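/- arXiv:1012.0671 — 2 statements merged into one kernel-verified Lean document; each statement's English description precedes it below -/
import Mathlib

section
/- If N > 5040 is a 6-free integer (no prime p satisfies p^6 ∣ N), then σ(N) < e^γ · N · log log N, i.e., Robin's inequality holds for N. -/
open Finset Filter

/-- Generalized Dedekind psi function `Ψ_t(n) = n ∏_{p ∣ n} (1 + 1/p + ⋯ + 1/p^(t-1))`. -/
noncomputable def Psi (t n : ℕ) : ℝ :=
  (n : ℝ) * ∏ p ∈ n.primeFactors, ∑ i ∈ Finset.range t, (1 : ℝ) / (p : ℝ) ^ i

/-- The primorial `N_n = ∏_{k=1}^n p_k`, the product of the first `n` primes. -/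
noncomputable def primorialAt (n : ℕ) : ℕ := ∏ k ∈ Finset.range n, Nat.nth Nat.Prime k

/-- The `n`-th prime `p_n` (so `nthPrime 1 = 2`). -/
noncomputable def nthPrime (n : ℕ) : ℕ := Nat.nth Nat.Prime (n - 1)

/-- The ratio `R_t(x) = Ψ_t(x) / (x log log x)`. -/
noncomputable def Rt (t n : ℕ) : ℝ := Psi t n / ((n : ℝ) * Real.log (Real.log n))

/-- The Riemann zeta value `ζ(t) = ∑_{n ≥ 1} n^{-t}` at an integer argument. -/
noncomputable def zetaNat (t : ℕ) : ℝ := ∑' k : ℕ, 1 / ((k : ℝ) + 1) ^ t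

section

open scoped ArithmeticFunction.vonMangoldt Nat

theorem log_factorial_eq_sum_vonMangoldt (n : ℕ) :
    Real.log (n ! : ℕ) = ∑ k ∈ Ioc 0 n, Λ k * ((n / k : ℕ) : ℝ) := by
  rw [← ArithmeticFunction.sum_Ioc_mul_zeta_eq_sum, ArithmeticFunction.vonMangoldt_mul_zeta]
  simp only [ArithmeticFunction.log_apply]
  induction n with
  | zero => simp
  | succ n ih =>
    rw [Nat.factorial_succ, ← Finset.insert_Ioc_right_eq_Ioc_add_one (Nat.zero_le n),
      sum_insert (by simp), Nat.cast_mul, Real.log_mul (by positivity) (by positivity), ih]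

theorem log_factorial_div_eq_sum_vonMangoldt (n d : ℕ) :
    Real.log ((n / d) ! : ℕ) = ∑ k ∈ Ioc 0 n, Λ k * ((n / k / d : ℕ) : ℝ) := by
  rw [log_factorial_eq_sum_vonMangoldt]
  have h : Ioc 0 (n / d) ⊆ Ioc 0 n := Ioc_subset_Ioc_right (Nat.div_le_self _ _)
  rw [← sum_subset h]
  · refine sum_congr rfl fun k _ => ?_
    rw [Nat.div_div_eq_div_mul, Nat.div_div_eq_div_mul, mul_comm d k]
  · intro k hk hk'
    simp only [mem_Ioc, not_and, not_le] at hk hk'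
    have : n / k / d = 0 := by
      rw [Nat.div_div_eq_div_mul, mul_comm, ← Nat.div_div_eq_div_mul]
      exact Nat.div_eq_of_lt (hk' hk.1)
    simp [this]

/-- Chebyshev's combination of log-factorials. -/
noncomputable def chebComb (n : ℕ) : ℝ :=
  Real.log (n ! : ℕ) - Real.log ((n / 2) ! : ℕ) - Real.log ((n / 3) ! : ℕ)
    - Real.log ((n / 5) ! : ℕ) + Real.log ((n / 30) ! : ℕ)

/-- The coefficients of the von Mangoldt function in `chebComb`. -/
noncomputable def chebCoeff (y : ℕ) : ℝ :=
  (y : ℝ) - ((y / 2 : ℕ) : ℝ) - ((y / 3 : ℕ) : ℝ) - ((y / 5 : ℕ) : ℝ) + ((y / 30 : ℕ) : ℝ)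

theorem chebCoeff_eq_intCast (y : ℕ) : chebCoeff y = (((y : ℤ) - ((y / 2 : ℕ) : ℤ)
    - ((y / 3 : ℕ) : ℤ) - ((y / 5 : ℕ) : ℤ) + ((y / 30 : ℕ) : ℤ) : ℤ) : ℝ) := by
  simp only [chebCoeff, Int.cast_sub, Int.cast_add, Int.cast_natCast]

theorem chebCoeff_nonneg (y : ℕ) : 0 ≤ chebCoeff y := by
  rw [chebCoeff_eq_intCast, Int.cast_nonneg_iff]
  omega

theorem chebCoeff_le_one (y : ℕ) : chebCoeff y ≤ 1 := by
  rw [chebCoeff_eq_intCast, ← Int.cast_one, Int.cast_le]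
  omega

theorem one_le_chebCoeff {y : ℕ} (h0 : 0 < y) (h6 : y < 6) : 1 ≤ chebCoeff y := by
  rw [chebCoeff_eq_intCast, ← Int.cast_one, Int.cast_le]
  omega

theorem chebComb_eq_sum (n : ℕ) : chebComb n = ∑ k ∈ Ioc 0 n, Λ k * chebCoeff (n / k) := by
  simp only [chebComb, log_factorial_div_eq_sum_vonMangoldt, chebCoeff]
  rw [log_factorial_eq_sum_vonMangoldt]
  simp only [← sum_sub_distrib, ← sum_add_distrib]
  exact sum_congr rfl fun k _ => by ring

theorem psi_natCast (n : ℕ) : Chebyshev.psi n = ∑ k ∈ Ioc 0 n, Λ k := by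
  simp [Chebyshev.psi]

theorem chebComb_le_psi (n : ℕ) : chebComb n ≤ Chebyshev.psi n := by
  rw [chebComb_eq_sum, psi_natCast]
  exact sum_le_sum fun k _ =>
    mul_le_of_le_one_right ArithmeticFunction.vonMangoldt_nonneg (chebCoeff_le_one _)

theorem psi_le_add_chebComb (n : ℕ) :
    Chebyshev.psi n ≤ Chebyshev.psi (n / 6 : ℕ) + chebComb n := by
  rw [chebComb_eq_sum, psi_natCast, psi_natCast]
  have h : Ioc 0 (n / 6) ⊆ Ioc 0 n := Ioc_subset_Ioc_right (Nat.div_le_self _ _)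
  rw [← sum_sdiff h, ← sum_sdiff (f := fun k => Λ k * _) h, add_comm, add_le_add_iff_left]
  have h1 : ∑ k ∈ Ioc 0 n \ Ioc 0 (n / 6), Λ k
      ≤ ∑ k ∈ Ioc 0 n \ Ioc 0 (n / 6), Λ k * chebCoeff (n / k) := by
    refine sum_le_sum fun k hk => ?_
    refine le_mul_of_one_le_right ArithmeticFunction.vonMangoldt_nonneg ?_
    simp only [Finset.mem_sdiff, Finset.mem_Ioc, not_and, not_le] at hk
    refine one_le_chebCoeff (Nat.div_pos hk.1.2 hk.1.1) ?_
    rw [Nat.div_lt_iff_lt_mul hk.1.1]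
    have := hk.2 hk.1.1
    omega
  have h2 : 0 ≤ ∑ k ∈ Ioc 0 (n / 6), Λ k * chebCoeff (n / k) :=
    sum_nonneg fun k _ => mul_nonneg ArithmeticFunction.vonMangoldt_nonneg (chebCoeff_nonneg _)
  linarith

theorem log_factorial_le {n : ℕ} (hn : n ≠ 0) :
    Real.log (n ! : ℕ) ≤ n * Real.log n - n + Real.log n / 2 + 1 := by
  obtain ⟨m, rfl⟩ := Nat.exists_eq_succ_of_ne_zero hn
  have h := Stirling.log_stirlingSeq'_antitone (Nat.zero_le m)
  simp only [Function.comp] at h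
  rw [Stirling.log_stirlingSeq_formula, Stirling.log_stirlingSeq_formula,
    Real.log_div (by positivity) (by positivity), Real.log_mul (by norm_num) (by positivity)] at h
  simp at h
  push_cast [Nat.succ_eq_add_one] at h ⊢
  linarith

/-- Tangent line inequality for `t log t - t`. -/
theorem mul_log_sub_tangent {s t : ℝ} (hs : 0 < s) (ht : 0 < t) :
    (t - s) * Real.log s ≤ (t * Real.log t - t) - (s * Real.log s - s) := by
  have h := Real.log_le_sub_one_of_pos (div_pos hs ht)
  rw [Real.log_div hs.ne' ht.ne'] at h
  have h2 : t * (Real.log s - Real.log t) ≤ t * (s / t - 1) := mul_le_mul_of_nonneg_left h ht.le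
  have : t * (s / t - 1) = s - t := by field_simp
  nlinarith

theorem log_factorial_floor_le {n d : ℕ} (hd : 0 < d) (hn : d ≤ n) :
    Real.log ((n / d) ! : ℕ) ≤ (n / d : ℝ) * Real.log (n / d) - (n / d)
      + Real.log (n / d) / 2 + 1 := by
  have hm : 1 ≤ n / d := Nat.div_pos hn hd
  have hle : ((n / d : ℕ) : ℝ) ≤ (n : ℝ) / d := Nat.cast_div_le
  have hm' : (1 : ℝ) ≤ ((n / d : ℕ) : ℝ) := by exact_mod_cast hm
  have h1 := log_factorial_le (n := n / d) (Nat.one_le_iff_ne_zero.1 hm)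
  have hl := Real.log_le_log (by linarith) hle
  have ht := mul_log_sub_tangent (s := ((n / d : ℕ) : ℝ)) (t := (n : ℝ) / d) (by linarith)
    (by linarith)
  have := mul_nonneg (sub_nonneg.2 hle) (Real.log_nonneg hm')
  linarith

theorem le_log_factorial_floor {n d : ℕ} (hd : 0 < d) (hn : 2 * d ≤ n) :
    (n / d : ℝ) * Real.log (n / d) - (n / d) - Real.log (n / d) / 2 + 0.9
      ≤ Real.log ((n / d) ! : ℕ) := by
  set m := n / d with hm
  set y : ℝ := (n : ℝ) / d with hy
  have hd' : (0 : ℝ) < d := by exact_mod_cast hd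
  have hy2 : 2 ≤ y := by rw [hy, le_div_iff₀ hd']; exact_mod_cast hn
  have hlt : y ≤ m + 1 := by
    rw [hy, div_le_iff₀ hd']
    have := Nat.lt_div_mul_add (a := n) hd
    have h3 : n ≤ (n / d + 1) * d := by linarith
    exact_mod_cast h3
  have h1 := Stirling.le_log_factorial_stirling (Nat.succ_ne_zero m)
  rw [Nat.factorial_succ, Nat.cast_mul, Real.log_mul (x := ((m + 1 : ℕ) : ℝ)) (by positivity)
    (by positivity)] at h1
  simp only [Nat.succ_eq_add_one, Nat.cast_add, Nat.cast_one] at h1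
  have ht := mul_log_sub_tangent (s := y) (t := (m : ℝ) + 1) (by linarith) (by linarith)
  have hl : Real.log (m + 1) - Real.log y ≤ (m + 1 - y) / y := by
    rw [← Real.log_div (by linarith) (by linarith)]
    refine (Real.log_le_sub_one_of_pos (by positivity)).trans (le_of_eq ?_)
    field_simp
  have hl2 : (m + 1 - y) / y ≤ (m + 1 - y) / 2 :=
    div_le_div_of_nonneg_left (by linarith) (by norm_num) hy2
  have hl3 : 0.69 ≤ Real.log y := by
    have := Real.log_le_log (by norm_num) hy2
    have := Real.log_two_gt_d9
    linarith
  have hpi : 1.8 ≤ Real.log (2 * Real.pi) := by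
    rw [Real.le_log_iff_exp_le (by positivity)]
    have h3 := Real.exp_one_lt_d9
    have h4 : Real.exp (1.8) ≤ 6.2 := by
      have : Real.exp 1.8 = (Real.exp 1 ^ 9) ^ ((1:ℝ)/5) := by
        rw [← Real.exp_nat_mul, ← Real.exp_mul]; norm_num
      rw [this]
      have h5 : Real.exp 1 ^ 9 ≤ (6.2 : ℝ) ^ (5 : ℕ) := by
        calc Real.exp 1 ^ 9 ≤ 2.7182818286 ^ 9 := by gcongr
          _ ≤ _ := by norm_num
      calc (Real.exp 1 ^ 9) ^ ((1:ℝ)/5) ≤ ((6.2 : ℝ) ^ (5 : ℕ)) ^ ((1:ℝ)/5) := by gcongr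
        _ = 6.2 := by
          rw [← Real.rpow_natCast, ← Real.rpow_mul (by norm_num)]; norm_num
    have := Real.pi_gt_d2
    linarith
  have hl4 := mul_le_mul_of_nonneg_left hl3 (sub_nonneg.2 hlt)
  linarith

def lcmCheck : ℕ → ℕ → ℕ → Bool
  | 0, _, _ => true
  | k + 1, n, l => Nat.ble l (3 ^ n) && lcmCheck k (n + 1) (Nat.lcm l (n + 1))

theorem lcmUpto_succ (n : ℕ) : Nat.lcmUpto (n + 1) = Nat.lcm (Nat.lcmUpto n) (n + 1) := by
  unfold Nat.lcmUpto
  rw [← Finset.insert_Icc_right_eq_Icc_add_one (by omega), Finset.lcm_insert, Nat.lcm_comm]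
  rfl

theorem lcmUpto_le_of_lcmCheck : ∀ (k n : ℕ), lcmCheck k n (Nat.lcmUpto n) = true →
    ∀ i < k, Nat.lcmUpto (n + i) ≤ 3 ^ (n + i) := by
  intro k
  induction k with
  | zero => intro n _ i hi; omega
  | succ k ih =>
    intro n h i hi
    simp only [lcmCheck, Bool.and_eq_true, Nat.ble_eq] at h
    rw [← lcmUpto_succ] at h
    rcases i with _ | i
    · exact h.1
    · have := ih (n + 1) h.2 i (by omega)
      rwa [show n + 1 + i = n + (i + 1) by ring] at this

theorem lcmCheck_5000 : lcmCheck 5000 0 1 = true := by decide +kernel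

theorem log_two_bounds : 0.693147 < Real.log 2 ∧ Real.log 2 < 0.693148 := by
  have h1 := Real.log_two_gt_d9
  have h2 := Real.log_two_lt_d9
  constructor <;> linarith

theorem log_three_bounds : 1.098612 < Real.log 3 ∧ Real.log 3 < 1.098613 := by
  have h1 := Real.log_three_gt_d9
  have h2 := Real.log_three_lt_d9
  constructor <;> linarith

theorem log_five_bounds : 1.609437 < Real.log 5 ∧ Real.log 5 < 1.609438 := by
  have h1 := Real.log_five_gt_d9
  have h2 := Real.log_five_lt_d9
  constructor <;> linarith

theorem psi_le_of_lt_5000 {n : ℕ} (hn : n < 5000) : Chebyshev.psi n ≤ 1.11 * n := by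
  have h := lcmUpto_le_of_lcmCheck 5000 0
    (by rw [show Nat.lcmUpto 0 = 1 from rfl]; exact lcmCheck_5000) n hn
  rw [zero_add] at h
  rw [Chebyshev.psi_eq_log_lcmUpto]
  have h2 : Real.log (Nat.lcmUpto n) ≤ Real.log ((3 : ℝ) ^ n) := by
    apply Real.log_le_log
    · exact_mod_cast Nat.lcmUpto_pos n
    · exact_mod_cast h
  rw [Real.log_pow] at h2
  have := log_three_bounds.2
  have hn0 : (0 : ℝ) ≤ n := Nat.cast_nonneg n
  nlinarith

/-- Tangent line bound for the logarithm. -/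
theorem log_le_div_add_log_sub_one {t K : ℝ} (ht : 0 < t) (hK : 0 < K) :
    Real.log t ≤ t / K + Real.log K - 1 := by
  have := Real.log_le_sub_one_of_pos (div_pos ht hK)
  rw [Real.log_div ht.ne' hK.ne'] at this
  linarith

theorem log_30 : Real.log 30 = Real.log 2 + Real.log 3 + Real.log 5 := by
  rw [← Real.log_mul (by norm_num) (by norm_num), ← Real.log_mul (by norm_num) (by norm_num)]
  norm_num

theorem log_natCast_div {n d : ℕ} (hn : n ≠ 0) (hd : d ≠ 0) :
    Real.log ((n : ℝ) / d) = Real.log n - Real.log d :=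
  Real.log_div (by exact_mod_cast hn) (by exact_mod_cast hd)

theorem chebComb_le {n : ℕ} (hn : 60 ≤ n) :
    chebComb n ≤ 0.9213 * n + 2.5 * Real.log n - 4.1 := by
  have h1 := log_factorial_le (n := n) (by omega)
  have h2 := le_log_factorial_floor (n := n) (d := 2) (by norm_num) (by omega)
  have h3 := le_log_factorial_floor (n := n) (d := 3) (by norm_num) (by omega)
  have h5 := le_log_factorial_floor (n := n) (d := 5) (by norm_num) (by omega)
  have h30 := log_factorial_floor_le (n := n) (d := 30) (by norm_num) (by omega)
  rw [log_natCast_div (by omega) (by norm_num)] at h2 h3 h5 h30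
  push_cast at h2 h3 h5 h30
  rw [log_30] at h30
  have l2 := log_two_bounds
  have l3 := log_three_bounds
  have l5 := log_five_bounds
  unfold chebComb
  have hn0 : (60 : ℝ) ≤ n := by exact_mod_cast hn
  have m2 := mul_lt_mul_of_pos_left l2.2 (show (0:ℝ) < n by linarith)
  have m3 := mul_lt_mul_of_pos_left l3.2 (show (0:ℝ) < n by linarith)
  have m5 := mul_lt_mul_of_pos_left l5.2 (show (0:ℝ) < n by linarith)
  linarith

theorem le_chebComb {n : ℕ} (hn : 60 ≤ n) :
    0.92129 * n - 2.5 * Real.log n + 2 ≤ chebComb n := by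
  have h1 := le_log_factorial_floor (n := n) (d := 1) (by norm_num) (by omega)
  have h2 := log_factorial_floor_le (n := n) (d := 2) (by norm_num) (by omega)
  have h3 := log_factorial_floor_le (n := n) (d := 3) (by norm_num) (by omega)
  have h5 := log_factorial_floor_le (n := n) (d := 5) (by norm_num) (by omega)
  have h30 := le_log_factorial_floor (n := n) (d := 30) (by norm_num) (by omega)
  rw [log_natCast_div (by omega) (by norm_num)] at h1 h2 h3 h5 h30
  simp only [Nat.div_one, Nat.cast_one, Real.log_one, div_one, sub_zero] at h1
  push_cast at h2 h3 h5 h30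
  rw [log_30] at h30
  have l2 := log_two_bounds
  have l3 := log_three_bounds
  have l5 := log_five_bounds
  unfold chebComb
  have hn0 : (60 : ℝ) ≤ n := by exact_mod_cast hn
  have m2 := mul_lt_mul_of_pos_left l2.1 (show (0:ℝ) < n by linarith)
  have m3 := mul_lt_mul_of_pos_left l3.1 (show (0:ℝ) < n by linarith)
  have m5 := mul_lt_mul_of_pos_left l5.1 (show (0:ℝ) < n by linarith)
  linarith

theorem log_5000_lt : Real.log 5000 < 8.52 := by
  have : Real.log 5000 = 3 * Real.log 2 + 4 * Real.log 5 := by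
    rw [show (5000 : ℝ) = 2 ^ 3 * 5 ^ 4 by norm_num, Real.log_mul (by norm_num) (by norm_num),
      Real.log_pow, Real.log_pow]
    norm_num
  linarith [log_two_bounds.2, log_five_bounds.2]

/-- Chebyshev's upper bound. -/
theorem psi_natCast_le (n : ℕ) : Chebyshev.psi n ≤ 1.11 * n := by
  induction n using Nat.strong_induction_on with
  | _ n ih =>
    rcases lt_or_ge n 5000 with h | h
    · exact psi_le_of_lt_5000 h
    · have h1 := ih (n / 6) (by omega)
      have h2 := psi_le_add_chebComb n
      have h3 := chebComb_le (n := n) (by omega)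
      have h4 : ((n / 6 : ℕ) : ℝ) ≤ (n : ℝ) / 6 := by exact_mod_cast Nat.cast_div_le (α := ℝ)
      have hn : (5000 : ℝ) ≤ n := by exact_mod_cast h
      have h5 := log_le_div_add_log_sub_one (t := n) (K := 5000) (by linarith) (by norm_num)
      have := log_5000_lt
      linarith

theorem psi_le_mul {x : ℝ} (hx : 0 ≤ x) : Chebyshev.psi x ≤ 1.11 * x := by
  rw [Chebyshev.psi_eq_psi_coe_floor]
  exact (psi_natCast_le _).trans (by linarith [Nat.floor_le hx])

/-- Chebyshev's lower bound. -/
theorem le_psi_natCast (n : ℕ) : 0.92 * n - 18 ≤ Chebyshev.psi n := by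
  rcases lt_or_ge n 60 with h | h
  · have h1 := Chebyshev.psi_ge n
    have hn : (n : ℝ) ≤ 59 := by exact_mod_cast (by omega : n ≤ 59)
    have h2 : Real.log (n + 1) ≤ Real.log (2 ^ 6) := Real.log_le_log (by positivity) (by linarith)
    rw [Real.log_pow] at h2
    push_cast at h2
    have l2 := log_two_bounds
    have m2 := mul_le_mul_of_nonneg_left l2.1.le (show (0:ℝ) ≤ n by positivity)
    linarith
  · have h1 := (le_chebComb h).trans (chebComb_le_psi n)
    have hn : (60 : ℝ) ≤ n := by exact_mod_cast h
    have h5 := log_le_div_add_log_sub_one (t := n) (K := 5000) (by linarith) (by norm_num)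
    have := log_5000_lt
    linarith

theorem le_psi_natCast_of_le {n : ℕ} (hn : 20000 ≤ n) : 0.92 * n ≤ Chebyshev.psi n := by
  have h1 := (le_chebComb (by omega)).trans (chebComb_le_psi n)
  have hn : (20000 : ℝ) ≤ n := by exact_mod_cast hn
  have h5 := log_le_div_add_log_sub_one (t := n) (K := 20000) (by linarith) (by norm_num)
  have h6 : Real.log 20000 = 2 * Real.log 2 + Real.log 5000 := by
    rw [show (20000 : ℝ) = 2 ^ 2 * 5000 by norm_num, Real.log_mul (by norm_num) (by norm_num),
      Real.log_pow]
    norm_num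
  linarith [log_two_bounds.2, log_5000_lt]

/-- The function `∫₁ʸ {t} / t dt` in closed form. -/
noncomputable def fracInt (y : ℝ) : ℝ :=
  y - 1 - ⌊y⌋₊ * Real.log y + Real.log (⌊y⌋₊ ! : ℕ)

theorem fracInt_one : fracInt 1 = 0 := by simp [fracInt]

theorem fracInt_natCast (m : ℕ) : fracInt m = m - 1 - m * Real.log m + Real.log (m ! : ℕ) := by
  simp [fracInt]

theorem fracInt_le_half_log {y : ℝ} (hy : 1 ≤ y) : fracInt y ≤ Real.log y / 2 := by
  have hm1 : 1 ≤ ⌊y⌋₊ := (Nat.one_le_floor_iff y).2 hy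
  have hle := Nat.floor_le (a := y) (by linarith)
  have hlt := Nat.lt_floor_add_one y
  unfold fracInt
  generalize ⌊y⌋₊ = m at hm1 hle hlt ⊢
  have hm : (1 : ℝ) ≤ m := by exact_mod_cast hm1
  rcases le_total y (m + 1 / 2) with h | h
  · have h1 := log_factorial_le (n := m) (by omega)
    have h2 := Real.log_le_sub_one_of_pos (show 0 < (m : ℝ) / y by positivity)
    rw [Real.log_div (by positivity) (by positivity)] at h2
    have h3 : ((m : ℝ) + 1 / 2) * ((y - m) / y) ≥ y - m := by
      rw [ge_iff_le, ← mul_div_assoc, le_div_iff₀ (by linarith)]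
      nlinarith
    have h4 : (m : ℝ) / y - 1 = - ((y - m) / y) := by field_simp; ring
    rw [h4] at h2
    nlinarith
  · have h1 := log_factorial_le (n := m + 1) (by omega)
    rw [Nat.factorial_succ, Nat.cast_mul, Real.log_mul (x := ((m + 1 : ℕ) : ℝ)) (by positivity)
      (by positivity)] at h1
    simp only [Nat.cast_add, Nat.cast_one] at h1
    have h2 := Real.log_le_sub_one_of_pos (show 0 < ((m : ℝ) + 1) / y by positivity)
    rw [Real.log_div (by positivity) (by positivity)] at h2
    have h3 : ((m : ℝ) + 1 / 2) * ((m + 1 - y) / y) ≤ m + 1 - y := by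
      rw [← mul_div_assoc, div_le_iff₀ (by linarith)]
      nlinarith
    have h4 : ((m : ℝ) + 1) / y - 1 = (m + 1 - y) / y := by field_simp
    rw [h4] at h2
    nlinarith

theorem fracInt_of_mem_Icc {y : ℝ} {m : ℕ} (h1 : (m : ℝ) ≤ y) (h2 : y ≤ m + 1) (hm : 1 ≤ m) :
    fracInt y = y - 1 - m * Real.log y + Real.log (m ! : ℕ) := by
  rcases h2.lt_or_eq with h | h
  · have : ⌊y⌋₊ = m := by
      rw [Nat.floor_eq_iff ((Nat.cast_nonneg m).trans h1)]
      exact ⟨h1, h⟩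
    rw [fracInt, this]
  · have h3 : y = ((m + 1 : ℕ) : ℝ) := by push_cast; exact h
    rw [h3, fracInt_natCast, Nat.factorial_succ, Nat.cast_mul (m + 1),
      Real.log_mul (x := ((m + 1 : ℕ) : ℝ)) (by positivity) (by positivity)]
    push_cast
    ring

theorem fracInt_mono_aux {y z : ℝ} {m : ℕ} (hm : 1 ≤ m) (h1 : (m : ℝ) ≤ y) (hyz : y ≤ z)
    (h2 : z ≤ m + 1) : fracInt y ≤ fracInt z := by
  rw [fracInt_of_mem_Icc h1 (hyz.trans h2) hm, fracInt_of_mem_Icc (h1.trans hyz) h2 hm]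
  have hm' : (1 : ℝ) ≤ m := by exact_mod_cast hm
  have hy : 0 < y := by linarith
  have h := Real.log_le_sub_one_of_pos (show 0 < z / y by apply div_pos <;> linarith)
  rw [Real.log_div (by linarith) (by linarith)] at h
  have h4 : z / y - 1 = (z - y) / y := by field_simp
  rw [h4] at h
  have h3 : (m : ℝ) * ((z - y) / y) ≤ z - y := by
    rw [← mul_div_assoc, div_le_iff₀ hy]
    nlinarith
  nlinarith

theorem fracInt_mono {y z : ℝ} (hy : 1 ≤ y) (hyz : y ≤ z) : fracInt y ≤ fracInt z := by
  have hy0 : 0 ≤ y := by linarith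
  have hz0 : 0 ≤ z := by linarith
  have hm1 : 1 ≤ ⌊y⌋₊ := (Nat.one_le_floor_iff y).2 hy
  rcases (Nat.floor_le_floor hyz).eq_or_lt with h | h
  · refine fracInt_mono_aux hm1 (Nat.floor_le hy0) hyz ?_
    rw [h]
    exact (Nat.lt_floor_add_one z).le
  · have key : ∀ k : ℕ, fracInt ((⌊y⌋₊ + 1 : ℕ) : ℝ) ≤ fracInt ((⌊y⌋₊ + 1 + k : ℕ) : ℝ) := by
      intro k
      induction k with
      | zero => simp
      | succ k ih =>
        refine ih.trans (fracInt_mono_aux (m := ⌊y⌋₊ + 1 + k) (by omega) le_rfl ?_ ?_)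
        · exact_mod_cast (by omega)
        · push_cast
          linarith
    obtain ⟨k, hk⟩ := Nat.exists_eq_add_of_le (Nat.succ_le_of_lt h)
    have h1 : fracInt y ≤ fracInt ((⌊y⌋₊ + 1 : ℕ) : ℝ) := by
      refine fracInt_mono_aux hm1 (Nat.floor_le hy0) ?_ ?_
      · push_cast
        exact (Nat.lt_floor_add_one y).le
      · push_cast
        exact le_rfl
    have h2 : fracInt ((⌊z⌋₊ : ℕ) : ℝ) ≤ fracInt z :=
      fracInt_mono_aux (((Nat.one_le_floor_iff z).2 (hy.trans hyz))) le_rfl (Nat.floor_le hz0)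
        (Nat.lt_floor_add_one z).le
    refine h1.trans ((key k).trans ?_)
    rwa [hk] at h2

theorem fracInt_nonneg {y : ℝ} (hy : 1 ≤ y) : 0 ≤ fracInt y := by
  rw [← fracInt_one]
  exact fracInt_mono le_rfl hy

theorem sum_Ioc_sum_Ioc_div {M : Type*} [AddCommMonoid M] (F : ℕ → ℕ → M) (N : ℕ) :
    ∑ n ∈ Ioc 0 N, ∑ m ∈ Ioc 0 (N / n), F n m
      = ∑ k ∈ Ioc 0 N, ∑ x ∈ k.divisorsAntidiagonal, F x.1 x.2 := by
  rw [sum_sigma', sum_sigma']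
  refine sum_nbij' (fun x => ⟨x.1 * x.2, (x.1, x.2)⟩) (fun x => ⟨x.2.1, x.2.2⟩) ?_ ?_ ?_ ?_ ?_
  · rintro ⟨n, m⟩ h
    simp only [Finset.mem_sigma, Finset.mem_Ioc, Nat.mem_divisorsAntidiagonal] at h ⊢
    have hnm : 0 < n * m := Nat.mul_pos h.1.1 h.2.1
    have : m * n ≤ N := (Nat.le_div_iff_mul_le h.1.1).1 h.2.2
    exact ⟨⟨hnm, by linarith⟩, trivial, hnm.ne'⟩
  · rintro ⟨k, n, m⟩ h
    simp only [Finset.mem_sigma, Finset.mem_Ioc, Nat.mem_divisorsAntidiagonal] at h ⊢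
    obtain ⟨⟨h1, h2⟩, rfl, h3⟩ := h
    have hn : 0 < n := Nat.pos_of_mul_pos_right h1
    have hm : 0 < m := Nat.pos_of_mul_pos_left h1
    exact ⟨⟨hn, (Nat.le_mul_of_pos_right n hm).trans h2⟩, hm,
      (Nat.le_div_iff_mul_le hn).2 (by linarith)⟩
  · rintro ⟨n, m⟩ h
    rfl
  · rintro ⟨k, n, m⟩ h
    simp only [Finset.mem_sigma, Nat.mem_divisorsAntidiagonal] at h
    obtain ⟨_, rfl, _⟩ := h
    rfl
  · rintro ⟨n, m⟩ h
    rfl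

theorem sum_Ioc_log (n : ℕ) : ∑ k ∈ Ioc 0 n, Real.log k = Real.log (n ! : ℕ) := by
  induction n with
  | zero => simp
  | succ n ih =>
    rw [Nat.factorial_succ, ← Finset.insert_Ioc_right_eq_Ioc_add_one (Nat.zero_le n),
      sum_insert (by simp), Nat.cast_mul, Real.log_mul (by positivity) (by positivity), ih]

/-- The sum `∑ log k log (N / k)`. -/
noncomputable def logLogSum (N : ℕ) : ℝ :=
  ∑ k ∈ Ioc 0 N, Real.log k * (Real.log N - Real.log k)

theorem sum_vonMangoldt_mul_eq_logLogSum (N : ℕ) :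
    ∑ n ∈ Ioc 0 N, Λ n * (((N / n : ℕ) : ℝ) * Real.log ((N : ℝ) / n)
      - Real.log ((N / n) ! : ℕ)) = logLogSum N := by
  have h : ∀ n ∈ Ioc 0 N, Λ n * (((N / n : ℕ) : ℝ) * Real.log ((N : ℝ) / n)
      - Real.log ((N / n) ! : ℕ))
      = ∑ m ∈ Ioc 0 (N / n), Λ n * (Real.log N - Real.log ((n * m : ℕ) : ℝ)) := by
    intro n hn
    rw [Finset.mem_Ioc] at hn
    rw [← mul_sum, ← sum_Ioc_log, Real.log_div (by norm_cast; omega) (by norm_cast; omega)]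
    congr 1
    have : ((N / n : ℕ) : ℝ) = ∑ m ∈ Ioc 0 (N / n), (1 : ℝ) := by simp
    rw [this, sum_mul, ← sum_sub_distrib]
    refine sum_congr rfl fun m hm => ?_
    rw [Finset.mem_Ioc] at hm
    rw [Nat.cast_mul, Real.log_mul (by norm_cast; omega) (by norm_cast; omega)]
    ring
  rw [sum_congr rfl h, sum_Ioc_sum_Ioc_div, logLogSum]
  refine sum_congr rfl fun k _ => ?_
  have h2 : ∀ x ∈ k.divisorsAntidiagonal, Λ x.1 * (Real.log N - Real.log ((x.1 * x.2 : ℕ) : ℝ))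
      = Λ x.1 * (Real.log N - Real.log k) := by
    intro x hx
    rw [(Nat.mem_divisorsAntidiagonal.1 hx).1]
  rw [sum_congr rfl h2, ← sum_mul, Nat.sum_divisorsAntidiagonal (fun i _ => Λ i),
    ArithmeticFunction.vonMangoldt_sum]

/-- Chebyshev-type identity relating `ψ` averages to `logLogSum`. -/
theorem sum_vonMangoldt_div_sub (N : ℕ) :
    ∑ n ∈ Ioc 0 N, Λ n * ((N : ℝ) / n - 1)
      = logLogSum N + ∑ n ∈ Ioc 0 N, Λ n * fracInt ((N : ℝ) / n) := by
  rw [← sum_vonMangoldt_mul_eq_logLogSum, ← sum_add_distrib]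
  refine sum_congr rfl fun n _ => ?_
  rw [fracInt, Nat.floor_div_natCast, Nat.floor_natCast]
  ring

theorem psi_natCast_succ (n : ℕ) :
    Chebyshev.psi ((n + 1 : ℕ) : ℝ) = Chebyshev.psi n + Λ (n + 1) := by
  rw [psi_natCast, psi_natCast, ← Finset.insert_Ioc_right_eq_Ioc_add_one (Nat.zero_le n),
    sum_insert (by simp), add_comm]

theorem sum_vonMangoldt_mul (g : ℕ → ℝ) (N : ℕ) :
    ∑ n ∈ Ioc 0 (N + 1), Λ n * g n = Chebyshev.psi ((N + 1 : ℕ) : ℝ) * g (N + 1)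
      + ∑ n ∈ Ioc 0 N, Chebyshev.psi n * (g n - g (n + 1)) := by
  induction N with
  | zero => simp [Chebyshev.psi_one]
  | succ N ih =>
    rw [← Finset.insert_Ioc_right_eq_Ioc_add_one (Nat.zero_le (N + 1)), sum_insert (by simp), ih,
      ← Finset.insert_Ioc_right_eq_Ioc_add_one (Nat.zero_le N), sum_insert (by simp),
      psi_natCast_succ (N + 1)]
    ring

theorem sum_natCast_mul (g : ℕ → ℝ) (N : ℕ) :
    ∑ n ∈ Ioc 0 (N + 1), g n = ((N + 1 : ℕ) : ℝ) * g (N + 1)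
      + ∑ n ∈ Ioc 0 N, (n : ℝ) * (g n - g (n + 1)) := by
  induction N with
  | zero => simp
  | succ N ih =>
    rw [← Finset.insert_Ioc_right_eq_Ioc_add_one (Nat.zero_le (N + 1)), sum_insert (by simp), ih,
      ← Finset.insert_Ioc_right_eq_Ioc_add_one (Nat.zero_le N), sum_insert (by simp)]
    push_cast
    ring

/-- The antiderivative `t log² t - 2 t log t + 2 t` of `log²`. -/
noncomputable def logSqInt (t : ℝ) : ℝ := t * Real.log t ^ 2 - 2 * t * Real.log t + 2 * t

theorem hasDerivAt_logSqInt {t : ℝ} (ht : 0 < t) :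
    HasDerivAt logSqInt (Real.log t ^ 2) t := by
  have h1 := Real.hasDerivAt_log ht.ne'
  have h2 := ((hasDerivAt_id t).mul (h1.pow 2)).sub (((hasDerivAt_id t).const_mul 2).mul h1)
  have h3 := h2.add ((hasDerivAt_id t).const_mul 2)
  refine h3.congr_deriv ?_
  simp only [id, Pi.pow_apply]
  field_simp
  ring

theorem logSqInt_succ_sub (k : ℕ) (hk : 1 ≤ k) :
    Real.log k ^ 2 ≤ logSqInt (k + 1) - logSqInt k ∧
      logSqInt (k + 1) - logSqInt k ≤ Real.log (k + 1) ^ 2 := by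
  have hk' : (1 : ℝ) ≤ k := by exact_mod_cast hk
  obtain ⟨c, hc, h⟩ := exists_hasDerivAt_eq_slope logSqInt (fun t => Real.log t ^ 2)
    (show (k : ℝ) < k + 1 by linarith)
    (fun t ht => (hasDerivAt_logSqInt (by linarith [ht.1])).continuousAt.continuousWithinAt)
    (fun t ht => hasDerivAt_logSqInt (by linarith [ht.1]))
  rw [add_sub_cancel_left, div_one] at h
  rw [← h]
  have h0 := Real.log_nonneg hk'
  have h1 := Real.log_le_log (by linarith) hc.1.le
  have h2 := Real.log_le_log (by linarith [hc.1]) hc.2.le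
  constructor
  · gcongr
  · have := h0.trans h1
    gcongr

theorem logSqInt_le_sum {N : ℕ} (hN : 1 ≤ N) :
    logSqInt N - 2 ≤ ∑ k ∈ Ioc 0 N, Real.log k ^ 2 := by
  induction N, hN using Nat.le_induction with
  | base => simp [logSqInt]
  | succ n hn ih =>
    rw [← Finset.insert_Ioc_right_eq_Ioc_add_one (Nat.zero_le n), sum_insert (by simp)]
    have := (logSqInt_succ_sub n hn).2
    push_cast
    linarith

theorem sum_le_logSqInt {N : ℕ} (hN : 1 ≤ N) :
    ∑ k ∈ Ioc 0 N, Real.log k ^ 2 ≤ logSqInt N - 2 + Real.log N ^ 2 := by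
  induction N, hN using Nat.le_induction with
  | base => simp [logSqInt]
  | succ n hn ih =>
    rw [← Finset.insert_Ioc_right_eq_Ioc_add_one (Nat.zero_le n), sum_insert (by simp)]
    have := (logSqInt_succ_sub n hn).1
    push_cast
    linarith

theorem logLogSum_eq (N : ℕ) : logLogSum N =
    Real.log N * Real.log (N ! : ℕ) - ∑ k ∈ Ioc 0 N, Real.log k ^ 2 := by
  rw [logLogSum, ← sum_Ioc_log, mul_sum, ← sum_sub_distrib]
  exact sum_congr rfl fun k _ => by ring

theorem le_log_factorial (n : ℕ) : n * Real.log n - n ≤ Real.log (n ! : ℕ) := by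
  rcases Nat.eq_zero_or_pos n with rfl | hn
  · simp
  have h1 := Stirling.le_log_factorial_stirling hn.ne'
  have h2 : 0 ≤ Real.log n := Real.log_natCast_nonneg n
  have h3 : 0 ≤ Real.log (2 * Real.pi) := Real.log_nonneg (by linarith [Real.pi_gt_three])
  linarith

theorem logLogSum_le {N : ℕ} (hN : 1 ≤ N) :
    logLogSum N ≤ N * Real.log N - 2 * N + Real.log N ^ 2 / 2 + Real.log N + 2 := by
  have h1 := mul_le_mul_of_nonneg_left (log_factorial_le (n := N) (by omega))
    (Real.log_natCast_nonneg N)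
  have h2 := logSqInt_le_sum hN
  rw [logLogSum_eq]
  unfold logSqInt at h2
  nlinarith

theorem le_logLogSum {N : ℕ} (hN : 1 ≤ N) :
    N * Real.log N - 2 * N - Real.log N ^ 2 ≤ logLogSum N := by
  have h1 := mul_le_mul_of_nonneg_left (le_log_factorial N) (Real.log_natCast_nonneg N)
  have h2 := sum_le_logSqInt hN
  rw [logLogSum_eq]
  unfold logSqInt at h2
  nlinarith

theorem antitoneOn_fracInt_div (N : ℕ) :
    AntitoneOn (fun x : ℝ => fracInt ((N : ℝ) / x)) (Set.Icc ((1 : ℕ) : ℝ) N) := by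
  intro x hx y hy hxy
  simp only [Nat.cast_one, Set.mem_Icc] at hx hy
  refine fracInt_mono ?_ ?_
  · rw [le_div_iff₀ (by linarith), one_mul]
    exact hy.2
  · exact div_le_div_of_nonneg_left (by linarith) (by linarith) hxy

theorem integral_fracInt_div {N : ℕ} (hN : 1 ≤ N) :
    ∫ x in ((1 : ℕ) : ℝ)..N, fracInt ((N : ℝ) / x)
      = N * ∫ v in (1 / (N : ℝ))..1, fracInt (1 / v) := by
  have hN' : (N : ℝ) ≠ 0 := by norm_cast; omega
  have h := intervalIntegral.integral_comp_div (a := ((1 : ℕ) : ℝ)) (b := N)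
    (fun v => fracInt (1 / v)) hN'
  rw [div_self hN', smul_eq_mul, Nat.cast_one] at h
  rw [← h, Nat.cast_one]
  congr 1
  ext x
  rw [one_div_div]

theorem sum_fracInt_eq {N : ℕ} (hN : 1 ≤ N) :
    ∑ n ∈ Ioc 0 N, fracInt ((N : ℝ) / n) = ∑ n ∈ Ico 1 N, fracInt ((N : ℝ) / n) := by
  obtain ⟨m, rfl⟩ := Nat.exists_eq_add_of_le' hN
  rw [← Finset.insert_Ioc_right_eq_Ioc_add_one (Nat.zero_le m), sum_insert (by simp),
    div_self (by positivity), fracInt_one, zero_add]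
  refine sum_congr ?_ fun _ _ => rfl
  ext x
  simp only [Finset.mem_Ioc, Finset.mem_Ico]
  omega

theorem integral_le_sum_fracInt {N : ℕ} (hN : 1 ≤ N) :
    N * ∫ v in (1 / (N : ℝ))..1, fracInt (1 / v) ≤ ∑ n ∈ Ioc 0 N, fracInt ((N : ℝ) / n) := by
  rw [← integral_fracInt_div hN, sum_fracInt_eq hN]
  exact AntitoneOn.integral_le_sum_Ico hN (antitoneOn_fracInt_div N)

theorem sum_fracInt_le_integral {N : ℕ} (hN : 1 ≤ N) :
    ∑ n ∈ Ioc 0 N, fracInt ((N : ℝ) / n)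
      ≤ N * (∫ v in (1 / (N : ℝ))..1, fracInt (1 / v)) + fracInt N := by
  have h := AntitoneOn.sum_le_integral_Ico hN (antitoneOn_fracInt_div N)
  rw [integral_fracInt_div hN, sum_Ico_add' (fun n : ℕ => fracInt ((N : ℝ) / n)) 1 N 1] at h
  have h2 : Ioc 0 N = insert 1 (Ico (1 + 1) (N + 1)) := by
    ext x
    simp only [Finset.mem_Ioc, Finset.mem_Ico, Finset.mem_insert]
    omega
  rw [h2, sum_insert (by simp), Nat.cast_one, div_one]
  linarith

theorem sum_fracInt_le {N : ℕ} : ∑ n ∈ Ioc 0 N, fracInt ((N : ℝ) / n) ≤ N / 2 := by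
  have h : ∑ n ∈ Ioc 0 N, fracInt ((N : ℝ) / n)
      ≤ ∑ n ∈ Ioc 0 N, (Real.log N - Real.log n) / 2 := by
    refine sum_le_sum fun n hn => ?_
    rw [Finset.mem_Ioc] at hn
    rw [← Real.log_div (by norm_cast; omega) (by norm_cast; omega)]
    refine fracInt_le_half_log ?_
    rw [le_div_iff₀ (by exact_mod_cast hn.1), one_mul]
    exact_mod_cast hn.2
  rw [← sum_div, sum_sub_distrib, sum_Ioc_log] at h
  simp only [sum_const, Nat.card_Ioc, tsub_zero, nsmul_eq_mul] at h
  linarith [le_log_factorial N]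

theorem intervalIntegrable_fracInt {a : ℝ} (ha : 0 < a) (ha1 : a ≤ 1) :
    IntervalIntegrable (fun v => fracInt (1 / v)) MeasureTheory.volume a 1 := by
  refine AntitoneOn.intervalIntegrable ?_
  rw [Set.uIcc_of_le ha1]
  intro x hx y hy hxy
  have hx0 : 0 < x := ha.trans_le hx.1
  have hy0 : 0 < y := ha.trans_le hy.1
  refine fracInt_mono ?_ ?_
  · rw [le_div_iff₀ hy0, one_mul]
    exact hy.2
  · exact div_le_div_of_nonneg_left (by linarith) hx0 hxy

theorem integral_fracInt_mono {a b : ℝ} (ha : 0 < a) (hab : a ≤ b) (hb : b ≤ 1) :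
    ∫ v in b..1, fracInt (1 / v) ≤ ∫ v in a..1, fracInt (1 / v) := by
  refine intervalIntegral.integral_mono_interval hab hb le_rfl ?_
    (intervalIntegrable_fracInt ha (hab.trans hb))
  filter_upwards [MeasureTheory.ae_restrict_mem measurableSet_Ioc] with v hv
  refine fracInt_nonneg ?_
  have := ha.trans hv.1
  rw [le_div_iff₀ this, one_mul]
  exact hv.2

/-- The sum `∑_{n ≤ N} Λ(n) fracInt (N / n)`. -/
noncomputable def mangoldtFracSum (N : ℕ) : ℝ := ∑ n ∈ Ioc 0 N, Λ n * fracInt ((N : ℝ) / n)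

theorem mangoldtFracSum_succ (N : ℕ) : mangoldtFracSum (N + 1) = ∑ n ∈ Ioc 0 N,
    Chebyshev.psi n * (fracInt (((N + 1 : ℕ) : ℝ) / n)
      - fracInt (((N + 1 : ℕ) : ℝ) / (n + 1 : ℕ))) := by
  rw [mangoldtFracSum, sum_vonMangoldt_mul (fun n => fracInt (((N + 1 : ℕ) : ℝ) / n)),
    div_self (by positivity), fracInt_one, mul_zero, zero_add]

theorem sum_fracInt_succ (N : ℕ) : ∑ n ∈ Ioc 0 (N + 1), fracInt (((N + 1 : ℕ) : ℝ) / n)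
    = ∑ n ∈ Ioc 0 N, (n : ℝ) * (fracInt (((N + 1 : ℕ) : ℝ) / n)
      - fracInt (((N + 1 : ℕ) : ℝ) / (n + 1 : ℕ))) := by
  rw [sum_natCast_mul (fun n => fracInt (((N + 1 : ℕ) : ℝ) / n)),
    div_self (by positivity), fracInt_one, mul_zero, zero_add]

theorem fracInt_div_sub_nonneg {N n : ℕ} (hn : n ∈ Ioc 0 N) :
    0 ≤ fracInt (((N + 1 : ℕ) : ℝ) / n) - fracInt (((N + 1 : ℕ) : ℝ) / (n + 1 : ℕ)) := by
  rw [Finset.mem_Ioc] at hn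
  rw [sub_nonneg]
  have hn0 : (0 : ℝ) < n := by exact_mod_cast hn.1
  refine fracInt_mono ?_ (div_le_div_of_nonneg_left (by positivity) hn0 (by push_cast; linarith))
  rw [le_div_iff₀ (by positivity), one_mul]
  exact_mod_cast (by omega)

theorem sum_fracInt_sub (N : ℕ) : ∑ n ∈ Ioc 0 N, (fracInt (((N + 1 : ℕ) : ℝ) / n)
      - fracInt (((N + 1 : ℕ) : ℝ) / (n + 1 : ℕ))) = fracInt (N + 1 : ℕ) := by
  have h : ∀ m : ℕ, ∑ n ∈ Ioc 0 m, (fracInt (((N + 1 : ℕ) : ℝ) / n)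
      - fracInt (((N + 1 : ℕ) : ℝ) / (n + 1 : ℕ)))
      = fracInt (((N + 1 : ℕ) : ℝ) / (1 : ℕ)) - fracInt (((N + 1 : ℕ) : ℝ) / (m + 1 : ℕ)) := by
    intro m
    induction m with
    | zero => simp
    | succ m ih =>
      rw [← Finset.insert_Ioc_right_eq_Ioc_add_one (Nat.zero_le m), sum_insert (by simp), ih]
      ring
  rw [h, div_self (by positivity), fracInt_one, Nat.cast_one, div_one, sub_zero]

theorem mangoldtFracSum_le {N : ℕ} (hN : 1 ≤ N) :
    mangoldtFracSum N ≤ 1.11 * ∑ n ∈ Ioc 0 N, fracInt ((N : ℝ) / n) := by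
  obtain ⟨m, rfl⟩ := Nat.exists_eq_add_of_le' hN
  rw [mangoldtFracSum_succ, sum_fracInt_succ, mul_sum]
  refine sum_le_sum fun n hn => ?_
  rw [← mul_assoc]
  exact mul_le_mul_of_nonneg_right (psi_natCast_le n) (fracInt_div_sub_nonneg hn)

theorem le_mangoldtFracSum {N : ℕ} (hN : 1 ≤ N) :
    0.92 * ∑ n ∈ Ioc 0 N, fracInt ((N : ℝ) / n) - 18 * fracInt N ≤ mangoldtFracSum N := by
  obtain ⟨m, rfl⟩ := Nat.exists_eq_add_of_le' hN
  rw [mangoldtFracSum_succ, sum_fracInt_succ, ← sum_fracInt_sub m, mul_sum, mul_sum,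
    ← sum_sub_distrib]
  refine sum_le_sum fun n hn => ?_
  rw [← mul_assoc, ← sub_mul]
  exact mul_le_mul_of_nonneg_right (le_psi_natCast n) (fracInt_div_sub_nonneg hn)

theorem sum_psi_div_eq {N : ℕ} (hN : 1 ≤ N) :
    N * ∑ n ∈ Ico 1 N, Chebyshev.psi n / (n * (n + 1)) = logLogSum N + mangoldtFracSum N := by
  obtain ⟨m, rfl⟩ := Nat.exists_eq_add_of_le' hN
  have hm : ((m + 1 : ℕ) : ℝ) ≠ 0 := by positivity
  have h := sum_vonMangoldt_mul (fun n => ((m + 1 : ℕ) : ℝ) / n - 1) m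
  rw [div_self hm, sub_self, mul_zero, zero_add] at h
  rw [mangoldtFracSum, ← sum_vonMangoldt_div_sub, h, mul_sum]
  have h2 : Ico 1 (m + 1) = Ioc 0 m := by
    ext x
    simp only [Finset.mem_Ioc, Finset.mem_Ico]
    omega
  rw [h2]
  refine sum_congr rfl fun n hn => ?_
  rw [Finset.mem_Ioc] at hn
  have hn0 : (n : ℝ) ≠ 0 := by norm_cast; omega
  have hn1 : (n : ℝ) + 1 ≠ 0 := by positivity
  push_cast
  field_simp
  ring

theorem sum_Ico_inv_succ_le {N M : ℕ} (hN : 1 ≤ N) (hM : N ≤ M) :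
    ∑ n ∈ Ico N M, (1 : ℝ) / (n + 1) ≤ Real.log M - Real.log N := by
  induction M, hM using Nat.le_induction with
  | base => simp
  | succ m hm ih =>
    rw [sum_Ico_succ_top hm]
    have hm0 : (0 : ℝ) < m := by exact_mod_cast (by omega : 0 < m)
    have h := Real.log_le_sub_one_of_pos (show 0 < (m : ℝ) / (m + 1) by positivity)
    rw [Real.log_div (by positivity) (by positivity)] at h
    have h2 : (m : ℝ) / (m + 1) - 1 = - (1 / (m + 1)) := by field_simp; ring
    rw [h2] at h
    push_cast
    linarith

theorem log_80000_bounds : 11.28 < Real.log 80000 ∧ Real.log 80000 < 11.3 := by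
  have : Real.log 80000 = 7 * Real.log 2 + 4 * Real.log 5 := by
    rw [show (80000 : ℝ) = 2 ^ 7 * 5 ^ 4 by norm_num, Real.log_mul (by norm_num) (by norm_num),
      Real.log_pow, Real.log_pow]
    norm_num
  have := log_two_bounds
  have := log_five_bounds
  constructor <;> linarith

theorem log_sq_div_le {x : ℝ} (hx : 80000 ≤ x) : Real.log x ^ 2 ≤ 0.0016 * x := by
  have hx0 : 0 < x := by linarith
  have h8 : Real.exp 2 ≤ 80000 := by
    rw [← Real.le_log_iff_exp_le (by norm_num)]
    linarith [log_80000_bounds.1]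
  have h := Real.log_div_sqrt_antitoneOn (Set.mem_ofPred.2 h8) (Set.mem_ofPred.2 (h8.trans hx)) hx
  simp only at h
  have hl : 0 ≤ Real.log x := Real.log_nonneg (by linarith)
  have h2 : (Real.log x / √x) ^ 2 ≤ (Real.log 80000 / √80000) ^ 2 := by gcongr
  rw [div_pow, div_pow, Real.sq_sqrt hx0.le, Real.sq_sqrt (by norm_num), div_le_iff₀ hx0] at h2
  refine h2.trans (mul_le_mul_of_nonneg_right ?_ hx0.le)
  rw [div_le_iff₀ (by norm_num)]
  nlinarith [log_80000_bounds.1, log_80000_bounds.2]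

/-- A one-sided bound for the logarithmic averages of `ψ(n) - n`. -/
theorem neg_le_sum_psi_sub {N M : ℕ} (hN : 80000 ≤ N) (hM : N ≤ M) :
    -0.1 ≤ ∑ n ∈ Ico N M, (Chebyshev.psi n - n) / (n * (n + 1)) := by
  have hN' : (80000 : ℝ) ≤ N := by exact_mod_cast hN
  have hM' : (N : ℝ) ≤ M := by exact_mod_cast hM
  have hsplit : ∑ n ∈ Ico N M, (Chebyshev.psi n - n) / (n * (n + 1))
      = ∑ n ∈ Ico 1 M, Chebyshev.psi n / (n * (n + 1))
        - ∑ n ∈ Ico 1 N, Chebyshev.psi n / (n * (n + 1)) - ∑ n ∈ Ico N M, (1 : ℝ) / (n + 1) := by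
    rw [← sum_Ico_consecutive _ (by omega : 1 ≤ N) hM, add_sub_cancel_left, ← sum_sub_distrib]
    refine sum_congr rfl fun n hn => ?_
    rw [Finset.mem_Ico] at hn
    have hn0 : (n : ℝ) ≠ 0 := by norm_cast; omega
    have hn1 : (n : ℝ) + 1 ≠ 0 := by positivity
    field_simp
  have hI := sum_Ico_inv_succ_le (by omega : 1 ≤ N) hM
  have aux : ∀ {X : ℕ}, 80000 ≤ X → (∑ n ∈ Ico 1 X, Chebyshev.psi n / (n * (n + 1))
      = logLogSum X / X + mangoldtFracSum X / X) := by
    intro X hX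
    have hX0 : (0 : ℝ) < X := by exact_mod_cast (by omega : 0 < X)
    rw [← add_div, ← sum_psi_div_eq (by omega : 1 ≤ X), mul_div_cancel_left₀ _ hX0.ne']
  rw [hsplit, aux hN, aux (hN.trans hM)]
  have hMpos : (0 : ℝ) < M := by linarith
  have hNpos : (0 : ℝ) < N := by linarith
  have hlM := log_sq_div_le (hN'.trans hM')
  have hlN := log_sq_div_le hN'
  have hlogN : 11 ≤ Real.log N := by
    linarith [Real.log_le_log (by norm_num) hN', log_80000_bounds.1]
  have hlogM : 11 ≤ Real.log M := by
    linarith [Real.log_le_log (by linarith) hM']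
  have fN : fracInt N ≤ 0.0001 * N := by
    refine (fracInt_le_half_log (by linarith)).trans ?_
    nlinarith
  have fM : fracInt M ≤ 0.0001 * M := by
    refine (fracInt_le_half_log (by linarith)).trans ?_
    nlinarith
  have v1 : Real.log M - 2 - 0.0016 ≤ logLogSum M / M := by
    rw [le_div_iff₀ hMpos]
    nlinarith [le_logLogSum (by omega : 1 ≤ M)]
  have v2 : logLogSum N / N ≤ Real.log N - 2 + 0.001 := by
    rw [div_le_iff₀ hNpos]
    nlinarith [logLogSum_le (by omega : 1 ≤ N)]
  set IM := ∫ v in (1 / (M : ℝ))..1, fracInt (1 / v) with hIM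
  set IN := ∫ v in (1 / (N : ℝ))..1, fracInt (1 / v) with hIN
  have hmono : IN ≤ IM := by
    refine integral_fracInt_mono (by positivity) ?_ ?_
    · exact one_div_le_one_div_of_le hNpos hM'
    · rw [div_le_iff₀ hNpos]
      linarith
  have s1 := integral_le_sum_fracInt (by omega : 1 ≤ M)
  have s2 := sum_fracInt_le_integral (by omega : 1 ≤ N)
  have s3 := (integral_le_sum_fracInt (by omega : 1 ≤ N)).trans sum_fracInt_le
  rw [← hIM] at s1
  rw [← hIN] at s2 s3
  have hIN2 : IN ≤ 1 / 2 := by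
    by_contra hc
    push Not at hc
    nlinarith
  have m1 : 0.92 * IM - 0.0018 ≤ mangoldtFracSum M / M := by
    rw [le_div_iff₀ hMpos]
    linarith [le_mangoldtFracSum (by omega : 1 ≤ M)]
  have m2 : mangoldtFracSum N / N ≤ 1.11 * IN + 0.0002 := by
    rw [div_le_iff₀ hNpos]
    linarith [mangoldtFracSum_le (by omega : 1 ≤ N)]
  linarith

theorem sum_vonMangoldt_sub_one_mul (g : ℕ → ℝ) {N X : ℕ} (h : N ≤ X) :
    ∑ n ∈ Ioc N X, (Λ n - 1) * g n
      = (Chebyshev.psi X - X) * g (X + 1) - (Chebyshev.psi N - N) * g (N + 1)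
        + ∑ n ∈ Ico (N + 1) (X + 1), (Chebyshev.psi n - n) * (g n - g (n + 1)) := by
  induction X, h using Nat.le_induction with
  | base => simp
  | succ X hX ih =>
    rw [← Finset.insert_Ioc_right_eq_Ioc_add_one hX, sum_insert (by simp), ih,
      sum_Ico_succ_top (by omega : N + 1 ≤ X + 1), psi_natCast_succ]
    push_cast
    ring

theorem neg_mul_le_sum_mul_of_antitone {r q : ℕ → ℝ} {a b : ℕ} {D : ℝ} (hab : a ≤ b)
    (hr : ∀ m, a ≤ m → -D ≤ ∑ n ∈ Ico a m, r n) (hq : ∀ n, a ≤ n → 0 ≤ q n)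
    (hq' : ∀ n, a ≤ n → q (n + 1) ≤ q n) :
    -(D * q a) ≤ ∑ n ∈ Ico a b, r n * q n := by
  have key : (∑ n ∈ Ico a b, r n) * q b - D * (q a - q b) ≤ ∑ n ∈ Ico a b, r n * q n := by
    induction b, hab using Nat.le_induction with
    | base => simp
    | succ b hb ih =>
      rw [sum_Ico_succ_top hb, sum_Ico_succ_top hb]
      have h1 := hr (b + 1) (by omega)
      rw [sum_Ico_succ_top hb] at h1
      nlinarith [hq' b hb]
  nlinarith [hr b hab, hq b hab]

/-- A Mertens-type lower bound for sums over a final range, for convex decreasing weights. -/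
theorem le_sum_vonMangoldt_mul_div {f : ℕ → ℝ} {N X : ℕ} (hN : 80000 ≤ N + 1) (hX : N ≤ X)
    (hf : ∀ n, N < n → 0 ≤ f n) (hanti : ∀ n, N < n → f (n + 1) ≤ f n)
    (hconv : ∀ n, N < n → 2 * f (n + 1) ≤ f n + f (n + 2)) :
    ∑ n ∈ Ioc N X, f n / n - f (X + 1) - (Chebyshev.psi N - N) * (f (N + 1) / (N + 1))
      - 0.1 * (f (N + 1) * (N + 2) - f (N + 2) * (N + 1))
      ≤ ∑ n ∈ Ioc N X, Λ n * (f n / n) := by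
  have h1 := sum_vonMangoldt_sub_one_mul (fun n => f n / n) hX
  have h2 : ∑ n ∈ Ico (N + 1) (X + 1), (Chebyshev.psi n - n) * (f n / n - f (n + 1) / (n + 1 : ℕ))
      = ∑ n ∈ Ico (N + 1) (X + 1), (Chebyshev.psi n - n) / (n * (n + 1))
        * (f n * (n + 1) - f (n + 1) * n) := by
    refine sum_congr rfl fun n hn => ?_
    rw [Finset.mem_Ico] at hn
    have hn0 : (n : ℝ) ≠ 0 := by norm_cast; omega
    have hn1 : (n : ℝ) + 1 ≠ 0 := by positivity
    push_cast
    field_simp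
  have h3 := neg_mul_le_sum_mul_of_antitone (r := fun n => (Chebyshev.psi n - n) / (n * (n + 1)))
    (q := fun n => f n * (n + 1) - f (n + 1) * n) (D := 0.1) (by omega : N + 1 ≤ X + 1)
    (fun m hm => neg_le_sum_psi_sub hN hm)
    (fun n hn => by
      have := hf n (by omega)
      have := hanti n (by omega)
      have : (0 : ℝ) ≤ n := n.cast_nonneg
      clear hN
      nlinarith)
    (fun n hn => by
      have := hconv n (by omega)
      have : (0 : ℝ) ≤ n := n.cast_nonneg
      clear hN
      push_cast
      simp only [add_assoc, one_add_one_eq_two]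
      nlinarith)
  have h4 : -f (X + 1) ≤ (Chebyshev.psi X - X) * (f (X + 1) / (X + 1 : ℕ)) := by
    have h0 := hf (X + 1) (by omega)
    have h5 : 0 ≤ f (X + 1) / (X + 1 : ℕ) := by positivity
    have h6 : f (X + 1) / (X + 1 : ℕ) * (X + 1 : ℕ) = f (X + 1) := by
      field_simp
    have h7 := Chebyshev.psi_nonneg X
    push_cast at *
    nlinarith
  have h8 : ∑ n ∈ Ioc N X, (Λ n - 1) * (f n / n)
      = ∑ n ∈ Ioc N X, Λ n * (f n / n) - ∑ n ∈ Ioc N X, f n / n := by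
    rw [← sum_sub_distrib]
    exact sum_congr rfl fun n _ => by ring
  rw [h2, h8] at h1
  push_cast at h1 h3 h4
  norm_num [add_assoc] at h3
  ring_nf at h1 h3 h4 ⊢
  clear hN
  linarith

/-- The weight `t ^ (-δ) / log t`. -/
noncomputable def powLogWeight (δ t : ℝ) : ℝ := Real.exp (-(δ * Real.log t)) / Real.log t

theorem powLogWeight_nonneg {δ t : ℝ} (ht : 1 ≤ t) : 0 ≤ powLogWeight δ t :=
  div_nonneg (Real.exp_pos _).le (Real.log_nonneg ht)

theorem powLogWeight_anti {δ s t : ℝ} (hδ : 0 ≤ δ) (hs : 1 < s) (h : s ≤ t) :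
    powLogWeight δ t ≤ powLogWeight δ s := by
  have hl : Real.log s ≤ Real.log t := Real.log_le_log (by linarith) h
  have h0 : 0 < Real.log s := Real.log_pos hs
  unfold powLogWeight
  gcongr

theorem powLogWeight_convex {δ t : ℝ} (hδ : 0 ≤ δ) (ht : 1 < t) :
    2 * powLogWeight δ (t + 1) ≤ powLogWeight δ t + powLogWeight δ (t + 2) := by
  have l0 : 0 < Real.log t := Real.log_pos ht
  have l1 : 0 < Real.log (t + 1) := Real.log_pos (by linarith)
  have l2 : 0 < Real.log (t + 2) := Real.log_pos (by linarith)
  have hs : Real.log t + Real.log (t + 2) ≤ 2 * Real.log (t + 1) := by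
    rw [← Real.log_mul (by linarith) (by linarith), ← Nat.cast_two (R := ℝ), ← Real.log_pow]
    exact Real.log_le_log (by nlinarith) (by push_cast; nlinarith)
  have hprod : powLogWeight δ (t + 1) ^ 2 ≤ powLogWeight δ t * powLogWeight δ (t + 2) := by
    unfold powLogWeight
    rw [div_pow, div_mul_div_comm, ← Real.exp_add, sq (Real.exp _), ← Real.exp_add]
    refine div_le_div₀ (Real.exp_pos _).le (Real.exp_le_exp.2 ?_) (by positivity) ?_
    · nlinarith
    · nlinarith [sq_nonneg (Real.log t - Real.log (t + 2))]
  have p0 := powLogWeight_nonneg (δ := δ) ht.le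
  have p1 := powLogWeight_nonneg (δ := δ) (by linarith : 1 ≤ t + 1)
  have p2 := powLogWeight_nonneg (δ := δ) (by linarith : 1 ≤ t + 2)
  refine abs_le_of_sq_le_sq' ?_ (by positivity) |>.2
  nlinarith [sq_nonneg (powLogWeight δ t - powLogWeight δ (t + 2))]

/-- A primitive of `(1 - u / m) ^ m / u`, an approximation to `exp (-u) / u`. -/
noncomputable def expIntApprox (m : ℕ) (u : ℝ) : ℝ :=
  Real.log u + ∑ k ∈ range m, (1 - u / m) ^ (k + 1) / (k + 1)

theorem hasDerivAt_expIntApprox {m : ℕ} (hm : m ≠ 0) {u : ℝ} (hu : u ≠ 0) :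
    HasDerivAt (expIntApprox m) ((1 - u / m) ^ m / u) u := by
  have hm' : (m : ℝ) ≠ 0 := by exact_mod_cast hm
  have h1 : ∀ k ∈ range m, HasDerivAt (fun v : ℝ => (1 - v / m) ^ (k + 1) / (k + 1))
      (-(1 - u / m) ^ k / m) u := by
    intro k _
    have hk : (k : ℝ) + 1 ≠ 0 := by positivity
    have := ((((hasDerivAt_id u).div_const (m : ℝ)).const_sub 1).fun_pow (k + 1)).div_const
      ((k : ℝ) + 1)
    refine this.congr_deriv ?_
    simp
    field_simp
  have h2 := (Real.hasDerivAt_log hu).fun_add (HasDerivAt.fun_sum h1)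
  refine h2.congr_deriv ?_
  have h3 := mul_neg_geom_sum (1 - u / m) m
  rw [← sum_div, sum_neg_distrib]
  rw [sub_sub_cancel] at h3
  field_simp at h3 ⊢
  linarith

theorem expIntApprox_sub_le {δ : ℝ} (hδ : 0 < δ) {m k : ℕ} (hm : m ≠ 0) (hk : 2 ≤ k)
    (h : δ * Real.log (k + 1) ≤ m) :
    expIntApprox m (δ * Real.log (k + 1)) - expIntApprox m (δ * Real.log k)
      ≤ powLogWeight δ k / k := by
  have hk' : (2 : ℝ) ≤ k := by exact_mod_cast hk
  have lk : 0 < Real.log k := Real.log_pos (by linarith)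
  have hlt : Real.log k < Real.log (k + 1) := Real.log_lt_log (by linarith) (by linarith)
  have hlt' : δ * Real.log k < δ * Real.log (k + 1) := by gcongr
  have hpos : 0 < δ * Real.log k := by positivity
  obtain ⟨c, ⟨hc1, hc2⟩, hc⟩ := exists_hasDerivAt_eq_slope (expIntApprox m)
    (fun u => (1 - u / m) ^ m / u) hlt'
    (fun u hu =>
      (hasDerivAt_expIntApprox hm (by linarith [hu.1] : u ≠ 0)).continuousAt.continuousWithinAt)
    (fun u hu => hasDerivAt_expIntApprox hm (by linarith [hu.1] : u ≠ 0))
  rw [eq_div_iff (by linarith)] at hc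
  rw [← hc]
  have hexp : (1 - c / m) ^ m ≤ Real.exp (-c) := Real.one_sub_div_pow_le_exp_neg (by linarith)
  have hc0 : 0 < c := by linarith
  have hstep : Real.log (k + 1) - Real.log k ≤ 1 / k := by
    rw [← Real.log_div (by linarith) (by linarith)]
    refine (Real.log_le_sub_one_of_pos (by positivity)).trans (le_of_eq ?_)
    field_simp
    ring
  calc (1 - c / m) ^ m / c * (δ * Real.log (k + 1) - δ * Real.log k)
      ≤ Real.exp (-(δ * Real.log k)) / (δ * Real.log k) * (δ * (1 / k)) := by
        rw [← mul_sub]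
        have : 0 ≤ Real.log (k + 1) - Real.log k := by linarith
        have h3 : (1 - c / m) ^ m / c ≤ Real.exp (-(δ * Real.log k)) / (δ * Real.log k) := by
          have : Real.exp (-c) ≤ Real.exp (-(δ * Real.log k)) := by
            apply Real.exp_le_exp.2; linarith
          calc _ ≤ Real.exp (-(δ * Real.log k)) / c := by gcongr; linarith
            _ ≤ _ := by gcongr
        gcongr
    _ = powLogWeight δ k / k := by
        rw [powLogWeight]
        field_simp

theorem expIntApprox_sub_le_sum {δ : ℝ} (hδ : 0 < δ) {m N X : ℕ} (hm : m ≠ 0) (hN : 1 ≤ N)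
    (hX : N ≤ X) (h : δ * Real.log (X + 1) ≤ m) :
    expIntApprox m (δ * Real.log (X + 1)) - expIntApprox m (δ * Real.log (N + 1))
      ≤ ∑ k ∈ Ioc N X, powLogWeight δ k / k := by
  induction X, hX using Nat.le_induction with
  | base => simp
  | succ X hX ih =>
    have hle : Real.log ((X : ℝ) + 1) ≤ Real.log (((X + 1 : ℕ) : ℝ) + 1) :=
      Real.log_le_log (by positivity) (by push_cast; linarith)
    have h1 := ih ((mul_le_mul_of_nonneg_left hle hδ.le).trans h)
    have h2 := expIntApprox_sub_le hδ hm (by omega : 2 ≤ X + 1) h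
    rw [← Finset.insert_Ioc_right_eq_Ioc_add_one hX, sum_insert (by simp)]
    push_cast at h1 h2 ⊢
    linarith

theorem expIntApprox_self {m : ℕ} (hm : m ≠ 0) : expIntApprox m m = Real.log m := by
  have hm' : (m : ℝ) ≠ 0 := by exact_mod_cast hm
  simp [expIntApprox, hm']

theorem expIntApprox_le {m : ℕ} {u : ℝ} (hu : 0 ≤ u) (hum : u ≤ m) :
    expIntApprox m u ≤ Real.log u + (harmonic m : ℝ) := by
  unfold expIntApprox harmonic
  push_cast
  gcongr with k _
  rw [inv_eq_one_div]
  have h0 : 0 ≤ 1 - u / m := sub_nonneg.2 (div_le_one_of_le₀ hum (by positivity))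
  have h1 : 1 - u / m ≤ 1 := sub_le_self _ (by positivity)
  gcongr
  exact pow_le_one₀ h0 h1

/-- A sum against the von Mangoldt function as a double sum over primes and exponents. -/
theorem sum_vonMangoldt_eq_sum_primesLE (w : ℕ → ℝ) (N : ℕ) :
    ∑ n ∈ Ioc 0 N, Λ n * w n
      = ∑ p ∈ N.primesLE, ∑ k ∈ Icc 1 (p.log N), Real.log p * w (p ^ k) := by
  calc ∑ n ∈ Ioc 0 N, Λ n * w n
    _ = ∑ n ∈ N.primesLE.biUnion fun p ↦ image (p ^ ·) (Icc 1 (p.log N)), Λ n * w n := by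
      refine (sum_subset (fun q hq ↦ ?_) fun x hx hx' ↦ ?_).symm
      · simp only [mem_biUnion, Nat.mem_primesLE, Finset.mem_image, Finset.mem_Icc] at hq
        obtain ⟨p, ⟨hpN, hp⟩, k, ⟨_, hk⟩, rfl⟩ := hq
        have := hp.two_le
        exact Finset.mem_Ioc.2 ⟨by positivity, Nat.pow_le_of_le_log (by omega) hk⟩
      · rw [ArithmeticFunction.vonMangoldt_eq_zero_iff.2, zero_mul]
        contrapose hx'
        rw [isPrimePow_nat_iff] at hx'
        obtain ⟨p, k, hp, hk, rfl⟩ := hx'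
        rw [Finset.mem_Ioc] at hx
        have hpn : p ≤ N := (Nat.le_of_dvd hx.1 (dvd_pow_self p hk.ne')).trans hx.2
        exact mem_biUnion.2 ⟨p, Nat.mem_primesLE.2 ⟨hpn, hp⟩, mem_image.2
          ⟨k, Finset.mem_Icc.2 ⟨hk, Nat.le_log_of_pow_le hp.one_lt hx.2⟩, rfl⟩⟩
    _ = ∑ p ∈ N.primesLE, ∑ n ∈ image (fun k ↦ p ^ k) (Icc 1 (p.log N)), Λ n * w n := by
      refine sum_biUnion fun p hp q hq hpq => ?_
      rw [Function.onFun, Finset.disjoint_left]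
      intro n hn hn'
      simp only [Finset.mem_image, Finset.mem_Icc] at hn hn'
      obtain ⟨a, ⟨ha, _⟩, rfl⟩ := hn
      obtain ⟨b, ⟨hb, _⟩, h⟩ := hn'
      exact hpq ((Nat.prime_of_mem_primesLE hp).pow_inj' (Nat.prime_of_mem_primesLE hq)
        (by omega) (by omega) h.symm).1
    _ = _ := by
      refine sum_congr rfl fun p hp ↦ ?_
      have hp' := Nat.prime_of_mem_primesLE hp
      rw [sum_image fun a _ b _ hab ↦ Nat.pow_right_injective hp'.two_le hab]
      refine sum_congr rfl fun k hk => ?_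
      rw [Finset.mem_Icc] at hk
      rw [ArithmeticFunction.vonMangoldt_apply_pow (by omega),
        ArithmeticFunction.vonMangoldt_apply_prime hp']

theorem sum_Icc_one_eq_sum_range (g : ℕ → ℝ) (K : ℕ) :
    ∑ k ∈ Icc 1 K, g k = ∑ i ∈ range K, g (i + 1) := by
  induction K with
  | zero => simp
  | succ K ih => rw [sum_Icc_succ_top (by omega), sum_range_succ, ih]

theorem sum_pow_div_le_neg_log {x : ℝ} (h0 : 0 ≤ x) (h1 : x < 1) (K : ℕ) :
    ∑ k ∈ Icc 1 K, x ^ k / k ≤ -Real.log (1 - x) := by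
  have h := (Real.hasSum_pow_div_log_of_abs_lt_one (abs_lt.2 ⟨by linarith, h1⟩))
  have h2 := sum_le_hasSum (range K) (fun i _ => by positivity) h
  rw [sum_Icc_one_eq_sum_range]
  push_cast
  exact h2

theorem neg_log_le_sum_pow_div_add {x : ℝ} (h0 : 0 ≤ x) (h1 : x < 1) (K : ℕ) :
    -Real.log (1 - x) ≤ ∑ k ∈ Icc 1 K, x ^ k / k + x ^ (K + 1) / ((K + 1) * (1 - x)) := by
  have h := (Real.hasSum_pow_div_log_of_abs_lt_one (abs_lt.2 ⟨by linarith, h1⟩))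
  have h2 := (hasSum_nat_add_iff' K).2 h
  have h3 := (hasSum_geometric_of_lt_one h0 h1).mul_left (x ^ (K + 1) / (K + 1))
  have h4 := hasSum_le (fun j => ?_) h2 h3
  · have h5 : ∑ k ∈ Icc 1 K, x ^ k / k = ∑ i ∈ range K, x ^ (i + 1) / ((i : ℝ) + 1) := by
      rw [sum_Icc_one_eq_sum_range]
      push_cast
      rfl
    have h6 : x ^ (K + 1) / ((K : ℝ) + 1) * (1 - x)⁻¹ = x ^ (K + 1) / ((K + 1) * (1 - x)) := by
      rw [← div_eq_mul_inv, div_div]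
    rw [h5, ← h6]
    linarith
  · have : x ^ (K + 1) / ((K : ℝ) + 1) * x ^ j = x ^ (j + K + 1) / (K + 1) := by
      rw [div_mul_eq_mul_div, ← pow_add]
      congr 2
      ring
    rw [this]
    gcongr
    linarith [j.cast_nonneg (α := ℝ)]

theorem sum_rpow_le {δ : ℝ} (hδ : 0 < δ) (M : ℕ) :
    ∑ n ∈ range M, ((n + 2 : ℕ) : ℝ) ^ (-(1 + δ)) ≤ (1 - ((M + 1 : ℕ) : ℝ) ^ (-δ)) / δ := by
  induction M with
  | zero => simp
  | succ M ih =>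
    rw [sum_range_succ]
    have hM : (0 : ℝ) < (M + 1 : ℕ) := by positivity
    have hM2 : (0 : ℝ) < (M + 1 + 1 : ℕ) := by positivity
    have hlog : 1 / ((M + 1 + 1 : ℕ) : ℝ) ≤ Real.log (M + 1 + 1 : ℕ) - Real.log (M + 1 : ℕ) := by
      rw [← Real.log_div hM2.ne' hM.ne']
      refine le_trans (le_of_eq ?_) (Real.one_sub_inv_le_log_of_pos (by positivity))
      push_cast
      field_simp
      ring
    have h1 : ((M + 1 + 1 : ℕ) : ℝ) ^ (-δ) * (1 + δ * (1 / ((M + 1 + 1 : ℕ) : ℝ)))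
        ≤ ((M + 1 : ℕ) : ℝ) ^ (-δ) := by
      have e : ((M + 1 : ℕ) : ℝ) ^ (-δ) = ((M + 1 + 1 : ℕ) : ℝ) ^ (-δ)
          * Real.exp (δ * (Real.log (M + 1 + 1 : ℕ) - Real.log (M + 1 : ℕ))) := by
        rw [Real.rpow_def_of_pos hM, Real.rpow_def_of_pos hM2, ← Real.exp_add]
        congr 1
        ring
      rw [e]
      have := Real.add_one_le_exp
        (δ * (Real.log (M + 1 + 1 : ℕ) - Real.log (M + 1 : ℕ)))
      have h2 := mul_le_mul_of_nonneg_left hlog hδ.le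
      gcongr
      linarith
    have h2 : ((M + 2 : ℕ) : ℝ) ^ (-(1 + δ))
        = ((M + 1 + 1 : ℕ) : ℝ) ^ (-δ) * (1 / ((M + 1 + 1 : ℕ) : ℝ)) := by
      rw [neg_add_rev, Real.rpow_add hM2, Real.rpow_neg_one, one_div]
    rw [h2]
    rw [le_div_iff₀ hδ] at ih ⊢
    nlinarith

theorem tsum_rpow_le {δ : ℝ} (hδ : 0 < δ) : ∑' n : ℕ, (n : ℝ) ^ (-(1 + δ)) ≤ 1 + 1 / δ := by
  refine Real.tsum_le_of_sum_range_le (fun n => by positivity) fun M => ?_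
  calc ∑ n ∈ range M, (n : ℝ) ^ (-(1 + δ)) ≤ ∑ n ∈ range (M + 2), (n : ℝ) ^ (-(1 + δ)) :=
        sum_le_sum_of_subset_of_nonneg (range_mono (by omega)) fun n _ _ => by positivity
    _ = 1 + ∑ n ∈ range M, ((n + 2 : ℕ) : ℝ) ^ (-(1 + δ)) := by
        rw [sum_range_succ', sum_range_succ']
        have : (-(1 + δ)) ≠ 0 := by linarith
        simp only [Nat.cast_zero, Real.zero_rpow this, zero_add, Nat.cast_one, Real.one_rpow]
        rw [add_zero, add_comm]
    _ ≤ 1 + (1 - ((M + 1 : ℕ) : ℝ) ^ (-δ)) / δ := by gcongr; exact sum_rpow_le hδ M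
    _ ≤ 1 + 1 / δ := by
        gcongr
        have : 0 ≤ ((M + 1 : ℕ) : ℝ) ^ (-δ) := by positivity
        linarith

theorem prod_primesLE_inv_le {δ : ℝ} (hδ : 0 < δ) (X : ℕ) :
    ∏ p ∈ X.primesLE, (1 - (p : ℝ) ^ (-(1 + δ)))⁻¹ ≤ 1 + 1 / δ := by
  let f : ℕ →* ℝ :=
    { toFun := fun n => (n : ℝ) ^ (-(1 + δ))
      map_one' := by simp
      map_mul' := fun a b => by
        push_cast
        exact Real.mul_rpow a.cast_nonneg b.cast_nonneg }
  have hs : Summable f := Real.summable_nat_rpow.2 (by linarith : -(1 + δ) < -1)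
  have h := EulerProduct.prod_primesBelow_geometric_eq_tsum_smoothNumbers hs (X + 1)
  calc _ = ∑' m : (X + 1).smoothNumbers, f m := h
    _ ≤ ∑' m, f m := hs.tsum_subtype_le f _ fun n => by
        change 0 ≤ (n : ℝ) ^ (-(1 + δ))
        positivity
    _ ≤ 1 + 1 / δ := tsum_rpow_le hδ

theorem sum_vonMangoldt_mul_powLogWeight_le {δ : ℝ} (hδ : 0 < δ) (X : ℕ) :
    ∑ n ∈ Ioc 0 X, Λ n * (powLogWeight δ n / n) ≤ -Real.log δ + δ := by
  have hx : ∀ p ∈ X.primesLE, 0 ≤ (p : ℝ) ^ (-(1 + δ)) ∧ (p : ℝ) ^ (-(1 + δ)) < 1 := by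
    intro p hp
    have : (1 : ℝ) < p := by exact_mod_cast Nat.one_lt_of_mem_primesLE hp
    exact ⟨by positivity, Real.rpow_lt_one_of_one_lt_of_neg this (by linarith)⟩
  calc ∑ n ∈ Ioc 0 X, Λ n * (powLogWeight δ n / n)
      = ∑ p ∈ X.primesLE, ∑ k ∈ Icc 1 (p.log X), ((p : ℝ) ^ (-(1 + δ))) ^ k / k := by
        rw [sum_vonMangoldt_eq_sum_primesLE (fun n => powLogWeight δ n / n)]
        refine sum_congr rfl fun p hp => sum_congr rfl fun k hk => ?_
        rw [Finset.mem_Icc] at hk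
        have hp1 : (1 : ℝ) < p := by exact_mod_cast Nat.one_lt_of_mem_primesLE hp
        have hl : Real.log p ≠ 0 := (Real.log_pos hp1).ne'
        have hk0 : (k : ℝ) ≠ 0 := by norm_cast; omega
        have hpk : (0 : ℝ) < (p : ℝ) ^ k := by positivity
        have e1 : ((p : ℝ) ^ (-(1 + δ))) ^ k
            = Real.exp (-(δ * (k * Real.log p))) / (p : ℝ) ^ k := by
          rw [eq_div_iff hpk.ne', ← Real.rpow_natCast, ← Real.rpow_mul (by linarith),
            ← Real.rpow_natCast, ← Real.rpow_add (by linarith), Real.rpow_def_of_pos (by linarith)]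
          congr 1
          ring
        rw [e1, powLogWeight]
        push_cast
        rw [Real.log_pow]
        field_simp
    _ ≤ ∑ p ∈ X.primesLE, -Real.log (1 - (p : ℝ) ^ (-(1 + δ))) :=
        sum_le_sum fun p hp => sum_pow_div_le_neg_log (hx p hp).1 (hx p hp).2 _
    _ = Real.log (∏ p ∈ X.primesLE, (1 - (p : ℝ) ^ (-(1 + δ)))⁻¹) := by
        rw [Real.log_prod fun p hp => inv_ne_zero (by linarith [(hx p hp).2])]
        simp [Real.log_inv]
    _ ≤ Real.log (1 + 1 / δ) := by
        refine Real.log_le_log (prod_pos fun p hp => inv_pos.2 (by linarith [(hx p hp).2])) ?_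
        exact prod_primesLE_inv_le hδ X
    _ = -Real.log δ + Real.log (1 + δ) := by
        rw [← Real.log_inv, ← Real.log_mul (by positivity) (by positivity)]
        congr 1
        field_simp
        ring
    _ ≤ -Real.log δ + δ := by
        linarith [Real.log_le_sub_one_of_pos (by linarith : 0 < 1 + δ)]

theorem continuous_powLogWeight (t : ℝ) : Continuous fun δ => powLogWeight δ t := by
  unfold powLogWeight
  fun_prop

theorem powLogWeight_zero (t : ℝ) : powLogWeight 0 t = 1 / Real.log t := by
  simp [powLogWeight]

theorem sum_vonMangoldt_mul_powLogWeight_le_harmonic {N X m : ℕ} (hN : 80000 ≤ N + 1)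
    (hX : N ≤ X) (hm : m ≠ 0) {δ : ℝ} (hδ : δ = m / Real.log (X + 1)) :
    ∑ n ∈ Ioc 0 N, Λ n * (powLogWeight δ n / n)
      ≤ Real.log (Real.log (N + 1)) + (harmonic m - Real.log m) + 2 * δ
        + (Chebyshev.psi N - N) * (powLogWeight δ (N + 1) / (N + 1))
        + 0.1 * (powLogWeight δ (N + 1) * (N + 2) - powLogWeight δ (N + 2) * (N + 1)) := by
  have hm1 : (1 : ℝ) ≤ m := by exact_mod_cast Nat.one_le_iff_ne_zero.2 hm
  have hN1 : (1 : ℝ) < N + 1 := by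
    have : 0 < N := by omega
    have : (0 : ℝ) < N := by exact_mod_cast this
    linarith
  have hXN : (N : ℝ) + 1 ≤ X + 1 := by exact_mod_cast Nat.succ_le_succ hX
  have lN : 0 < Real.log (N + 1) := Real.log_pos hN1
  have lNX : Real.log (N + 1) ≤ Real.log (X + 1) := Real.log_le_log (by linarith) hXN
  have lX : 0 < Real.log (X + 1) := by linarith
  have hδ0 : 0 < δ := by rw [hδ]; positivity
  have hδX : δ * Real.log (X + 1) = m := by rw [hδ]; field_simp
  have hδN : δ * Real.log (N + 1) ≤ m := by rw [← hδX]; gcongr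
  have h1 := le_sum_vonMangoldt_mul_div (f := fun n => powLogWeight δ n) hN hX
    (fun n hn => powLogWeight_nonneg (by exact_mod_cast (by omega : 1 ≤ n)))
    (fun n hn => powLogWeight_anti hδ0.le (by exact_mod_cast (by omega : 1 < n))
      (by push_cast; linarith))
    (fun n hn => by
      have := powLogWeight_convex hδ0.le (by exact_mod_cast (by omega : 1 < n) : (1 : ℝ) < n)
      push_cast
      exact this)
  have h2 := expIntApprox_sub_le_sum hδ0 hm (by omega : 1 ≤ N) hX hδX.le
  rw [hδX, expIntApprox_self hm] at h2
  have h3 := expIntApprox_le (by positivity) hδN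
  rw [Real.log_mul hδ0.ne' lN.ne'] at h3
  have h4 := sum_vonMangoldt_mul_powLogWeight_le hδ0 X
  rw [← sum_Ioc_consecutive _ (Nat.zero_le N) hX] at h4
  have h5 : powLogWeight δ (X + 1) ≤ δ := by
    unfold powLogWeight
    rw [div_le_iff₀ lX, hδX]
    refine le_trans ?_ hm1
    rw [Real.exp_le_one_iff]
    linarith
  clear hN
  push_cast at h1
  linarith

/-- An explicit upper bound in Mertens' second theorem for prime powers. -/
theorem sum_vonMangoldt_div_mul_log_le {N : ℕ} (hN : 80000 ≤ N + 1) :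
    ∑ n ∈ Ioc 0 N, Λ n / (n * Real.log n)
      ≤ Real.eulerMascheroniConstant + Real.log (Real.log (N + 1))
        + (Chebyshev.psi N - N) / ((N + 1) * Real.log (N + 1))
        + 0.1 * (1 / Real.log (N + 1) + 1 / Real.log (N + 1) ^ 2) := by
  have hN1 : (1 : ℝ) < N + 1 := by
    have : 0 < N := by omega
    have : (0 : ℝ) < N := by exact_mod_cast this
    linarith
  have step : ∀ m : ℕ, m ≠ 0 → ∑ n ∈ Ioc 0 N, Λ n * (powLogWeight 0 n / n)
      ≤ Real.log (Real.log (N + 1)) + (harmonic m - Real.log m) + 2 * 0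
        + (Chebyshev.psi N - N) * (powLogWeight 0 (N + 1) / (N + 1))
        + 0.1 * (powLogWeight 0 (N + 1) * (N + 2) - powLogWeight 0 (N + 2) * (N + 1)) := by
    intro m hm
    have hlim : Tendsto (fun X : ℕ => (m : ℝ) / Real.log ((X : ℝ) + 1)) atTop (nhds 0) := by
      refine Tendsto.const_div_atTop (Real.tendsto_log_atTop.comp ?_) _
      exact tendsto_atTop_add_const_right _ _ tendsto_natCast_atTop_atTop
    have c1 : Continuous fun δ => ∑ n ∈ Ioc 0 N, Λ n * (powLogWeight δ n / n) := by
      refine continuous_finsetSum _ fun n _ => ?_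
      have := continuous_powLogWeight n
      fun_prop
    have c2 : Continuous fun δ => Real.log (Real.log (N + 1)) + (harmonic m - Real.log m) + 2 * δ
        + (Chebyshev.psi N - N) * (powLogWeight δ (N + 1) / (N + 1))
        + 0.1 * (powLogWeight δ (N + 1) * (N + 2) - powLogWeight δ (N + 2) * (N + 1)) := by
      have := continuous_powLogWeight (N + 1)
      have := continuous_powLogWeight (N + 2)
      fun_prop
    refine le_of_tendsto_of_tendsto ((c1.tendsto 0).comp hlim) ((c2.tendsto 0).comp hlim) ?_
    filter_upwards [eventually_ge_atTop N] with X hX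
    exact sum_vonMangoldt_mul_powLogWeight_le_harmonic hN hX hm rfl
  have hlim2 : Tendsto (fun m : ℕ => Real.log (Real.log (N + 1))
        + ((harmonic m : ℝ) - Real.log m) + 2 * 0
        + (Chebyshev.psi N - N) * (powLogWeight 0 (N + 1) / (N + 1))
        + 0.1 * (powLogWeight 0 (N + 1) * (N + 2) - powLogWeight 0 (N + 2) * (N + 1))) atTop
      (nhds (Real.log (Real.log (N + 1)) + Real.eulerMascheroniConstant + 2 * 0
        + (Chebyshev.psi N - N) * (powLogWeight 0 (N + 1) / (N + 1))
        + 0.1 * (powLogWeight 0 (N + 1) * (N + 2) - powLogWeight 0 (N + 2) * (N + 1)))) :=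
    (((Real.tendsto_harmonic_sub_log.const_add _).add_const _).add_const _).add_const _
  have h := ge_of_tendsto hlim2 ((eventually_ne_atTop 0).mono step)
  have e1 : ∑ n ∈ Ioc 0 N, Λ n / (n * Real.log n)
      = ∑ n ∈ Ioc 0 N, Λ n * (powLogWeight 0 n / n) := by
    refine sum_congr rfl fun n _ => ?_
    rw [powLogWeight_zero, div_div, mul_comm (Real.log _), mul_one_div]
  have l1 : 0 < Real.log (N + 1) := Real.log_pos hN1
  have l12 : Real.log ((N : ℝ) + 1) < Real.log (N + 2) :=
    Real.log_lt_log (by linarith) (by linarith)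
  have e2 : powLogWeight 0 ((N : ℝ) + 1) * (N + 2) - powLogWeight 0 ((N : ℝ) + 2) * (N + 1)
      ≤ 1 / Real.log (N + 1) + 1 / Real.log (N + 1) ^ 2 := by
    rw [powLogWeight_zero, powLogWeight_zero]
    have hd : (Real.log ((N : ℝ) + 2) - Real.log (N + 1)) * (N + 1) ≤ 1 := by
      rw [← Real.log_div (by linarith) (by linarith), ← le_div_iff₀ (by linarith)]
      refine (Real.log_le_sub_one_of_pos (by positivity)).trans (le_of_eq ?_)
      field_simp
      ring
    have e3 : 1 / Real.log ((N : ℝ) + 1) * (N + 2) - 1 / Real.log ((N : ℝ) + 2) * (N + 1)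
        = 1 / Real.log (N + 1) + (Real.log ((N : ℝ) + 2) - Real.log (N + 1)) * (N + 1)
          / (Real.log (N + 1) * Real.log (N + 2)) := by
      have l2 : Real.log ((N : ℝ) + 2) ≠ 0 := by linarith
      field_simp
      ring
    rw [e3, sq]
    gcongr
  have e3 : (Chebyshev.psi N - N) * (powLogWeight 0 ((N : ℝ) + 1) / (N + 1))
      = (Chebyshev.psi N - N) / ((N + 1) * Real.log (N + 1)) := by
    rw [powLogWeight_zero, div_div, mul_comm (Real.log _), mul_one_div]
  rw [e1, ← e3]
  clear hN
  linarith

theorem sum_Ioc_inv_sub_inv {s N : ℕ} (h : s ≤ N) :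
    ∑ n ∈ Ioc s N, (1 / ((n : ℝ) - 1) - 1 / n) = 1 / s - 1 / N := by
  induction N, h using Nat.le_induction with
  | base => simp
  | succ N hN ih =>
    rw [← Finset.insert_Ioc_right_eq_Ioc_add_one hN, sum_insert (by simp), ih]
    push_cast
    ring

theorem neg_log_one_sub_inv_le_of_le_sqrt {p N : ℕ} (hp : p.Prime) (h : p ≤ N.sqrt) :
    -Real.log (1 - 1 / (p : ℝ)) ≤ ∑ k ∈ Icc 1 (p.log N), (1 / (p : ℝ)) ^ k / k + 2 / 3 / N := by
  have hp2 : (2 : ℝ) ≤ p := by exact_mod_cast hp.two_le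
  have hx : 1 / (p : ℝ) ≤ 1 / 2 := one_div_le_one_div_of_le (by norm_num) hp2
  refine (neg_log_le_sum_pow_div_add (by positivity) (by linarith) (p.log N)).trans ?_
  refine add_le_add le_rfl ?_
  have hpp : p ^ 2 ≤ N := by nlinarith [Nat.sqrt_le' N]
  have hK : 2 ≤ p.log N := Nat.le_log_of_pow_le hp.one_lt hpp
  have hK' : (2 : ℝ) ≤ p.log N := by exact_mod_cast hK
  have hN : (N : ℝ) ≤ (p : ℝ) ^ (p.log N + 1) := by
    exact_mod_cast (Nat.lt_pow_succ_log_self hp.one_lt N).le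
  have hN0 : (0 : ℝ) < N := by
    have := hp.pos
    exact_mod_cast (by positivity : 0 < p ^ 2).trans_le hpp
  calc (1 / (p : ℝ)) ^ (p.log N + 1) / ((p.log N + 1) * (1 - 1 / p))
      ≤ 1 / N / ((2 + 1) * (1 - 1 / 2)) := by
        rw [one_div_pow]
        gcongr
    _ = 2 / 3 / N := by ring

theorem neg_log_one_sub_inv_le {p N : ℕ} (hp : p.Prime) (h : p ≤ N) :
    -Real.log (1 - 1 / (p : ℝ)) ≤ ∑ k ∈ Icc 1 (p.log N), (1 / (p : ℝ)) ^ k / k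
      + 1 / 2 * (1 / ((p : ℝ) - 1) - 1 / p) := by
  have hp2 : (2 : ℝ) ≤ p := by exact_mod_cast hp.two_le
  have hx : 1 / (p : ℝ) ≤ 1 / 2 := one_div_le_one_div_of_le (by norm_num) hp2
  refine (neg_log_le_sum_pow_div_add (by positivity) (by linarith) (p.log N)).trans ?_
  refine add_le_add le_rfl ?_
  have hK : 1 ≤ p.log N := Nat.le_log_of_pow_le hp.one_lt (by simpa using h)
  have hK' : (1 : ℝ) ≤ p.log N := by exact_mod_cast hK
  calc (1 / (p : ℝ)) ^ (p.log N + 1) / ((p.log N + 1) * (1 - 1 / p))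
      ≤ (1 / (p : ℝ)) ^ 2 / ((1 + 1) * (1 - 1 / p)) := by
        have h0 : 0 < 1 - 1 / (p : ℝ) := by linarith
        have h1 : (1 / (p : ℝ)) ^ (p.log N + 1) ≤ (1 / (p : ℝ)) ^ 2 :=
          pow_le_pow_of_le_one (by positivity) (by linarith) (by omega)
        gcongr
    _ = 1 / 2 * (1 / ((p : ℝ) - 1) - 1 / p) := by
        have : (p : ℝ) - 1 ≠ 0 := by linarith
        field_simp
        ring

/-- The logarithm of the Mertens product is controlled by the sum over prime powers. -/
theorem sum_neg_log_one_sub_inv_le {N : ℕ} (hN : 1 ≤ N) :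
    ∑ p ∈ N.primesLE, -Real.log (1 - 1 / (p : ℝ))
      ≤ ∑ n ∈ Ioc 0 N, Λ n / (n * Real.log n) + 7 / 6 / N.sqrt := by
  have hs : 1 ≤ N.sqrt := Nat.sqrt_pos.2 hN
  have hsN : N.sqrt ≤ N := Nat.sqrt_le_self N
  have e1 : ∑ n ∈ Ioc 0 N, Λ n / (n * Real.log n)
      = ∑ p ∈ N.primesLE, ∑ k ∈ Icc 1 (p.log N), (1 / (p : ℝ)) ^ k / k := by
    have := sum_vonMangoldt_eq_sum_primesLE (fun n => 1 / (n * Real.log n)) N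
    simp only [mul_one_div] at this
    rw [this]
    refine sum_congr rfl fun p hp => sum_congr rfl fun k hk => ?_
    rw [Finset.mem_Icc] at hk
    have hp1 : (1 : ℝ) < p := by exact_mod_cast Nat.one_lt_of_mem_primesLE hp
    have hl : Real.log p ≠ 0 := (Real.log_pos hp1).ne'
    have hk0 : (k : ℝ) ≠ 0 := by norm_cast; omega
    push_cast
    rw [Real.log_pow, one_div_pow]
    field_simp
  set w : ℕ → ℝ := fun n => if n ≤ N.sqrt then 2 / 3 / N else 1 / 2 * (1 / ((n : ℝ) - 1) - 1 / n)
    with hw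
  have h1 : ∑ p ∈ N.primesLE, -Real.log (1 - 1 / (p : ℝ))
      ≤ ∑ p ∈ N.primesLE, (∑ k ∈ Icc 1 (p.log N), (1 / (p : ℝ)) ^ k / k + w p) := by
    refine sum_le_sum fun p hp => ?_
    rw [Nat.mem_primesLE] at hp
    by_cases h : p ≤ N.sqrt
    · simp only [hw, if_pos h]
      exact neg_log_one_sub_inv_le_of_le_sqrt hp.2 h
    · simp only [hw, if_neg h]
      exact neg_log_one_sub_inv_le hp.2 hp.1
  have h2 : ∑ p ∈ N.primesLE, w p ≤ ∑ n ∈ Ioc 0 N, w n := by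
    rw [Nat.primesLE_eq_filter_Ioc_zero]
    refine sum_le_sum_of_subset_of_nonneg (filter_subset _ _) fun n hn _ => ?_
    simp only [hw]
    split_ifs with h
    · positivity
    · have : (1 : ℝ) < n := by exact_mod_cast (by omega : 1 < n)
      have := one_div_le_one_div_of_le (by linarith : (0 : ℝ) < n - 1)
          (by linarith : (n : ℝ) - 1 ≤ n)
      linarith
  have h3 : ∑ n ∈ Ioc 0 N.sqrt, w n = N.sqrt * (2 / 3 / N) := by
    rw [sum_congr rfl fun n hn => if_pos (Finset.mem_Ioc.1 hn).2]
    simp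
  have h4 : ∑ n ∈ Ioc N.sqrt N, w n = 1 / 2 * (1 / N.sqrt - 1 / N) := by
    rw [sum_congr rfl fun n hn => if_neg (not_le.2 (Finset.mem_Ioc.1 hn).1), ← mul_sum,
      sum_Ioc_inv_sub_inv hsN]
  rw [← sum_Ioc_consecutive _ (Nat.zero_le _) hsN, h3, h4] at h2
  rw [sum_add_distrib, ← e1] at h1
  have hs0 : (0 : ℝ) < N.sqrt := by exact_mod_cast hs
  have h5 : (N.sqrt : ℝ) * (2 / 3 / N) ≤ 2 / 3 / N.sqrt := by
    have : (N.sqrt : ℝ) ^ 2 ≤ N := by exact_mod_cast Nat.sqrt_le' N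
    have hN0 : (0 : ℝ) < N := by positivity
    rw [mul_div_assoc', div_le_div_iff₀ hN0 hs0]
    nlinarith
  have h6 : (0 : ℝ) ≤ 1 / N := by positivity
  have h7 : (7 : ℝ) / 6 / N.sqrt = 2 / 3 / N.sqrt + 1 / 2 * (1 / N.sqrt) := by ring
  linarith

theorem log_sum_divisors_div {N : ℕ} (hN : N ≠ 0) :
    Real.log (((∑ d ∈ N.divisors, d : ℕ) : ℝ) / N)
      = ∑ p ∈ N.primeFactors,
        Real.log (∑ i ∈ range (N.factorization p + 1), (1 / (p : ℝ)) ^ i) := by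
  have h1 : ((∑ d ∈ N.divisors, d : ℕ) : ℝ) / N
      = ∏ p ∈ N.primeFactors, ∑ i ∈ range (N.factorization p + 1), (1 / (p : ℝ)) ^ i := by
    have h2 : (N : ℝ) = ∏ p ∈ N.primeFactors, (p : ℝ) ^ N.factorization p := by
      have := Nat.prod_factorization_pow_eq_self hN
      rw [Finsupp.prod, Nat.support_factorization] at this
      exact_mod_cast this.symm
    rw [Nat.sum_divisors hN]
    conv_lhs => rw [h2]
    push_cast
    rw [← prod_div_distrib]
    refine prod_congr rfl fun p hp => ?_
    have hp0 : (p : ℝ) ≠ 0 := by exact_mod_cast (Nat.prime_of_mem_primeFactors hp).ne_zero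
    rw [← sum_range_reflect, sum_div]
    refine sum_congr rfl fun i hi => ?_
    rw [Finset.mem_range] at hi
    rw [one_div_pow, div_eq_div_iff (by positivity) (by positivity), one_mul, ← pow_add]
    congr 1
    omega
  rw [h1, Real.log_prod]
  intro p hp
  rw [sum_range_succ']
  positivity

theorem log_eq_sum_factorization_mul_log {N : ℕ} (hN : N ≠ 0) :
    Real.log N = ∑ p ∈ N.primeFactors, N.factorization p * Real.log p := by
  have := Nat.prod_factorization_pow_eq_self hN
  rw [Finsupp.prod, Nat.support_factorization] at this
  conv_lhs => rw [← this]
  push_cast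
  rw [Real.log_prod]
  · simp
  · intro p hp
    have := (Nat.prime_of_mem_primeFactors hp).ne_zero
    positivity

/-- Linear programming bound for the abundancy index: a local bound with slope `c` in the
logarithm gives a global one. -/
theorem log_sum_divisors_div_le {N : ℕ} (hN : N ≠ 0) {c : ℝ} {w : ℕ → ℝ} {S : Finset ℕ}
    (h : ∀ p, p.Prime → p ∣ N → Real.log (∑ i ∈ range (N.factorization p + 1), (1 / (p : ℝ)) ^ i)
      ≤ w p + c * (N.factorization p * Real.log p))
    (hS : ∀ p ∈ S, 0 ≤ w p) (hS' : ∀ p, p.Prime → p ∉ S → w p ≤ 0) :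
    Real.log (((∑ d ∈ N.divisors, d : ℕ) : ℝ) / N) ≤ c * Real.log N + ∑ p ∈ S, w p := by
  rw [log_sum_divisors_div hN, log_eq_sum_factorization_mul_log hN, mul_sum]
  have h1 : ∑ p ∈ N.primeFactors, w p ≤ ∑ p ∈ S, w p := by
    calc ∑ p ∈ N.primeFactors, w p ≤ ∑ p ∈ N.primeFactors with p ∈ S, w p := by
          rw [← sum_filter_add_sum_filter_not N.primeFactors (· ∈ S)]
          refine add_le_of_nonpos_right (sum_nonpos fun p hp => ?_)
          rw [Finset.mem_filter] at hp
          exact hS' p (Nat.prime_of_mem_primeFactors hp.1) hp.2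
      _ ≤ ∑ p ∈ S, w p := by
          refine sum_le_sum_of_subset_of_nonneg ?_ fun p hp _ => hS p hp
          intro p hp
          exact (Finset.mem_filter.1 hp).2
  have h2 := sum_le_sum fun p hp => h p (Nat.prime_of_mem_primeFactors hp)
    (Nat.dvd_of_mem_primeFactors hp)
  rw [sum_add_distrib] at h2
  linarith

theorem factorization_le_of_not_pow_dvd {N p t : ℕ} (hN : N ≠ 0) (hp : p.Prime)
    (h : ¬ p ^ (t + 1) ∣ N) : N.factorization p ≤ t := by
  by_contra hc
  exact h ((hp.pow_dvd_iff_le_factorization hN).2 (by omega))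

/-- An upper bound for the abundancy index of a `t`-free number of bounded size. -/
theorem log_sum_divisors_div_le_of_log_le_theta {N n t : ℕ} (hN : N ≠ 0)
    (hfree : ∀ p : ℕ, p.Prime → ¬ p ^ (t + 1) ∣ N) (hn : 2 ≤ n)
    (h : Real.log N ≤ Chebyshev.theta n) :
    Real.log (((∑ d ∈ N.divisors, d : ℕ) : ℝ) / N)
      ≤ ∑ p ∈ n.primesLE, Real.log (∑ i ∈ range (t + 1), (1 / (p : ℝ)) ^ i) := by
  set g : ℕ → ℝ := fun p => Real.log (∑ i ∈ range (t + 1), (1 / (p : ℝ)) ^ i) with hg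
  have hone : ∀ (p a : ℕ), 1 ≤ ∑ i ∈ range (a + 1), (1 / (p : ℝ)) ^ i := by
    intro p a
    rw [sum_range_succ', pow_zero]
    exact le_add_of_nonneg_left (by positivity)
  have g0 : ∀ p, 0 ≤ g p := fun p => Real.log_nonneg (hone p t)
  have ganti : ∀ p q : ℕ, 1 ≤ p → p ≤ q → g q ≤ g p := by
    intro p q hp hpq
    have : (0 : ℝ) < p := by exact_mod_cast hp
    have : (p : ℝ) ≤ q := by exact_mod_cast hpq
    refine Real.log_le_log (by linarith [hone q t]) ?_
    gcongr
  have ln : 0 < Real.log n := Real.log_pos (by exact_mod_cast hn)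
  set c := g n / Real.log n with hc
  have hc0 : 0 ≤ c := div_nonneg (g0 n) ln.le
  have hcn : c * Real.log n = g n := by rw [hc]; field_simp
  have key := log_sum_divisors_div_le hN (c := c) (w := fun p => g p - c * Real.log p)
    (S := n.primesLE) ?_ ?_ ?_
  · rw [sum_sub_distrib, ← mul_sum, ← Chebyshev.theta_eq_sum_primesLE_log] at key
    nlinarith
  · intro p hp hpN
    have h1 : N.factorization p ≤ t := factorization_le_of_not_pow_dvd hN hp (hfree p hp)
    have h2 : 1 ≤ N.factorization p := (hp.dvd_iff_one_le_factorization hN).1 hpN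
    have h3 : (1 : ℝ) ≤ N.factorization p := by exact_mod_cast h2
    have h4 : 0 ≤ Real.log p := Real.log_natCast_nonneg p
    have h5 : Real.log (∑ i ∈ range (N.factorization p + 1), (1 / (p : ℝ)) ^ i) ≤ g p := by
      refine Real.log_le_log (by linarith [hone p (N.factorization p)]) ?_
      refine sum_le_sum_of_subset_of_nonneg (range_mono (by omega)) fun i _ _ => by positivity
    have h6 : c * Real.log p ≤ c * (N.factorization p * Real.log p) := by
      gcongr
      exact le_mul_of_one_le_left h4 h3
    linarith
  · intro p hp
    have h1 := ganti p n (Nat.prime_of_mem_primesLE hp).one_le (Nat.le_of_mem_primesLE hp)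
    have h2 : Real.log p ≤ Real.log n := Real.log_le_log
      (by exact_mod_cast (Nat.prime_of_mem_primesLE hp).pos)
      (by exact_mod_cast Nat.le_of_mem_primesLE hp)
    have := mul_le_mul_of_nonneg_left h2 hc0
    linarith
  · intro p hp hpS
    have hnp : n ≤ p := by
      by_contra h'
      exact hpS (Nat.mem_primesLE.2 ⟨by omega, hp⟩)
    have h1 := ganti n p (by omega) hnp
    have h2 : Real.log n ≤ Real.log p := Real.log_le_log
      (by exact_mod_cast (by omega : 0 < n)) (by exact_mod_cast hnp)
    have := mul_le_mul_of_nonneg_left h2 hc0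
    linarith

theorem sum_primesLE_log_geom_sum_le {n : ℕ} (hn : 3 ≤ n) :
    ∑ p ∈ n.primesLE, Real.log (∑ i ∈ range 6, (1 / (p : ℝ)) ^ i)
      ≤ ∑ p ∈ n.primesLE, -Real.log (1 - 1 / (p : ℝ)) - 0.01699 := by
  have e : ∀ p ∈ n.primesLE, Real.log (∑ i ∈ range 6, (1 / (p : ℝ)) ^ i)
      = -Real.log (1 - 1 / (p : ℝ)) + Real.log (1 - (1 / (p : ℝ)) ^ 6) := by
    intro p hp
    have hp1 : (1 : ℝ) < p := by exact_mod_cast Nat.one_lt_of_mem_primesLE hp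
    have hx : 1 / (p : ℝ) < 1 := (div_lt_one (by linarith)).2 hp1
    have hx6 : (1 / (p : ℝ)) ^ 6 < 1 := pow_lt_one₀ (by positivity) hx (by norm_num)
    rw [geom_sum_eq hx.ne, ← neg_div_neg_eq, Real.log_div (by linarith) (by linarith)]
    rw [neg_sub, neg_sub]
    ring
  have h1 : ∑ p ∈ n.primesLE, Real.log (1 - (1 / (p : ℝ)) ^ 6)
      ≤ ∑ p ∈ n.primesLE, -(1 / (p : ℝ)) ^ 6 := by
    refine sum_le_sum fun p hp => ?_
    have hp1 : (1 : ℝ) < p := by exact_mod_cast Nat.one_lt_of_mem_primesLE hp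
    have hx : 1 / (p : ℝ) < 1 := (div_lt_one (by linarith)).2 hp1
    have hx6 : (1 / (p : ℝ)) ^ 6 < 1 := pow_lt_one₀ (by positivity) hx (by norm_num)
    linarith [Real.log_le_sub_one_of_pos (by linarith : 0 < 1 - (1 / (p : ℝ)) ^ 6)]
  have h2 : ∑ p ∈ ({2, 3} : Finset ℕ), (1 / (p : ℝ)) ^ 6 ≤ ∑ p ∈ n.primesLE, (1 / (p : ℝ)) ^ 6 := by
    refine sum_le_sum_of_subset_of_nonneg ?_ fun p _ _ => by positivity
    intro p hp
    simp only [Finset.mem_insert, Finset.mem_singleton] at hp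
    rcases hp with rfl | rfl
    · exact Nat.mem_primesLE.2 ⟨by omega, Nat.prime_two⟩
    · exact Nat.mem_primesLE.2 ⟨by omega, Nat.prime_three⟩
  rw [sum_pair (by norm_num)] at h2
  norm_num at h2
  rw [sum_congr rfl e, sum_add_distrib]
  rw [sum_neg_distrib] at h1
  norm_num at h1 ⊢
  linarith

theorem psi_sub_theta_le_mul {x : ℝ} (hx : 81000 ≤ x) :
    Chebyshev.psi x - Chebyshev.theta x ≤ 0.0048 * x := by
  have hx0 : 0 < x := by linarith
  set s := x ^ ((2 : ℝ)⁻¹) with hs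
  have s0 : 0 < s := by positivity
  have hss : s * s = x := by
    rw [hs, ← Real.rpow_add hx0]
    norm_num
  have hs284 : 284 ≤ s := by nlinarith
  have h3 : x ^ ((3 : ℝ)⁻¹) ≤ s * (1 / 6) := by
    have e : s = x ^ ((3 : ℝ)⁻¹) * x ^ ((6 : ℝ)⁻¹) := by
      rw [hs, ← Real.rpow_add hx0]
      norm_num
    have : (6 : ℝ) ≤ x ^ ((6 : ℝ)⁻¹) := by
      rw [Real.le_rpow_inv_iff_of_pos (by norm_num) hx0.le (by norm_num)]
      norm_num
      linarith
    have := mul_le_mul_of_nonneg_left this (by positivity : 0 ≤ x ^ ((3 : ℝ)⁻¹))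
    linarith
  have h5 : x ^ ((5 : ℝ)⁻¹) ≤ s * (1 / 20) := by
    have e : s = x ^ ((5 : ℝ)⁻¹) * x ^ ((10 / 3 : ℝ)⁻¹) := by
      rw [hs, ← Real.rpow_add hx0]
      norm_num
    have : (20 : ℝ) ≤ x ^ ((10 / 3 : ℝ)⁻¹) := by
      rw [Real.le_rpow_inv_iff_of_pos (by norm_num) hx0.le (by norm_num)]
      have h : (20 : ℝ) ^ (10 / 3 : ℝ) ≤ (27145 : ℝ) := by
        have : (20 : ℝ) ^ (10 / 3 : ℝ) = ((20 : ℝ) ^ 10) ^ ((3 : ℝ)⁻¹) := by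
          rw [← Real.rpow_natCast, ← Real.rpow_mul (by norm_num)]
          norm_num
        rw [this, Real.rpow_inv_le_iff_of_pos (by norm_num) (by norm_num) (by norm_num)]
        norm_num
      linarith
    have := mul_le_mul_of_nonneg_left this (by positivity : 0 ≤ x ^ ((5 : ℝ)⁻¹))
    linarith
  have h := Chebyshev.psi_sub_theta_le_psi_add_psi_add_psi x
  have p2 := psi_le_mul (by positivity : 0 ≤ x ^ ((2 : ℝ)⁻¹))
  have p3 := psi_le_mul (by positivity : 0 ≤ x ^ ((3 : ℝ)⁻¹))
  have p5 := psi_le_mul (by positivity : 0 ≤ x ^ ((5 : ℝ)⁻¹))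
  rw [← hs] at h p2
  nlinarith

theorem log_add_div_le_log_log_mul {L v : ℝ} (hL : 11.28 ≤ L) (hv : 0.91 ≤ v) (hv' : v ≤ 1.11) :
    Real.log L + (v - 1) / L - 0.00108 ≤ Real.log (L + Real.log v) := by
  have hv0 : 0 < v := by linarith
  have h1 : 1 - v⁻¹ ≤ Real.log v := Real.one_sub_inv_le_log_of_pos hv0
  have hvi : v⁻¹ ≤ 1.12 := by
    rw [inv_le_comm₀ hv0 (by norm_num)]
    norm_num
    linarith
  have hL0 : 0 < L := by linarith
  have hy0 : 0 < L + (1 - v⁻¹) := by linarith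
  have h2 : 1 - L / (L + (1 - v⁻¹)) ≤ Real.log ((L + (1 - v⁻¹)) / L) := by
    have := Real.one_sub_inv_le_log_of_pos (div_pos hy0 hL0)
    rwa [inv_div] at this
  rw [Real.log_div hy0.ne' hL0.ne'] at h2
  have h3 : Real.log (L + (1 - v⁻¹)) ≤ Real.log (L + Real.log v) :=
    Real.log_le_log hy0 (by linarith)
  have hd : 0 < v * L + v - 1 := by nlinarith
  have hd' : v * L + v - 1 ≠ 0 := hd.ne'
  have h4 : 1 - L / (L + (1 - v⁻¹)) = (v - 1) / (v * L + v - 1) := by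
    have : L + (1 - v⁻¹) = (v * L + v - 1) / v := by field_simp; ring
    rw [this, div_div_eq_mul_div, eq_div_iff hd', sub_mul, div_mul_cancel₀ _ hd']
    ring
  have h5 : (v - 1) / L - 0.00108 ≤ (v - 1) / (v * L + v - 1) := by
    have h6 : (v - 1) / L - (v - 1) / (v * L + v - 1)
        = (v - 1) ^ 2 * (L + 1) / (L * (v * L + v - 1)) := by
      rw [div_sub_div _ _ hL0.ne' hd']
      congr 1
      ring
    have h7 : (v - 1) ^ 2 * (L + 1) / (L * (v * L + v - 1)) ≤ 0.00108 := by
      rw [div_le_iff₀ (by positivity)]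
      have h8 : (v - 1) ^ 2 ≤ 0.011 * v := by nlinarith
      have h9 : (v - 1) ^ 2 * (L + 1) ≤ 0.011 * v * (L + 1) := by gcongr
      have h10 : L * (v * (L - 0.1)) ≤ L * (v * L + v - 1) := by
        gcongr
        linarith
      have h11 : v * (0.011 * (L + 1)) ≤ v * (0.00108 * (L * (L - 0.1))) := by
        refine mul_le_mul_of_nonneg_left ?_ hv0.le
        nlinarith
      linarith
    linarith
  linarith

theorem robin_of_log_ge {N : ℕ} (hN : 90000 ≤ Real.log N)
    (hfree : ∀ p : ℕ, p.Prime → ¬ p ^ 6 ∣ N) :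
    ((∑ d ∈ N.divisors, d : ℕ) : ℝ) <
      Real.exp Real.eulerMascheroniConstant * (N : ℝ) * Real.log (Real.log N) := by
  have hN0 : N ≠ 0 := by
    rintro rfl
    norm_num at hN
  have hex : ∃ n : ℕ, Real.log N ≤ Chebyshev.theta n := by
    obtain ⟨n, hn⟩ := exists_nat_ge (2 * Real.log N)
    refine ⟨n, ?_⟩
    have hn0 : 20000 ≤ n := by
      have : (20000 : ℝ) ≤ n := by linarith
      exact_mod_cast this
    have h1 := le_psi_natCast_of_le hn0
    have h2 := psi_sub_theta_le_mul (x := n) (by linarith)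
    linarith
  classical
  obtain ⟨n, hn, hmin⟩ : ∃ n : ℕ, Real.log N ≤ Chebyshev.theta n ∧
      ∀ m < n, Chebyshev.theta m < Real.log N :=
    ⟨Nat.find hex, Nat.find_spec hex, fun m hm => not_le.1 (Nat.find_min hex hm)⟩
  have hψ := psi_natCast_le n
  have hθψ := Chebyshev.theta_le_psi n
  have hn81' : (81000 : ℝ) ≤ n := by linarith
  have hn81 : 81000 ≤ n := by exact_mod_cast hn81'
  have hψ' := le_psi_natCast_of_le (by omega : 20000 ≤ n)
  have hdiff := psi_sub_theta_le_mul hn81'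
  have hk : Chebyshev.theta n - Real.log n ≤ Real.log N := by
    obtain ⟨k, rfl⟩ : ∃ k, n = k + 1 := ⟨n - 1, by omega⟩
    have hk := hmin k (Nat.lt_succ_self k)
    rw [Chebyshev.theta_eq_sum_primesLE_log] at hk ⊢
    rw [Nat.primesLE_succ]
    split_ifs with hp
    · rw [sum_insert (Nat.notMem_primesLE k)]
      linarith
    · linarith [Real.log_natCast_nonneg (k + 1)]
  have hlog := log_sq_div_le (by linarith : (80000 : ℝ) ≤ n)
  have hln : 11.28 ≤ Real.log n :=
    log_80000_bounds.1.le.trans (Real.log_le_log (by norm_num) (by linarith))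
  have hln2 : Real.log n ≤ 0.00015 * n := by nlinarith
  have hL : 11.28 ≤ Real.log (n + 1) :=
    hln.trans (Real.log_le_log (by linarith) (by linarith))
  have hn1 : (0 : ℝ) < n + 1 := by linarith
  set L := Real.log ((n : ℝ) + 1) with hLdef
  set y := Chebyshev.theta n - Real.log n with hy
  have hy1 : 0.915 * n ≤ y := by linarith
  have hv1 : 0.91 ≤ y / (n + 1) := by
    rw [le_div_iff₀ hn1]
    linarith
  have hv2 : y / (n + 1) ≤ 1.11 := by
    rw [div_le_iff₀ hn1]
    linarith
  have h1 := log_add_div_le_log_log_mul hL hv1 hv2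
  rw [Real.log_div (by linarith) hn1.ne', ← hLdef, add_sub_cancel] at h1
  have h2 : Real.log (Real.log y) ≤ Real.log (Real.log (Real.log N)) := by
    refine Real.log_le_log (Real.log_pos (by linarith)) (Real.log_le_log (by linarith) hk)
  have h3 := (log_sum_divisors_div_le_of_log_le_theta (t := 5) hN0 hfree (by omega) hn).trans
    (sum_primesLE_log_geom_sum_le (by omega))
  have h4 := sum_neg_log_one_sub_inv_le (by omega : 1 ≤ n)
  have h5 := sum_vonMangoldt_div_mul_log_le (by omega : 80000 ≤ n + 1)
  rw [← hLdef] at h5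
  have h6 : (7 : ℝ) / 6 / n.sqrt ≤ 0.0042 := by
    have : 284 ≤ n.sqrt := Nat.le_sqrt.2 (by omega)
    have : (284 : ℝ) ≤ n.sqrt := by exact_mod_cast this
    rw [div_le_iff₀ (by linarith)]
    linarith
  have h7 : (Chebyshev.psi n - n) / ((n + 1) * L) ≤ (y / (n + 1) - 1) / L + 0.00045 := by
    have e : (Chebyshev.psi n - n) / ((n + 1) * L)
        = (y / (n + 1) - 1) / L + (Chebyshev.psi n - y + 1) / ((n + 1) * L) := by
      field_simp
      ring
    rw [e]
    gcongr
    rw [div_le_iff₀ (by positivity)]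
    nlinarith
  have h8 : 1 / L ≤ 0.0887 := by
    rw [div_le_iff₀ (by linarith)]
    linarith
  have h9 : 1 / L ^ 2 ≤ 0.008 := by
    rw [div_le_iff₀ (by positivity)]
    nlinarith
  have hfin : Real.log (((∑ d ∈ N.divisors, d : ℕ) : ℝ) / N)
      < Real.eulerMascheroniConstant + Real.log (Real.log (Real.log N)) := by
    clear hn81 hmin
    linarith
  have hNpos : (0 : ℝ) < N := by positivity
  have hσ : (0 : ℝ) < ((∑ d ∈ N.divisors, d : ℕ) : ℝ) := by
    have : 0 < ∑ d ∈ N.divisors, d :=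
      sum_pos (fun d hd => Nat.pos_of_mem_divisors hd) ⟨1, Nat.one_mem_divisors.2 hN0⟩
    exact_mod_cast this
  rw [Real.log_lt_iff_lt_exp (by positivity), Real.exp_add,
    Real.exp_log (Real.log_pos (by linarith)), div_lt_iff₀ hNpos] at hfin
  linarith

theorem harmonic_sub_log_sub_le_eulerMascheroniConstant {n : ℕ} (hn : n ≠ 0) :
    (harmonic n : ℝ) - Real.log n - 1 / (2 * n) ≤ Real.eulerMascheroniConstant := by
  have mono : Monotone fun k : ℕ => (harmonic (k + 1) : ℝ) - Real.log (k + 1 : ℕ)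
      - 1 / (2 * (k + 1 : ℕ)) := by
    refine monotone_nat_of_le_succ fun k => ?_
    have hk : (0 : ℝ) < (k + 1 : ℕ) := by positivity
    have hx : 1 ≤ ((k + 1 + 1 : ℕ) : ℝ) / (k + 1 : ℕ) := by
      rw [le_div_iff₀ hk]
      push_cast
      linarith
    have h := Real.self_le_sinh_iff.2 (Real.log_nonneg hx)
    rw [Real.sinh_log (by positivity), Real.log_div (by positivity) (by positivity)] at h
    rw [harmonic_succ (k + 1)]
    push_cast at h ⊢
    have e : (((k : ℝ) + 1 + 1) / (k + 1) - (((k : ℝ) + 1 + 1) / (k + 1))⁻¹) / 2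
        = ((k : ℝ) + 1 + 1)⁻¹ + 1 / (2 * (k + 1)) - 1 / (2 * (k + 1 + 1)) := by
      field_simp
      ring
    linarith
  have hlim : Tendsto (fun k : ℕ => (harmonic (k + 1) : ℝ) - Real.log (k + 1 : ℕ)
      - 1 / (2 * (k + 1 : ℕ))) atTop (nhds Real.eulerMascheroniConstant) := by
    have h1 := (tendsto_add_atTop_iff_nat 1).2 Real.tendsto_harmonic_sub_log
    have h2 : Tendsto (fun k : ℕ => 1 / (2 * ((k + 1 : ℕ) : ℝ))) atTop (nhds 0) := by
      refine Tendsto.const_div_atTop (Tendsto.const_mul_atTop (by norm_num) ?_) _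
      exact (tendsto_natCast_atTop_atTop (R := ℝ)).comp (tendsto_add_atTop_nat 1)
    simpa using h1.sub h2
  obtain ⟨k, rfl⟩ := Nat.exists_eq_succ_of_ne_zero hn
  exact mono.ge_of_tendsto hlim k

theorem le_eulerMascheroniConstant : 0.57719 ≤ Real.eulerMascheroniConstant := by
  have h := harmonic_sub_log_sub_le_eulerMascheroniConstant (n := 64) (by norm_num)
  have h2 : Real.log (64 : ℕ) = 6 * Real.log 2 := by
    rw [show ((64 : ℕ) : ℝ) = 2 ^ 6 by norm_num, Real.log_pow]
    norm_num
  have h3 : (4.743890 : ℚ) ≤ harmonic 64 := by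
    simp only [harmonic, sum_range_succ, sum_range_zero]
    norm_num
  have h4 : (4.743890 : ℝ) ≤ (harmonic 64 : ℝ) := by
    have : ((4.743890 : ℚ) : ℝ) ≤ (harmonic 64 : ℝ) := by exact_mod_cast h3
    norm_num at this ⊢
  have := log_two_bounds.2
  rw [h2] at h
  norm_num at h
  linarith

theorem lt_exp_eulerMascheroniConstant : 1.781 < Real.exp Real.eulerMascheroniConstant := by
  refine lt_of_lt_of_le ?_ (Real.exp_le_exp.2 le_eulerMascheroniConstant)
  refine lt_of_lt_of_le ?_ (Real.sum_le_exp_of_nonneg (by norm_num) 8)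
  simp only [sum_range_succ, sum_range_zero]
  norm_num [Nat.factorial]

/-- `powSum j n = n + n ^ 2 + ⋯ + n ^ j`. -/
def powSum : ℕ → ℕ → ℕ
  | 0, _ => 0
  | j + 1, n => n + n * powSum j n

theorem powSum_mono (j : ℕ) {m n : ℕ} (h : m ≤ n) : powSum j m ≤ powSum j n := by
  induction j with
  | zero => exact le_rfl
  | succ j ih => exact Nat.add_le_add h (Nat.mul_le_mul h ih)

theorem powSum_succ_pos (j : ℕ) {n : ℕ} (hn : 0 < n) : 0 < powSum (j + 1) n :=
  Nat.add_pos_left hn _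

theorem powSum_eq (j : ℕ) {n : ℕ} (hn : 0 < n) :
    (powSum j n + 1 : ℝ) = n ^ j * ∑ i ∈ range (j + 1), (1 / (n : ℝ)) ^ i := by
  have hn' : (n : ℝ) ≠ 0 := by positivity
  induction j with
  | zero => simp [powSum]
  | succ j ih =>
    rw [sum_range_succ, mul_add, pow_succ', mul_assoc, ← ih, ← pow_succ', one_div_pow,
      mul_one_div_cancel (pow_ne_zero _ hn'), powSum]
    push_cast
    ring

/-- The increments of the logarithm of the geometric sum. -/
theorem log_geom_sum_eq (v : ℕ) {n : ℕ} (hn : 0 < n) :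
    Real.log (∑ i ∈ range (v + 1), (1 / (n : ℝ)) ^ i)
      = ∑ j ∈ range v, Real.log (1 + 1 / (powSum (j + 1) n : ℝ)) := by
  have hn' : (0 : ℝ) < n := by exact_mod_cast hn
  induction v with
  | zero => simp
  | succ v ih =>
    rw [sum_range_succ _ v, ← ih]
    have h1 : 0 < ∑ i ∈ range (v + 1), (1 / (n : ℝ)) ^ i := by
      rw [sum_range_succ']
      positivity
    have h2 : (0 : ℝ) < powSum (v + 1) n := by exact_mod_cast powSum_succ_pos v hn
    rw [← Real.log_mul h1.ne' (by positivity), sum_range_succ]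
    congr 1
    have e1 := powSum_eq v hn
    have e2 : (powSum (v + 1) n : ℝ) = n * (powSum v n + 1) := by
      rw [powSum]
      push_cast
      ring
    rw [e2, e1, mul_add, mul_one]
    congr 1
    rw [one_div_pow, pow_succ']
    field_simp

theorem log_one_add_inv_le {y : ℝ} (hy : 0 < y) : Real.log (1 + 1 / y) ≤ 1 / y := by
  have := Real.log_le_sub_one_of_pos (by positivity : 0 < 1 + 1 / y)
  linarith

theorem inv_add_one_le_log {y : ℝ} (hy : 0 < y) : 1 / (y + 1) ≤ Real.log (1 + 1 / y) := by
  have := Real.one_sub_inv_le_log_of_pos (by positivity : 0 < 1 + 1 / y)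
  have e : 1 - (1 + 1 / y)⁻¹ = 1 / (y + 1) := by
    field_simp
    ring
  linarith

/-- `t` is an upper threshold, at slope `1 / (β log 2)`, for the bases at which the `j`-th power
is worthwhile. -/
def IsThreshold (β j t : ℕ) : Prop :=
  t ^ (powSum j t + 1) ≤ 2 ^ β ∧ 2 ^ β ≤ (t + 1) ^ powSum j (t + 1)

instance (β j t : ℕ) : Decidable (IsThreshold β j t) := instDecidableAnd

theorem IsThreshold.le_log {β j t n : ℕ} (h : IsThreshold β (j + 1) t) (hβ : 0 < β) (hn : 2 ≤ n)
    (hnt : n ≤ t) :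
    1 / (β * Real.log 2) * Real.log n ≤ Real.log (1 + 1 / (powSum (j + 1) n : ℝ)) := by
  have hβ' : (0 : ℝ) < β := by exact_mod_cast hβ
  have hl : 0 < Real.log 2 := Real.log_pos (by norm_num)
  have h1 : n ^ (powSum (j + 1) n + 1) ≤ 2 ^ β :=
    ((Nat.pow_le_pow_left hnt _).trans (Nat.pow_le_pow_right (by omega)
      (Nat.add_le_add_right (powSum_mono _ hnt) 1))).trans h.1
  have h2 : ((powSum (j + 1) n : ℝ) + 1) * Real.log n ≤ β * Real.log 2 := by
    have : ((n : ℝ) ^ (powSum (j + 1) n + 1)) ≤ 2 ^ β := by exact_mod_cast h1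
    have := Real.log_le_log (by positivity) this
    rw [Real.log_pow, Real.log_pow] at this
    exact_mod_cast this
  have hy : (0 : ℝ) < powSum (j + 1) n := by exact_mod_cast powSum_succ_pos j (by omega)
  refine le_trans ?_ (inv_add_one_le_log hy)
  rw [one_div_mul_eq_div, div_le_div_iff₀ (by positivity) (by positivity)]
  linarith

theorem IsThreshold.log_le {β j t n : ℕ} (h : IsThreshold β (j + 1) t) (hβ : 0 < β) (hnt : t < n) :
    Real.log (1 + 1 / (powSum (j + 1) n : ℝ)) ≤ 1 / (β * Real.log 2) * Real.log n := by
  have hβ' : (0 : ℝ) < β := by exact_mod_cast hβ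
  have hl : 0 < Real.log 2 := Real.log_pos (by norm_num)
  have h1 : 2 ^ β ≤ n ^ powSum (j + 1) n :=
    h.2.trans ((Nat.pow_le_pow_left hnt _).trans (Nat.pow_le_pow_right (by omega)
      (powSum_mono _ hnt)))
  have h2 : β * Real.log 2 ≤ (powSum (j + 1) n : ℝ) * Real.log n := by
    have : (2 : ℝ) ^ β ≤ (n : ℝ) ^ powSum (j + 1) n := by exact_mod_cast h1
    have := Real.log_le_log (by positivity) this
    rwa [Real.log_pow, Real.log_pow] at this
  have hy : (0 : ℝ) < powSum (j + 1) n := by exact_mod_cast powSum_succ_pos j (by omega)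
  refine (log_one_add_inv_le hy).trans ?_
  rw [one_div_mul_eq_div, div_le_div_iff₀ (by positivity) (by positivity)]
  linarith

theorem log_sum_divisors_div_le_of_isThreshold {N k β : ℕ} {t : ℕ → ℕ} (hN : N ≠ 0)
    (hfree : ∀ p : ℕ, p.Prime → ¬ p ^ (k + 1) ∣ N) (hβ : 0 < β)
    (ht : ∀ j < k, IsThreshold β (j + 1) (t j)) {A : ℕ → Bool} (hA : ∀ p, p.Prime → A p = true) :
    Real.log (((∑ d ∈ N.divisors, d : ℕ) : ℝ) / N) ≤ 1 / (β * Real.log 2) * Real.log N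
      + ∑ j ∈ range k, ∑ n ∈ Finset.Icc 2 (t j) with A n = true,
        (Real.log (1 + 1 / (powSum (j + 1) n : ℝ)) - 1 / (β * Real.log 2) * Real.log n) := by
  set c : ℝ := 1 / (β * Real.log 2) with hc
  set G : ℕ → ℕ → ℝ := fun j n => Real.log (1 + 1 / (powSum (j + 1) n : ℝ)) - c * Real.log n with hG
  set T := ∑ j ∈ range k, t j with hT
  have htT : ∀ j ∈ range k, t j ≤ T := fun j hj => single_le_sum (fun _ _ => Nat.zero_le _) hj
  set w : ℕ → ℝ := fun n => ∑ j ∈ range k, if n ≤ t j then G j n else 0 with hw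
  have key := log_sum_divisors_div_le hN (c := c) (w := w)
    (S := {n ∈ Finset.Icc 2 T | A n = true}) ?_ ?_ ?_
  · refine key.trans_eq ?_
    congr 1
    rw [hw, sum_comm]
    refine sum_congr rfl fun j hj => ?_
    rw [← sum_filter]
    refine sum_congr ?_ fun _ _ => rfl
    ext n
    have := htT j hj
    simp only [Finset.mem_filter, Finset.mem_Icc]
    constructor
    · rintro ⟨⟨⟨h1, h2⟩, h3⟩, h4⟩
      exact ⟨⟨h1, h4⟩, h3⟩
    · rintro ⟨⟨h1, h2⟩, h3⟩
      exact ⟨⟨⟨h1, h2.trans this⟩, h3⟩, h2⟩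
  · intro p hp hpN
    have hv : N.factorization p ≤ k := factorization_le_of_not_pow_dvd hN hp (hfree p hp)
    rw [log_geom_sum_eq _ hp.pos]
    have h1 : ∑ j ∈ range (N.factorization p), G j p
        ≤ ∑ j ∈ range (N.factorization p), if p ≤ t j then G j p else 0 := by
      refine sum_le_sum fun j hj => ?_
      split_ifs with h
      · exact le_rfl
      · rw [Finset.mem_range] at hj
        exact sub_nonpos.2 ((ht j (by omega)).log_le hβ (by omega))
    have h2 : (∑ j ∈ range (N.factorization p), if p ≤ t j then G j p else 0) ≤ w p := by
      refine sum_le_sum_of_subset_of_nonneg (range_mono hv) fun j hj _ => ?_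
      split_ifs with h
      · exact sub_nonneg.2 ((ht j (Finset.mem_range.1 hj)).le_log hβ hp.two_le h)
      · exact le_rfl
    rw [hG] at h1
    simp only [sum_sub_distrib, sum_const, card_range, nsmul_eq_mul] at h1
    linarith
  · intro n hn
    refine sum_nonneg fun j hj => ?_
    split_ifs with h
    · rw [Finset.mem_filter, Finset.mem_Icc] at hn
      exact sub_nonneg.2 ((ht j (Finset.mem_range.1 hj)).le_log hβ hn.1.1 h)
    · exact le_rfl
  · intro p hp hpS
    refine (sum_eq_zero fun j hj => if_neg fun h => hpS ?_).le
    rw [Finset.mem_filter, Finset.mem_Icc]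
    exact ⟨⟨hp.two_le, h.trans (htT j hj)⟩, hA p hp⟩

/-- The product of the primes below `256`. -/
def primeProd : ℕ :=
  64266330917908644872330635228106713310880186591609208114244758680898150367880703152525200743234420230

/-- A quick test which all primes pass. -/
def isPrimeLike (n : ℕ) : Bool :=
  Nat.beq (Nat.gcd n primeProd) 1 || (Nat.ble n 256 && (Nat.beq (Nat.gcd n 30030) 1 ||
    (Nat.ble n 13 && (Nat.beq (Nat.gcd n 6) 1 || Nat.ble n 3))))

theorem gcd_eq_one_of_dvd_factorial {p m k : ℕ} (hp : p.Prime) (hm : m ∣ k !) (hk : k < p) :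
    Nat.gcd p m = 1 :=
  (hp.coprime_iff_not_dvd).2 fun h => absurd ((hp.dvd_factorial).1 (h.trans hm)) (by omega)

theorem isPrimeLike_of_prime {p : ℕ} (hp : p.Prime) : isPrimeLike p = true := by
  have h1 : primeProd ∣ 256 ! := by decide +kernel
  have h2 : 30030 ∣ 13 ! := by decide +kernel
  have h3 : 6 ∣ 3 ! := by decide +kernel
  simp only [isPrimeLike, Bool.or_eq_true, Bool.and_eq_true, Nat.ble_eq, Nat.beq_eq]
  by_cases h256 : p ≤ 256
  · by_cases h13 : p ≤ 13
    · by_cases hp3 : p ≤ 3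
      · exact Or.inr ⟨h256, Or.inr ⟨h13, Or.inr hp3⟩⟩
      · exact Or.inr ⟨h256, Or.inr ⟨h13, Or.inl (gcd_eq_one_of_dvd_factorial hp h3 (by omega))⟩⟩
    · exact Or.inr ⟨h256, Or.inl (gcd_eq_one_of_dvd_factorial hp h2 (by omega))⟩
  · exact Or.inl (gcd_eq_one_of_dvd_factorial hp h1 (by omega))

/-- The product of `h n` over the prime-like `n ≤ t` in `[a, a + 2 ^ d)`, computed by binary
splitting. -/
def prodPrimeLike (h : ℕ → ℕ) (t : ℕ) : ℕ → ℕ → ℕ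
  | 0, a => bif Nat.ble a t && isPrimeLike a then h a else 1
  | d + 1, a =>
    bif Nat.ble a t then prodPrimeLike h t d a * prodPrimeLike h t d (a + 2 ^ d) else 1

theorem prodPrimeLike_eq (h : ℕ → ℕ) (t : ℕ) : ∀ d a : ℕ, prodPrimeLike h t d a
    = ∏ n ∈ Finset.Ico a (a + 2 ^ d), if n ≤ t ∧ isPrimeLike n = true then h n else 1
  | 0, a => by
    rw [pow_zero, Nat.Ico_succ_singleton, prod_singleton, prodPrimeLike]
    cases h1 : Nat.ble a t <;> cases h2 : isPrimeLike a <;> simp [← Nat.ble_eq, h1]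
  | d + 1, a => by
    rw [prodPrimeLike]
    cases h1 : Nat.ble a t
    · refine (prod_eq_one fun n hn => if_neg fun h => ?_).symm
      have := Nat.ble_eq ▸ (Finset.mem_Ico.1 hn).1.trans h.1
      simp [h1] at this
    · rw [cond_true, prodPrimeLike_eq h t d a, prodPrimeLike_eq h t d (a + 2 ^ d),
        prod_Ico_consecutive _ (Nat.le_add_right _ _) (Nat.le_add_right _ _), pow_succ', two_mul,
        add_assoc]

theorem prodPrimeLike_two (h : ℕ → ℕ) {t d : ℕ} (ht : t < 2 + 2 ^ d) :
    prodPrimeLike h t d 2 = ∏ n ∈ Finset.Icc 2 t with isPrimeLike n = true, h n := by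
  rw [prodPrimeLike_eq, ← prod_filter]
  refine prod_congr ?_ fun _ _ => rfl
  ext n
  simp only [Finset.mem_filter, Finset.mem_Ico, Finset.mem_Icc]
  constructor
  · rintro ⟨⟨h1, h2⟩, h3, h4⟩
    exact ⟨⟨h1, h3⟩, h4⟩
  · rintro ⟨⟨h1, h3⟩, h4⟩
    exact ⟨⟨h1, by omega⟩, h3, h4⟩

/-- The product of `h j n` over `j < m` and the prime-like `2 ≤ n ≤ t j`. -/
def prodBelow (h : ℕ → ℕ → ℕ) (t : ℕ → ℕ) (d : ℕ) : ℕ → ℕ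
  | 0 => 1
  | m + 1 => prodBelow h t d m * prodPrimeLike (h m) (t m) d 2

theorem log_prodBelow {h : ℕ → ℕ → ℕ} {t : ℕ → ℕ} {d : ℕ} (m : ℕ) (ht : ∀ j < m, t j < 2 + 2 ^ d)
    (h0 : ∀ j n, 0 < n → h j n ≠ 0) :
    Real.log (prodBelow h t d m)
      = ∑ j ∈ range m, ∑ n ∈ Finset.Icc 2 (t j) with isPrimeLike n = true, Real.log (h j n) := by
  have e : prodBelow h t d m
      = ∏ j ∈ range m, ∏ n ∈ Finset.Icc 2 (t j) with isPrimeLike n = true, h j n := by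
    induction m with
    | zero => rfl
    | succ m ih =>
      rw [prodBelow, prod_range_succ, ih fun j hj => ht j (by omega),
        prodPrimeLike_two _ (ht m (by omega))]
  have h1 : ∀ j, ∀ n ∈ {n ∈ Finset.Icc 2 (t j) | isPrimeLike n = true}, (h j n : ℝ) ≠ 0 := by
    intro j n hn
    rw [Finset.mem_filter, Finset.mem_Icc] at hn
    exact_mod_cast h0 j n (by omega)
  rw [e]
  push_cast
  rw [Real.log_prod fun j _ => prod_ne_zero_iff.2 (h1 j)]
  exact sum_congr rfl fun j _ => Real.log_prod (h1 j)

theorem prodBelow_pos {h : ℕ → ℕ → ℕ} {t : ℕ → ℕ} {d : ℕ} (m : ℕ) (ht : ∀ j < m, t j < 2 + 2 ^ d)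
    (h0 : ∀ j n, 0 < n → h j n ≠ 0) : 0 < prodBelow h t d m := by
  induction m with
  | zero => exact Nat.one_pos
  | succ m ih =>
    rw [prodBelow, prodPrimeLike_two _ (ht m (by omega))]
    refine Nat.mul_pos (ih fun j hj => ht j (by omega)) (Nat.pos_of_ne_zero ?_)
    refine prod_ne_zero_iff.2 fun n hn => h0 m n ?_
    rw [Finset.mem_filter, Finset.mem_Icc] at hn
    omega

/-- At slope `1 / (β log 2)` and with thresholds `t`, the extremal abundancy index is at most
`K / 2 ^ 30` and the extremal number is at least `2 ^ (k / r)`. -/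
def IsExtremalBound (β : ℕ) (t : ℕ → ℕ) (d K k r : ℕ) : Prop :=
  (∀ j < 5, IsThreshold β (j + 1) (t j) ∧ t j < 2 + 2 ^ d) ∧
  prodBelow (fun j n => powSum (j + 1) n + 1) t d 5 * 2 ^ 30
    ≤ K * prodBelow (fun j n => powSum (j + 1) n) t d 5 ∧
  2 ^ k ≤ prodBelow (fun _ n => n) t d 5 ^ r ∧ 0 < β ∧ 0 < K ∧ 0 < r

instance (β : ℕ) (t : ℕ → ℕ) (d K k r : ℕ) : Decidable (IsExtremalBound β t d K k r) :=
  instDecidableAnd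

theorem log_sum_divisors_div_le_of_isExtremalBound {N β d K k r : ℕ} {t : ℕ → ℕ} (hN : N ≠ 0)
    (hfree : ∀ p : ℕ, p.Prime → ¬ p ^ 6 ∣ N) (h : IsExtremalBound β t d K k r) :
    Real.log (((∑ d ∈ N.divisors, d : ℕ) : ℝ) / N)
      ≤ Real.log (K / 2 ^ 30) + (Real.log N / Real.log 2 - k / r) / β := by
  obtain ⟨ht, hK, hk, hβ, hK0, hr⟩ := h
  have key := log_sum_divisors_div_le_of_isThreshold (k := 5) hN hfree hβ (fun j hj => (ht j hj).1)
    (A := isPrimeLike) fun p hp => isPrimeLike_of_prime hp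
  have htd := fun j hj => (ht j hj).2
  have hβ' : (0 : ℝ) < β := by exact_mod_cast hβ
  have hr' : (0 : ℝ) < r := by exact_mod_cast hr
  have hl : 0 < Real.log 2 := Real.log_pos (by norm_num)
  have hp0 : ∀ j n : ℕ, 0 < n → powSum (j + 1) n ≠ 0 := fun j n hn => (powSum_succ_pos j hn).ne'
  have e1 := log_prodBelow (d := d) (h := fun j n => powSum (j + 1) n + 1) 5 htd
    fun _ _ _ => Nat.succ_ne_zero _
  have e2 := log_prodBelow (d := d) (h := fun j n => powSum (j + 1) n) 5 htd hp0
  have e3 := log_prodBelow (d := d) (h := fun _ n => n) 5 htd fun _ _ hn => hn.ne'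
  have p1 := prodBelow_pos (d := d) (h := fun j n => powSum (j + 1) n + 1) 5 htd
    fun _ _ _ => Nat.succ_ne_zero _
  have p2 := prodBelow_pos (d := d) (h := fun j n => powSum (j + 1) n) 5 htd hp0
  generalize prodBelow (fun j n => powSum (j + 1) n + 1) t d 5 = P at *
  generalize prodBelow (fun j n => powSum (j + 1) n) t d 5 = Q at *
  generalize prodBelow (fun _ n => n) t d 5 = C at *
  have hP : Real.log P - Real.log Q ≤ Real.log (K / 2 ^ 30) := by
    have hP0 : (0 : ℝ) < P := by exact_mod_cast p1
    have hQ0 : (0 : ℝ) < Q := by exact_mod_cast p2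
    rw [← Real.log_div hP0.ne' hQ0.ne']
    refine Real.log_le_log (by positivity) ?_
    rw [div_le_div_iff₀ hQ0 (by positivity)]
    exact_mod_cast hK
  have hC : k / r * Real.log 2 ≤ Real.log C := by
    have : (2 : ℝ) ^ k ≤ (C : ℝ) ^ r := by exact_mod_cast hk
    have := Real.log_le_log (by positivity) this
    rw [Real.log_pow, Real.log_pow] at this
    rw [div_mul_eq_mul_div, div_le_iff₀ hr']
    linarith
  have e4 : ∑ j ∈ range 5, ∑ n ∈ Finset.Icc 2 (t j) with isPrimeLike n = true,
      (Real.log (1 + 1 / (powSum (j + 1) n : ℝ)) - 1 / (β * Real.log 2) * Real.log n)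
      = Real.log P - Real.log Q - 1 / (β * Real.log 2) * Real.log C := by
    rw [e1, e2, e3, mul_sum, ← sum_sub_distrib, ← sum_sub_distrib]
    refine sum_congr rfl fun j _ => ?_
    rw [mul_sum, ← sum_sub_distrib, ← sum_sub_distrib]
    refine sum_congr rfl fun n hn => ?_
    rw [Finset.mem_filter, Finset.mem_Icc] at hn
    have : (0 : ℝ) < powSum (j + 1) n := by exact_mod_cast powSum_succ_pos j (by omega)
    rw [← Real.log_div (by positivity) this.ne']
    push_cast
    rw [add_div, div_self this.ne']
  rw [e4] at key
  have h5 : 1 / (β * Real.log 2) * (k / r * Real.log 2) ≤ 1 / (β * Real.log 2) * Real.log C := by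
    gcongr
  have e6 : (Real.log N / Real.log 2 - k / r) / β
      = 1 / (β * Real.log 2) * Real.log N - 1 / (β * Real.log 2) * (k / r * Real.log 2) := by
    field_simp
  linarith

theorem concaveOn_log_log : ConcaveOn ℝ (Set.Ioi 1) fun x => Real.log (Real.log x) := by
  refine ⟨convex_Ioi 1, fun x hx y hy a b ha hb hab => ?_⟩
  rw [Set.mem_Ioi] at hx hy
  have lx := Real.log_pos hx
  have ly := Real.log_pos hy
  have h1 := strictConcaveOn_log_Ioi.concaveOn.2 (Set.mem_Ioi.2 (by linarith : 0 < x))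
    (Set.mem_Ioi.2 (by linarith : 0 < y)) ha hb hab
  have h2 := strictConcaveOn_log_Ioi.concaveOn.2 (Set.mem_Ioi.2 lx) (Set.mem_Ioi.2 ly) ha hb hab
  exact h2.trans (Real.log_le_log
    (convex_Ioi (0 : ℝ) (Set.mem_Ioi.2 lx) (Set.mem_Ioi.2 ly) ha hb hab) h1)

/-- A sufficient condition, in integers, for the extremal bound to satisfy Robin's inequality at
`2 ^ l`. -/
def IsRobinPoint (m n a β K k r l : ℕ) : Prop :=
  2 ^ a * 1000000 ^ m ≤ (l * 693147) ^ m ∧ l * r ≤ k + n * β * r ∧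
  K * (n * β * r) ^ n * (m * 1000000000)
    ≤ 2 ^ 30 * (k + n * β * r - l * r) ^ n * (1781 * a * 693147) ∧
  0 < a ∧ 0 < m ∧ 0 < n

instance (m n a β K k r l : ℕ) : Decidable (IsRobinPoint m n a β K k r l) := instDecidableAnd

theorem IsRobinPoint.le_log_log {m n a β K k r l : ℕ} (h : IsRobinPoint m n a β K k r l)
    (hβ : 0 < β) (hK : 0 < K) (hr : 0 < r) :
    1 < l * Real.log 2 ∧
    Real.log (K / 2 ^ 30) + (l - k / r : ℝ) / β
      ≤ Real.log 1.781 + Real.log (Real.log (l * Real.log 2)) := by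
  obtain ⟨h1, h2, h3, ha, hm, hn⟩ := h
  have hβ' : (0 : ℝ) < β := by exact_mod_cast hβ
  have hr' : (0 : ℝ) < r := by exact_mod_cast hr
  have hK' : (0 : ℝ) < K := by exact_mod_cast hK
  have ha' : (0 : ℝ) < a := by exact_mod_cast ha
  have hm' : (0 : ℝ) < m := by exact_mod_cast hm
  have hn' : (0 : ℝ) < n := by exact_mod_cast hn
  have hl := log_two_bounds.1
  have hl0 : 0 < l := by
    rcases Nat.eq_zero_or_pos l with rfl | h
    · rw [zero_mul, zero_pow hm.ne'] at h1
      have : 0 < 2 ^ a * 1000000 ^ m := by positivity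
      omega
    · exact h
  have hl0' : (0 : ℝ) < l := by exact_mod_cast hl0
  have g1 : (a : ℝ) / m * 0.693147 ≤ Real.log (l * Real.log 2) := by
    have : (2 : ℝ) ^ a ≤ (l * 0.693147) ^ m := by
      have : (2 : ℝ) ^ a * 1000000 ^ m ≤ (l * 693147) ^ m := by exact_mod_cast h1
      rw [show (l : ℝ) * 693147 = l * 0.693147 * 1000000 by ring, mul_pow] at this
      exact le_of_mul_le_mul_right this (by positivity)
    have h4 := Real.log_le_log (by positivity) this
    rw [Real.log_pow, Real.log_pow] at h4
    have h5 : Real.log (l * 0.693147) ≤ Real.log (l * Real.log 2) := by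
      refine Real.log_le_log (by positivity) ?_
      gcongr
    refine le_trans ?_ h5
    rw [div_mul_eq_mul_div, div_le_iff₀ hm']
    nlinarith
  have g2 : 0 < Real.log (l * Real.log 2) := lt_of_lt_of_le (by positivity) g1
  set x : ℝ := (l - k / r : ℝ) / β with hx
  have e : 1 - x / n = ((k + n * β * r - l * r : ℕ) : ℝ) / (n * β * r) := by
    rw [hx]
    push_cast [h2]
    field_simp
    ring
  have hxn : x ≤ n := by
    have : 0 ≤ 1 - x / n := by
      rw [e]
      positivity
    have : x / n ≤ 1 := by linarith
    rwa [div_le_one hn'] at this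
  have g3 := Real.one_sub_div_pow_le_exp_neg hxn
  have g4 : (K : ℝ) / 2 ^ 30 ≤ (1 - x / n) ^ n * (1.781 * (a / m * 0.693147)) := by
    have : (K : ℝ) * (n * β * r) ^ n * (m * 1000000000)
        ≤ 2 ^ 30 * ((k + n * β * r - l * r : ℕ) : ℝ) ^ n * (1781 * a * 693147) := by
      exact_mod_cast h3
    rw [e, div_pow]
    rw [show ((k + n * β * r - l * r : ℕ) : ℝ) ^ n / (n * β * r) ^ n * (1.781 * (a / m * 0.693147))
      = (((k + n * β * r - l * r : ℕ) : ℝ) ^ n * (1781 * a * 693147))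
        / ((n * β * r) ^ n * (m * 1000000000)) by field_simp; ring]
    rw [div_le_div_iff₀ (by positivity) (by positivity)]
    linarith
  have g5 : (K : ℝ) / 2 ^ 30 ≤ Real.exp (-x) * (1.781 * Real.log (l * Real.log 2)) := by
    refine g4.trans ?_
    gcongr
  have g6 := Real.log_le_log (by positivity) g5
  rw [Real.log_mul (Real.exp_pos _).ne' (by positivity), Real.log_exp,
    Real.log_mul (by norm_num) g2.ne'] at g6
  refine ⟨?_, by linarith⟩
  by_contra hc
  exact absurd g2 (not_lt.2 (Real.log_nonpos (by positivity) (not_lt.1 hc)))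

theorem robin_of_log_abundancy_le {N : ℕ} (hN : 1 < Real.log N)
    (h : Real.log (((∑ d ∈ N.divisors, d : ℕ) : ℝ) / N)
      ≤ Real.log 1.781 + Real.log (Real.log (Real.log N))) :
    ((∑ d ∈ N.divisors, d : ℕ) : ℝ) <
      Real.exp Real.eulerMascheroniConstant * (N : ℝ) * Real.log (Real.log N) := by
  have hN0 : N ≠ 0 := by
    rintro rfl
    norm_num at hN
  have hNpos : (0 : ℝ) < N := by positivity
  have hσ : (0 : ℝ) < ((∑ d ∈ N.divisors, d : ℕ) : ℝ) := by
    have : 0 < ∑ d ∈ N.divisors, d :=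
      sum_pos (fun d hd => Nat.pos_of_mem_divisors hd) ⟨1, Nat.one_mem_divisors.2 hN0⟩
    exact_mod_cast this
  have hll := Real.log_pos hN
  rw [← Real.log_mul (by norm_num) hll.ne', Real.log_le_log_iff (by positivity) (by positivity),
    div_le_iff₀ hNpos] at h
  refine h.trans_lt ?_
  rw [mul_right_comm]
  gcongr
  exact lt_exp_eulerMascheroniConstant

theorem robin_of_isExtremalBound {N β d K k r m n a₁ a₂ l₁ l₂ : ℕ} {t : ℕ → ℕ}
    (hfree : ∀ p : ℕ, p.Prime → ¬ p ^ 6 ∣ N) (h : IsExtremalBound β t d K k r)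
    (h₁ : IsRobinPoint m n a₁ β K k r l₁) (h₂ : IsRobinPoint m n a₂ β K k r l₂)
    (hN₁ : l₁ * Real.log 2 ≤ Real.log N) (hN₂ : Real.log N ≤ l₂ * Real.log 2) :
    ((∑ d ∈ N.divisors, d : ℕ) : ℝ) <
      Real.exp Real.eulerMascheroniConstant * (N : ℝ) * Real.log (Real.log N) := by
  obtain ⟨-, -, -, hβ, hK, hr⟩ := id h
  obtain ⟨b₁, c₁⟩ := h₁.le_log_log hβ hK hr
  obtain ⟨b₂, c₂⟩ := h₂.le_log_log hβ hK hr
  have hN : 1 < Real.log N := b₁.trans_le hN₁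
  have hN0 : N ≠ 0 := by
    rintro rfl
    norm_num at hN
  have hl : Real.log 2 ≠ 0 := (Real.log_pos (by norm_num)).ne'
  have hβ' : (β : ℝ) ≠ 0 := by exact_mod_cast hβ.ne'
  refine robin_of_log_abundancy_le hN
    ((log_sum_divisors_div_le_of_isExtremalBound hN0 hfree h).trans ?_)
  set s := 1 / (β * Real.log 2) with hs
  have conc : ConcaveOn ℝ (Set.Ioi 1) fun x => Real.log (Real.log x) - s * x :=
    concaveOn_log_log.sub ((s • LinearMap.id : ℝ →ₗ[ℝ] ℝ).convexOn (convex_Ioi 1))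
  have hmin := conc.min_le_of_mem_Icc b₁ b₂ ⟨hN₁, hN₂⟩
  have e : ∀ l : ℝ, s * (l * Real.log 2) = l / β := by
    intro l
    rw [hs]
    field_simp
  have e' : Real.log N / Real.log 2 / β = s * Real.log N := by
    rw [hs]
    field_simp
  simp only [e, min_le_iff] at hmin
  rw [sub_div, e']
  rw [sub_div] at c₁ c₂
  rcases hmin with h | h <;> linarith

/-- The part of the sum of the divisors of `N` coming from `d ≤ k` and from `N / d > s`. -/
def pairedDivisorSum (N s : ℕ) : ℕ → ℕ
  | 0 => 0
  | k + 1 => pairedDivisorSum N s k + bif Nat.beq (N % (k + 1)) 0 then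
      k + 1 + bif Nat.ble (N / (k + 1)) s then 0 else N / (k + 1) else 0

theorem sum_divisors_le_pairedDivisorSum {N s : ℕ} (hs : N < (s + 1) * (s + 1)) :
    ∑ d ∈ N.divisors, d ≤ pairedDivisorSum N s s := by
  have e : ∀ k, pairedDivisorSum N s k = ∑ d ∈ Finset.Icc 1 k with d ∣ N, d
      + ∑ d ∈ Finset.Icc 1 k with d ∣ N ∧ ¬ N / d ≤ s, N / d := by
    intro k
    simp only [sum_filter]
    rw [← sum_add_distrib]
    induction k with
    | zero => rfl
    | succ k ih =>
      rw [pairedDivisorSum, sum_Icc_succ_top (by omega), ih]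
      congr 1
      by_cases h : k + 1 ∣ N
      · rw [if_pos h, Nat.mod_eq_zero_of_dvd h, show Nat.beq 0 0 = true from rfl, cond_true]
        congr 1
        cases h2 : Nat.ble (N / (k + 1)) s <;> simp [h, ← Nat.ble_eq, h2]
      · have : Nat.beq (N % (k + 1)) 0 = false := by
          rw [← Bool.not_eq_true, Nat.beq_eq, ← Nat.dvd_iff_mod_eq_zero]
          exact h
        rw [if_neg h, if_neg fun h' => h h'.1, this, cond_false, add_zero]
  rw [e, ← sum_filter_add_sum_filter_not N.divisors (· ≤ s)]
  refine Nat.add_le_add (sum_le_sum_of_subset fun d hd => ?_) ?_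
  · rw [Finset.mem_filter, Nat.mem_divisors] at hd
    rw [Finset.mem_filter, Finset.mem_Icc]
    exact ⟨⟨Nat.pos_of_dvd_of_pos hd.1.1 (Nat.pos_of_ne_zero hd.1.2), hd.2⟩, hd.1.1⟩
  · have h1 : ∀ d ∈ {d ∈ N.divisors | ¬ d ≤ s}, N / (N / d) = d := fun d hd =>
      Nat.div_div_self (Nat.dvd_of_mem_divisors (Finset.mem_filter.1 hd).1)
        (Nat.mem_divisors.1 (Finset.mem_filter.1 hd).1).2
    have h2 : ∑ d ∈ N.divisors with ¬ d ≤ s, d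
        = ∑ d ∈ ({d ∈ N.divisors | ¬ d ≤ s}).image (N / ·), N / d := by
      rw [sum_image fun a ha b hb hab => by rw [← h1 a ha, ← h1 b hb, hab]]
      exact sum_congr rfl fun d hd => (h1 d hd).symm
    rw [h2]
    refine sum_le_sum_of_subset fun c hc => ?_
    obtain ⟨d, hd, rfl⟩ := Finset.mem_image.1 hc
    have hd' := h1 d hd
    rw [Finset.mem_filter, Nat.mem_divisors] at hd
    rw [Finset.mem_filter, Finset.mem_Icc, hd']
    have hd0 : 0 < d := by omega
    refine ⟨⟨Nat.div_pos (Nat.le_of_dvd (Nat.pos_of_ne_zero hd.1.2) hd.1.1) hd0, ?_⟩,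
      Nat.div_dvd_of_dvd hd.1.1, hd.2⟩
    rw [← Nat.lt_succ_iff, Nat.div_lt_iff_lt_mul hd0]
    exact hs.trans_le (Nat.mul_le_mul_left _ (by omega))

/-- Checks an upper bound for the abundancy index of the `k` integers following `N`. -/
def abundancyCheck (s : ℕ) : ℕ → ℕ → Bool
  | 0, _ => true
  | k + 1, N => Nat.ble (pairedDivisorSum (N + 1) s s * 10000) (38148 * (N + 1)) &&
      abundancyCheck s k (N + 1)

theorem le_of_abundancyCheck {s : ℕ} : ∀ {k N : ℕ}, abundancyCheck s k N = true → ∀ i < k,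
    pairedDivisorSum (N + i + 1) s s * 10000 ≤ 38148 * (N + i + 1)
  | 0, _, _, i, hi => absurd hi (Nat.not_lt_zero i)
  | k + 1, N, h, i, hi => by
    rw [abundancyCheck, Bool.and_eq_true, Nat.ble_eq] at h
    rcases i with _ | i
    · exact h.1
    · have := le_of_abundancyCheck h.2 i (by omega)
      rwa [show N + 1 + i = N + (i + 1) by ring] at this

theorem abundancyCheck_5040 : abundancyCheck 90 3160 5040 = true := by decide +kernel

theorem robin_of_le_8200 {N : ℕ} (hN : 5040 < N) (hN' : N ≤ 8200) :
    ((∑ d ∈ N.divisors, d : ℕ) : ℝ) <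
      Real.exp Real.eulerMascheroniConstant * (N : ℝ) * Real.log (Real.log N) := by
  have hl := log_two_bounds.1
  have pow_le : ∀ {a b m x : ℕ} (y : ℝ), 2 ^ a * b ^ m ≤ x ^ m → 0 < b → (x : ℝ) / b ≤ y →
      a * Real.log 2 ≤ m * Real.log y := by
    intro a b m x y h hb hy
    have hb' : (0 : ℝ) < b := by exact_mod_cast hb
    rw [← Real.log_pow, ← Real.log_pow]
    refine Real.log_le_log (by positivity) ?_
    refine le_trans ?_ (pow_le_pow_left₀ (by positivity) hy m)
    rw [div_pow, le_div_iff₀ (by positivity)]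
    exact_mod_cast h
  have h1 : 8.525 ≤ Real.log N := by
    have := pow_le (a := 12299) (b := 1) (m := 1000) (x := 5041) (N : ℝ) (by decide +kernel)
      one_pos (by simpa using (by exact_mod_cast hN : (5041 : ℝ) ≤ N))
    push_cast at this
    linarith
  have h2 : 2.142 ≤ Real.log (Real.log N) := by
    have := pow_le (a := 3091) (b := 1000) (m := 1000) (x := 8525) (Real.log N) (by decide +kernel)
      (by norm_num) (le_trans (by norm_num) h1)
    push_cast at this
    linarith
  have h3 := le_of_abundancyCheck abundancyCheck_5040 (N - 5041) (by omega)
  rw [show 5040 + (N - 5041) + 1 = N by omega] at h3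
  have h4 : (∑ d ∈ N.divisors, d) * 10000 ≤ 38148 * N :=
    (Nat.mul_le_mul_right _ (sum_divisors_le_pairedDivisorSum (by omega))).trans h3
  have h5 : ((∑ d ∈ N.divisors, d : ℕ) : ℝ) * 10000 ≤ 38148 * N := by exact_mod_cast h4
  have hN0 : (0 : ℝ) < N := by exact_mod_cast (by omega : 0 < N)
  have h6 := lt_exp_eulerMascheroniConstant
  have h7 : 1.781 * 2.142 ≤ Real.exp Real.eulerMascheroniConstant * Real.log (Real.log N) := by
    gcongr
  have h8 := mul_le_mul_of_nonneg_right h7 hN0.le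
  linarith

/-- The thresholds given by a list. -/
def thresholds (l : List ℕ) (j : ℕ) : ℕ := l.getD j 1

theorem robin_of_log_le {N : ℕ} (hN : 8192 ≤ N) (hN' : Real.log N ≤ 90000)
    (hfree : ∀ p : ℕ, p.Prime → ¬ p ^ 6 ∣ N) :
    ((∑ d ∈ N.divisors, d : ℕ) : ℝ) <
      Real.exp Real.eulerMascheroniConstant * (N : ℝ) * Real.log (Real.log N) := by
  have h0 : (13 : ℕ) * Real.log 2 ≤ Real.log N := by
    rw [← Real.log_pow]
    exact Real.log_le_log (by norm_num) (by exact_mod_cast hN)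
  have hl := log_two_bounds.1
  rcases le_total (Real.log N) ((18 : ℕ) * Real.log 2) with h1 | h0
  · refine robin_of_isExtremalBound (β := 37) (t := thresholds [10, 3, 2, 2, 1]) (d := 4)
      (K := 4121123382) (k := 787) (r := 64)
      (m := 2048) (n := 1024) (a₁ := 6495)
      (a₂ := 7457) (l₁ := 13) (l₂ := 18) hfree (by decide +kernel)
      (by decide +kernel) (by decide +kernel) h0 h1
  rcases le_total (Real.log N) ((37 : ℕ) * Real.log 2) with h1 | h0
  · refine robin_of_isExtremalBound (β := 74) (t := thresholds [17, 5, 3, 2, 2]) (d := 4)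
      (K := 5520737889) (k := 1821) (r := 64)
      (m := 2048) (n := 1024) (a₁ := 7457)
      (a₂ := 9586) (l₁ := 18) (l₂ := 37) hfree (by decide +kernel)
      (by decide +kernel) (by decide +kernel) h0 h1
  rcases le_total (Real.log N) ((82 : ℕ) * Real.log 2) with h1 | h0
  · refine robin_of_isExtremalBound (β := 205) (t := thresholds [38, 7, 4, 3, 2]) (d := 6)
      (K := 6825607258) (k := 3624) (r := 64)
      (m := 2048) (n := 1024) (a₁ := 9586)
      (a₂ := 11937) (l₁ := 37) (l₂ := 82) hfree (by decide +kernel)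
      (by decide +kernel) (by decide +kernel) h0 h1
  rcases le_total (Real.log N) ((196 : ℕ) * Real.log 2) with h1 | h0
  · refine robin_of_isExtremalBound (β := 583) (t := thresholds [89, 12, 5, 3, 3]) (d := 7)
      (K := 8460818741) (k := 8668) (r := 64)
      (m := 2048) (n := 1024) (a₁ := 11937)
      (a₂ := 14512) (l₁ := 82) (l₂ := 196) hfree (by decide +kernel)
      (by decide +kernel) (by decide +kernel) h0 h1
  rcases le_total (Real.log N) ((481 : ℕ) * Real.log 2) with h1 | h0
  · refine robin_of_isExtremalBound (β := 1693) (t := thresholds [217, 19, 7, 4, 3]) (d := 8)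
      (K := 10074305259) (k := 20214) (r := 64)
      (m := 2048) (n := 1024) (a₁ := 14512)
      (a₂ := 17164) (l₁ := 196) (l₂ := 481) hfree (by decide +kernel)
      (by decide +kernel) (by decide +kernel) h0 h1
  rcases le_total (Real.log N) ((1238 : ℕ) * Real.log 2) with h1 | h0
  · refine robin_of_isExtremalBound (β := 5016) (t := thresholds [550, 31, 10, 6, 4]) (d := 10)
      (K := 11815308445) (k := 50661) (r := 64)
      (m := 2048) (n := 1024) (a₁ := 17164)
      (a₂ := 19957) (l₁ := 481) (l₂ := 1238) hfree (by decide +kernel)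
      (by decide +kernel) (by decide +kernel) h0 h1
  rcases le_total (Real.log N) ((3325 : ℕ) * Real.log 2) with h1 | h0
  · refine robin_of_isExtremalBound (β := 15251) (t := thresholds [1451, 51, 15, 8, 5]) (d := 11)
      (K := 13662653714) (k := 134479) (r := 64)
      (m := 2048) (n := 1024) (a₁ := 19957)
      (a₂ := 22876) (l₁ := 1238) (l₂ := 3325) hfree (by decide +kernel)
      (by decide +kernel) (by decide +kernel) h0 h1
  rcases le_total (Real.log N) ((9346 : ℕ) * Real.log 2) with h1 | h0
  · refine robin_of_isExtremalBound (β := 47835) (t := thresholds [3997, 85, 21, 10, 6]) (d := 12)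
      (K := 15577135736) (k := 370312) (r := 64)
      (m := 2048) (n := 1024) (a₁ := 22876)
      (a₂ := 25930) (l₁ := 3325) (l₂ := 9346) hfree (by decide +kernel)
      (by decide +kernel) (by decide +kernel) h0 h1
  rcases le_total (Real.log N) ((26769 : ℕ) * Real.log 2) with h1 | h0
  · refine robin_of_isExtremalBound (β := 150712)
      (t := thresholds [11203, 144, 30, 13, 8]) (d := 14)
      (K := 17521488941) (k := 16212) (r := 1)
      (m := 2048) (n := 1024) (a₁ := 25930)
      (a₂ := 29039) (l₁ := 9346) (l₂ := 26769) hfree (by decide +kernel)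
      (by decide +kernel) (by decide +kernel) h0 h1
  rcases le_total (Real.log N) ((78510 : ℕ) * Real.log 2) with h1 | h0
  · refine robin_of_isExtremalBound (β := 480398)
      (t := thresholds [32090, 245, 44, 18, 10]) (d := 15)
      (K := 19497911620) (k := 46297) (r := 1)
      (m := 2048) (n := 1024) (a₁ := 29039)
      (a₂ := 32218) (l₁ := 26769) (l₂ := 78510) hfree (by decide +kernel)
      (by decide +kernel) (by decide +kernel) h0 h1
  refine robin_of_isExtremalBound (β := 951909)
      (t := thresholds [59973, 336, 54, 21, 11]) (d := 16)
    (K := 20681651277) (k := 86805) (r := 1)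
    (m := 2048) (n := 1024) (a₁ := 32218)
    (a₂ := 33705) (l₁ := 78510) (l₂ := 129845) hfree (by decide +kernel)
    (by decide +kernel) (by decide +kernel) h0 ?_
  push_cast
  linarith

end

theorem robin_of_sixfree (N : ℕ) (hN : 5040 < N)
    (hfree : ∀ p : ℕ, p.Prime → ¬ p ^ 6 ∣ N) :
    ((∑ d ∈ N.divisors, d : ℕ) : ℝ) <
      Real.exp Real.eulerMascheroniConstant * (N : ℝ) * Real.log (Real.log N) := by
  rcases Nat.lt_or_ge N 8192 with h | h
  · exact robin_of_le_8200 hN (by omega)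
  · rcases le_total (Real.log N) 90000 with h' | h'
    · exact robin_of_log_le h h' hfree
    · exact robin_of_log_ge h' hfree
end

section
/- Let (S_n) be a sequence of positive integers and (t_n) a sequence of integers with t_n ≥ 2, such that S_n ≥ N_n for all sufficiently large n, S_n is t_n-free for all n, and t_n/log log n → 0 as n → ∞. Then for all sufficiently large n Robin's inequality holds for S_n: σ(S_n) < e^γ · S_n · log log S_n. -/
open Finset Filter

/-- The logarithm of the Euler factor of `ζ(1 + s)` at a prime `n`, and `0` if `n` is not prime. -/
noncomputable def logEulerFactor (s : ℝ) (n : ℕ) : ℝ :=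
  if n.Prime then -Real.log (1 - (n : ℝ) ^ (-(1 + s))) else 0

lemma rpow_neg_one_add_le_inv {s : ℝ} (hs : 0 ≤ s) {p : ℕ} (hp : p.Prime) :
    (p : ℝ) ^ (-(1 + s)) ≤ (p : ℝ)⁻¹ := by
  rw [← Real.rpow_neg_one]
  exact Real.rpow_le_rpow_of_exponent_le (by exact_mod_cast hp.one_lt.le) (by linarith)

lemma natCast_inv_le_half {p : ℕ} (hp : 2 ≤ p) : (p : ℝ)⁻¹ ≤ 1 / 2 := by
  rw [one_div]
  exact inv_anti₀ (by norm_num) (by exact_mod_cast hp)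

lemma logEulerFactor_nonneg {s : ℝ} (hs : 0 ≤ s) (n : ℕ) : 0 ≤ logEulerFactor s n := by
  unfold logEulerFactor
  split_ifs with hp
  · have h1 := rpow_neg_one_add_le_inv hs hp
    have h2 := natCast_inv_le_half hp.two_le
    have h3 : 0 ≤ (n : ℝ) ^ (-(1 + s)) := by positivity
    have := Real.log_nonpos (x := 1 - (n : ℝ) ^ (-(1 + s))) (by linarith) (by linarith)
    linarith
  · exact le_rfl

lemma abs_logEulerFactor_sub_le {s : ℝ} (hs : 0 ≤ s) {p : ℕ} (hp : p.Prime) :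
    |logEulerFactor s p - (p : ℝ) ^ (-(1 + s))| ≤ 2 * ((p : ℝ) ^ 2)⁻¹ := by
  have h1 := rpow_neg_one_add_le_inv hs hp
  have h2 := natCast_inv_le_half hp.two_le
  have h3 : 0 ≤ (p : ℝ) ^ (-(1 + s)) := by positivity
  rw [logEulerFactor, if_pos hp]
  set t := (p : ℝ) ^ (-(1 + s))
  have h := Real.abs_log_sub_add_sum_range_le (x := t) (by rw [abs_of_nonneg h3]; linarith) 1
  simp only [sum_range_one, Nat.cast_zero, zero_add, pow_one, div_one, abs_of_nonneg h3] at h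
  rw [abs_sub_comm, sub_neg_eq_add]
  refine h.trans ?_
  rw [div_le_iff₀ (by linarith), ← inv_pow]
  nlinarith [mul_self_le_mul_self h3 h1, sq_nonneg (p : ℝ)⁻¹]

lemma logEulerFactor_zero_of_prime {p : ℕ} (hp : p.Prime) :
    logEulerFactor 0 p = -Real.log (1 - (p : ℝ)⁻¹) := by
  rw [logEulerFactor, if_pos hp, add_zero, Real.rpow_neg_one]

lemma logEulerFactor_zero_mem_Icc {p : ℕ} (hp : p.Prime) :
    logEulerFactor 0 p ∈ Set.Icc (p : ℝ)⁻¹ ((p : ℝ) - 1)⁻¹ := by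
  have hp1 : (1 : ℝ) < p := by exact_mod_cast hp.one_lt
  have hpos : 0 < 1 - (p : ℝ)⁻¹ := by linarith [natCast_inv_le_half hp.two_le]
  rw [logEulerFactor_zero_of_prime hp]
  constructor
  · linarith [Real.log_le_sub_one_of_pos hpos]
  · have h := Real.one_sub_inv_le_log_of_pos hpos
    have : (1 - (p : ℝ)⁻¹)⁻¹ - 1 = ((p : ℝ) - 1)⁻¹ := by
      have : (p : ℝ) - 1 ≠ 0 := by linarith
      field_simp
      ring
    linarith

lemma sum_range_logEulerFactor_mul (s : ℝ) (f : ℕ → ℝ) (N : ℕ) :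
    ∑ n ∈ range (N + 1), logEulerFactor s n * f n =
      ∑ p ∈ N.primesLE, logEulerFactor s p * f p := by
  rw [Nat.primesLE_eq_filter_range, sum_filter]
  refine sum_congr rfl fun n _ => ?_
  split_ifs with h
  · rfl
  · simp [logEulerFactor, h]

lemma exists_sum_log_div_mul_sub_one_le :
    ∃ K : ℝ, ∀ N : ℕ, ∑ p ∈ N.primesLE, Real.log p / (p * (p - 1)) ≤ K := by
  have hsum : Summable fun n : ℕ => 4 * (n : ℝ) ^ (-(3 / 2) : ℝ) :=
    (Real.summable_nat_rpow.mpr (by norm_num)).mul_left 4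
  refine ⟨_, fun N => le_trans (sum_le_sum fun p hp => ?_)
    (hsum.sum_le_tsum N.primesLE fun n _ => by positivity)⟩
  have hp2 : (2 : ℝ) ≤ p := by exact_mod_cast (Nat.mem_primesLE.mp hp).2.two_le
  have hlog : Real.log p ≤ 2 * (p : ℝ) ^ (1 / 2 : ℝ) := by
    have := Real.log_le_rpow_div (x := (p : ℝ)) (by linarith) (ε := 1 / 2) (by norm_num)
    linarith
  have hrpow : (p : ℝ) ^ (-(3 / 2) : ℝ) = (p : ℝ) ^ (1 / 2 : ℝ) / (p : ℝ) ^ 2 := by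
    rw [← Real.rpow_natCast, ← Real.rpow_sub (by linarith)]
    norm_num
  rw [hrpow, div_le_iff₀ (by nlinarith), mul_div_assoc', div_mul_eq_mul_div,
    le_div_iff₀ (by positivity)]
  have : 0 ≤ (p : ℝ) ^ (1 / 2 : ℝ) := by positivity
  nlinarith [mul_le_mul_of_nonneg_right hlog (sq_nonneg (p : ℝ)),
    mul_nonneg this (mul_nonneg (by linarith : (0 : ℝ) ≤ p) (by linarith : (0 : ℝ) ≤ p - 2))]

lemma log_factorial_eq_sum_primesLE (N : ℕ) :
    Real.log N.factorial = ∑ p ∈ N.primesLE, (N.factorial.factorization p : ℝ) * Real.log p := by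
  conv_lhs => rw [← Nat.prod_factorization_pow_eq_self N.factorial_ne_zero]
  rw [Finsupp.prod, Nat.cast_prod, Real.log_prod]
  · simp only [Nat.cast_pow, Real.log_pow]
    refine sum_subset (fun p hp => ?_) fun p _ hp => ?_
    · rw [Nat.support_factorization] at hp
      have := Nat.prime_of_mem_primeFactors hp
      exact Nat.mem_primesLE.mpr ⟨this.dvd_factorial.mp (Nat.dvd_of_mem_primeFactors hp), this⟩
    · rw [Finsupp.notMem_support_iff.mp hp]
      simp
  · intro p hp
    rw [Nat.support_factorization] at hp
    have := (Nat.prime_of_mem_primeFactors hp).pos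
    positivity

lemma factorial_factorization_mem_Icc {N p : ℕ} (hp : p.Prime) :
    (N.factorial.factorization p : ℝ) ∈ Set.Icc ((N : ℝ) / p - 1) ((N : ℝ) / (p - 1)) := by
  constructor
  · have h1 : N / p ≤ N.factorial.factorization p := by
      rw [Nat.factorization_factorial hp
        (b := Nat.log p N + 2) (by lia)]
      calc N / p = N / p ^ 1 := by rw [pow_one]
        _ ≤ _ := single_le_sum (f := fun i => N / p ^ i) (fun _ _ => Nat.zero_le _)
          (by simp)
    have h2 : (N : ℝ) / p < (N / p : ℕ) + 1 := by
      rw [← Nat.floor_div_eq_div (K := ℝ)]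
      exact Nat.lt_floor_add_one _
    have h3 : ((N / p : ℕ) : ℝ) ≤ N.factorial.factorization p := by exact_mod_cast h1
    linarith
  · have h := Nat.factorization_factorial_le_div_pred hp N
    have h' : (N.factorial.factorization p : ℝ) ≤ (N / (p - 1) : ℕ) := by exact_mod_cast h
    refine h'.trans (Nat.cast_div_le.trans ?_)
    rw [Nat.cast_sub hp.one_lt.le, Nat.cast_one]

/-- A form of **Mertens' first theorem**. -/
lemma exists_abs_sum_logEulerFactor_mul_log_sub_log_le :
    ∃ K : ℝ, ∀ N : ℕ, 1 ≤ N →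
      |∑ n ∈ range (N + 1), logEulerFactor 0 n * Real.log n - Real.log N| ≤ K := by
  obtain ⟨K, hK⟩ := exists_sum_log_div_mul_sub_one_le
  refine ⟨K + 1 + Real.log 4, fun N hN => ?_⟩
  have hK := hK N
  have hN0 : (0 : ℝ) < N := by exact_mod_cast hN
  have hlog4 : 0 < Real.log 4 := Real.log_pos (by norm_num)
  rw [sum_range_logEulerFactor_mul]
  set A := ∑ p ∈ N.primesLE, Real.log p / p
  set B := ∑ p ∈ N.primesLE, Real.log p / (p - 1)
  have hAB : B - A = ∑ p ∈ N.primesLE, Real.log p / (p * (p - 1)) := by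
    rw [← sum_sub_distrib]
    refine sum_congr rfl fun p hp => ?_
    have hp1 : (1 : ℝ) < p := by exact_mod_cast (Nat.mem_primesLE.mp hp).2.one_lt
    have : (p : ℝ) - 1 ≠ 0 := by linarith
    field_simp
    ring
  have hlog : ∀ p ∈ N.primesLE, 0 ≤ Real.log p := fun p _ => Real.log_natCast_nonneg p
  have hA : A ≤ ∑ p ∈ N.primesLE, logEulerFactor 0 p * Real.log p := by
    refine sum_le_sum fun p hp => ?_
    rw [div_eq_inv_mul]
    exact mul_le_mul_of_nonneg_right
      (logEulerFactor_zero_mem_Icc (Nat.mem_primesLE.mp hp).2).1 (hlog p hp)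
  have hB : ∑ p ∈ N.primesLE, logEulerFactor 0 p * Real.log p ≤ B := by
    refine sum_le_sum fun p hp => ?_
    rw [div_eq_inv_mul]
    exact mul_le_mul_of_nonneg_right
      (logEulerFactor_zero_mem_Icc (Nat.mem_primesLE.mp hp).2).2 (hlog p hp)
  have hupper : Real.log N.factorial ≤ N * B := by
    rw [log_factorial_eq_sum_primesLE, mul_sum]
    refine sum_le_sum fun p hp => ?_
    have := mul_le_mul_of_nonneg_right
      (factorial_factorization_mem_Icc (N := N) (Nat.mem_primesLE.mp hp).2).2 (hlog p hp)
    calc _ ≤ _ := this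
      _ = _ := by ring
  have hlower : N * A - Real.log 4 * N ≤ Real.log N.factorial := by
    have htheta := Chebyshev.theta_le_log4_mul_x (x := (N : ℝ)) hN0.le
    rw [Chebyshev.theta_eq_sum_primesLE_log] at htheta
    refine le_trans (sub_le_sub_left htheta _) ?_
    rw [log_factorial_eq_sum_primesLE, mul_sum, ← sum_sub_distrib]
    refine sum_le_sum fun p hp => ?_
    have := mul_le_mul_of_nonneg_right
      (factorial_factorization_mem_Icc (N := N) (Nat.mem_primesLE.mp hp).2).1 (hlog p hp)
    calc _ = _ := by ring
      _ ≤ _ := this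
  have hfac_le : Real.log N.factorial ≤ N * Real.log N := by
    rw [← Real.log_pow]
    exact Real.log_le_log (by exact_mod_cast N.factorial_pos)
      (by exact_mod_cast N.factorial_le_pow)
  have hfac_ge : N * Real.log N - N ≤ Real.log N.factorial := by
    have h := Real.log_le_log (by positivity) (Real.pow_div_factorial_le_exp (x := N) hN0.le N)
    rw [Real.log_exp, Real.log_div (by positivity) (by positivity), Real.log_pow] at h
    linarith
  have h1 : Real.log N - 1 ≤ B := by
    refine le_of_mul_le_mul_left ?_ hN0
    linarith
  have h2 : A ≤ Real.log N + Real.log 4 := by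
    refine le_of_mul_le_mul_left ?_ hN0
    linarith
  rw [abs_le]
  constructor <;> linarith

lemma sum_logEulerFactor_le_log_tsum {s : ℝ} (hs : 0 < s) (N : ℕ) :
    ∑ n ∈ range N, logEulerFactor s n ≤ Real.log (∑' n : ℕ, 1 / (n : ℝ) ^ (1 + s)) := by
  let f : ℕ →*₀ ℝ :=
    { toFun := fun n => (n : ℝ) ^ (-(1 + s))
      map_zero' := by
        rw [Nat.cast_zero, Real.zero_rpow (by linarith)]
      map_one' := by simp
      map_mul' := fun a b => by
        rw [Nat.cast_mul, Real.mul_rpow (by positivity) (by positivity)] }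
  have hfapp : ∀ n, f n = (n : ℝ) ^ (-(1 + s)) := fun n => rfl
  have hsum : Summable (‖f ·‖) := by
    have : (fun n => ‖f n‖) = fun n : ℕ => (n : ℝ) ^ (-(1 + s)) :=
      funext fun n => Real.norm_of_nonneg (by rw [hfapp]; positivity)
    rw [this]
    exact Real.summable_nat_rpow.mpr (by linarith)
  have htsum : ∑' n : ℕ, 1 / (n : ℝ) ^ (1 + s) = ∑' n, f n :=
    tsum_congr fun n => by rw [hfapp, Real.rpow_neg (by positivity), one_div]
  have hfac : ∀ n, ∏ p ∈ Nat.primesBelow n, (1 - f p)⁻¹ =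
      Real.exp (∑ k ∈ range n, logEulerFactor s k) := by
    intro n
    rw [Nat.primesBelow_eq_filter_range, prod_filter, Real.exp_sum]
    refine prod_congr rfl fun p _ => ?_
    unfold logEulerFactor
    split_ifs with hp
    · have h1 := rpow_neg_one_add_le_inv hs.le hp
      have h2 := natCast_inv_le_half hp.two_le
      rw [Real.exp_neg, Real.exp_log (by linarith), hfapp]
    · rw [Real.exp_zero]
  have hlim := EulerProduct.eulerProduct_completely_multiplicative hsum
  simp only [hfac] at hlim
  have hmono : Monotone fun n => Real.exp (∑ k ∈ range n, logEulerFactor s k) :=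
    monotone_nat_of_le_succ fun n => by
      rw [sum_range_succ]
      exact Real.exp_le_exp.mpr (by linarith [logEulerFactor_nonneg hs.le n])
  have hle := hmono.ge_of_tendsto hlim N
  rw [htsum]
  exact (Real.le_log_iff_exp_le ((Real.exp_pos _).trans_le hle)).mpr hle

lemma summable_logEulerFactor {s : ℝ} (hs : 0 < s) : Summable (logEulerFactor s) :=
  summable_of_sum_range_le (logEulerFactor_nonneg hs.le) (sum_logEulerFactor_le_log_tsum hs)

lemma abs_logEulerFactor_zero_mul_rpow_sub_le {s : ℝ} (hs : 0 ≤ s) (n : ℕ) :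
    |logEulerFactor 0 n * (n : ℝ) ^ (-s) - logEulerFactor s n| ≤ 4 * ((n : ℝ) ^ 2)⁻¹ := by
  by_cases hp : n.Prime
  · have hpos : (0 : ℝ) < n := by exact_mod_cast hp.pos
    have h0 := abs_logEulerFactor_sub_le le_rfl hp
    have h1 := abs_logEulerFactor_sub_le hs hp
    have hy : (n : ℝ) ^ (-s) ≤ 1 :=
      Real.rpow_le_one_of_one_le_of_nonpos (by exact_mod_cast hp.one_lt.le) (by linarith)
    have hy0 : 0 ≤ (n : ℝ) ^ (-s) := by positivity
    have hsplit : (n : ℝ) ^ (-(1 + s)) = (n : ℝ) ^ (-(1 + 0) : ℝ) * (n : ℝ) ^ (-s) := by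
      rw [← Real.rpow_add hpos]
      ring_nf
    rw [hsplit] at h1
    set x := (n : ℝ) ^ (-(1 + 0) : ℝ)
    set y := (n : ℝ) ^ (-s)
    calc |logEulerFactor 0 n * y - logEulerFactor s n|
        = |(logEulerFactor 0 n - x) * y - (logEulerFactor s n - x * y)| := by ring_nf
      _ ≤ |(logEulerFactor 0 n - x) * y| + |logEulerFactor s n - x * y| := abs_sub _ _
      _ ≤ |logEulerFactor 0 n - x| + |logEulerFactor s n - x * y| := by
          rw [abs_mul, abs_of_nonneg hy0]
          gcongr
          exact mul_le_of_le_one_right (abs_nonneg _) hy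
      _ ≤ _ := by linarith
  · simp only [logEulerFactor, if_neg hp]
    simp only [zero_mul, sub_zero, abs_zero]
    positivity

lemma tendsto_tsum_logEulerFactor_zero_mul_rpow_sub :
    Tendsto (fun s => ∑' n : ℕ, (logEulerFactor 0 n * (n : ℝ) ^ (-s) - logEulerFactor s n))
      (nhdsWithin 0 (Set.Ioi 0)) (nhds 0) := by
  have hbound : Summable fun n : ℕ => 4 * ((n : ℝ) ^ 2)⁻¹ :=
    (Real.summable_nat_pow_inv.mpr one_lt_two).mul_left 4
  have h := tendsto_tsum_of_dominated_convergence (𝓕 := nhdsWithin 0 (Set.Ioi 0))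
    (f := fun (s : ℝ) (n : ℕ) => logEulerFactor 0 n * (n : ℝ) ^ (-s) - logEulerFactor s n)
    (g := fun _ => 0) hbound (fun n => ?_) ?_
  · simpa using h
  · refine Tendsto.mono_left ?_ nhdsWithin_le_nhds
    by_cases hp : n.Prime
    · have hn0 : (n : ℝ) ≠ 0 := by exact_mod_cast hp.ne_zero
      have hne : 1 - (n : ℝ) ^ (-(1 + 0) : ℝ) ≠ 0 := by
        have h1 := rpow_neg_one_add_le_inv le_rfl hp
        have h2 := natCast_inv_le_half hp.two_le
        exact (sub_pos.mpr ((h1.trans h2).trans_lt one_half_lt_one)).ne'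
      have hcont : ContinuousAt
          (fun s : ℝ => logEulerFactor 0 n * (n : ℝ) ^ (-s) - logEulerFactor s n) 0 := by
        simp only [logEulerFactor, if_pos hp]
        have hrpow : ∀ g : ℝ → ℝ, Continuous g → ContinuousAt (fun s => (n : ℝ) ^ g s) 0 :=
          fun g hg => (Real.continuous_const_rpow hn0).comp hg |>.continuousAt
        refine (continuousAt_const.mul (hrpow _ (by fun_prop))).sub (ContinuousAt.neg ?_)
        exact (continuousAt_const.sub (hrpow _ (by fun_prop))).log hne
      simpa using hcont.tendsto
    · simp [logEulerFactor, hp]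
  · filter_upwards [self_mem_nhdsWithin] with s hs n
    exact abs_logEulerFactor_zero_mul_rpow_sub_le (le_of_lt hs) n

lemma tendsto_log_tsum_one_div_rpow_add_log :
    Tendsto (fun s : ℝ => Real.log (∑' n : ℕ, 1 / (n : ℝ) ^ (1 + s)) + Real.log s)
      (nhdsWithin 0 (Set.Ioi 0)) (nhds 0) := by
  have hshift : Tendsto (fun s : ℝ => 1 + s) (nhdsWithin 0 (Set.Ioi 0))
      (nhdsWithin 1 (Set.Ioi 1)) := by
    refine tendsto_nhdsWithin_iff.mpr ⟨?_, ?_⟩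
    · refine Tendsto.mono_left ?_ nhdsWithin_le_nhds
      exact (by fun_prop : Continuous fun s : ℝ => 1 + s).tendsto' 0 1 (by simp)
    · filter_upwards [self_mem_nhdsWithin] with s hs
      simpa using hs
  have h := (tendsto_sub_mul_tsum_nat_rpow.comp hshift).log one_ne_zero
  rw [Real.log_one] at h
  refine h.congr' ?_
  filter_upwards [self_mem_nhdsWithin] with s hs
  have hs : 0 < s := hs
  have hsum : Summable fun n : ℕ => 1 / (n : ℝ) ^ (1 + s) :=
    Real.summable_one_div_nat_rpow.mpr (by linarith)
  have hpos : 0 < ∑' n : ℕ, 1 / (n : ℝ) ^ (1 + s) :=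
    hsum.tsum_pos (fun n => by positivity) 1 (by simp)
  simp only [Function.comp_apply, add_sub_cancel_left]
  rw [Real.log_mul hs.ne' hpos.ne', add_comm]

lemma exists_sum_logEulerFactor_mul_rpow_le :
    ∃ Z : ℝ → ℝ, (∀ s, 0 < s → ∀ N : ℕ,
        ∑ n ∈ range N, logEulerFactor 0 n * (n : ℝ) ^ (-s) ≤ Z s) ∧
      Tendsto (fun s => Z s + Real.log s) (nhdsWithin 0 (Set.Ioi 0)) (nhds 0) := by
  refine ⟨fun s => Real.log (∑' n : ℕ, 1 / (n : ℝ) ^ (1 + s)) +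
    ∑' n : ℕ, (logEulerFactor 0 n * (n : ℝ) ^ (-s) - logEulerFactor s n), fun s hs N => ?_, ?_⟩
  · have hd : Summable fun n : ℕ =>
        logEulerFactor 0 n * (n : ℝ) ^ (-s) - logEulerFactor s n :=
      ((Real.summable_nat_pow_inv.mpr one_lt_two).mul_left 4).of_norm_bounded
        (abs_logEulerFactor_zero_mul_rpow_sub_le hs.le)
    have hsum := (summable_logEulerFactor hs).add hd
    simp only [add_sub_cancel] at hsum
    calc ∑ n ∈ range N, logEulerFactor 0 n * (n : ℝ) ^ (-s)
        ≤ ∑' n : ℕ, logEulerFactor 0 n * (n : ℝ) ^ (-s) :=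
          hsum.sum_le_tsum _ fun n _ =>
            mul_nonneg (logEulerFactor_nonneg le_rfl n) (by positivity)
      _ = ∑' n, logEulerFactor s n +
            ∑' n : ℕ, (logEulerFactor 0 n * (n : ℝ) ^ (-s) - logEulerFactor s n) := by
          rw [← (summable_logEulerFactor hs).tsum_add hd]
          simp only [add_sub_cancel]
      _ ≤ _ := by
          refine add_le_add ?_ le_rfl
          exact Real.tsum_le_of_sum_range_le (logEulerFactor_nonneg hs.le)
            (sum_logEulerFactor_le_log_tsum hs)
  · have h := tendsto_log_tsum_one_div_rpow_add_log.add
      tendsto_tsum_logEulerFactor_zero_mul_rpow_sub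
    rw [add_zero] at h
    exact h.congr fun s => by ring

/-- A discrete Tauberian-type estimate: partial summation from `C m = m + O(1)` to
`B m = harmonic m + E + O(1 / m)`. -/
lemma exists_tendsto_sub_harmonic {B C : ℕ → ℝ} {K : ℝ}
    (hlower : ∀ m : ℕ, m * (B (m + 1) - B m) ≤ C (m + 1) - C m)
    (hupper : ∀ m : ℕ, C (m + 1) - C m ≤ (m + 1) * (B (m + 1) - B m))
    (hC : ∀ m : ℕ, |C m - m| ≤ K) :
    ∃ E K' : ℝ, Tendsto (fun m => B m - harmonic m) atTop (nhds E) ∧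
      ∀ m : ℕ, 1 ≤ m → B m - harmonic m ≤ E + K' / m := by
  have hK : 0 ≤ K := (abs_nonneg _).trans (hC 0)
  set V : ℕ → ℝ := fun m => (C m - m) / (m + 1) with hV
  set Z : ℕ → ℝ := fun m => B m - harmonic m - V m with hZ
  have hstep : ∀ m : ℕ, 1 ≤ m →
      |Z (m + 1) - Z m| ≤ (1 + 3 * K) * (1 / m - 1 / (m + 1)) := by
    intro m hm
    have hm0 : (0 : ℝ) < m := by exact_mod_cast hm
    have hl := hlower m
    have hu := hupper m
    have hc0 := abs_le.mp (hC m)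
    have hc := abs_le.mp (hC (m + 1))
    push_cast at hc
    set b := B (m + 1) - B m
    have hb : b ≤ (1 + 2 * K) / m := by
      rw [le_div_iff₀ hm0]
      linarith
    have hr0 : 0 ≤ b - (C (m + 1) - C m) / (m + 1) := by
      rw [sub_nonneg, div_le_iff₀ (by positivity)]
      linarith
    have hr1 : b - (C (m + 1) - C m) / (m + 1) ≤ (1 + 2 * K) * (1 / m - 1 / (m + 1)) := by
      have h1 : b - (C (m + 1) - C m) / (m + 1) ≤ b / (m + 1) := by
        rw [sub_le_iff_le_add, ← add_div, le_div_iff₀ (by positivity)]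
        linarith
      refine h1.trans ((div_le_div_of_nonneg_right hb (by positivity)).trans (le_of_eq ?_))
      field_simp
      ring
    have hq : |(C (m + 1) - (m + 1)) * (1 / ((m : ℝ) + 1) - 1 / (m + 2))| ≤
        K * (1 / m - 1 / (m + 1)) := by
      have h1 : 1 / ((m : ℝ) + 1) - 1 / (m + 2) = 1 / ((m + 1) * (m + 2)) := by
        field_simp
        ring
      have h2 : 1 / (m : ℝ) - 1 / (m + 1) = 1 / (m * (m + 1)) := by
        field_simp
        ring
      rw [abs_mul, h1, h2, abs_of_pos (a := 1 / (((m : ℝ) + 1) * (m + 2))) (by positivity)]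
      refine mul_le_mul (abs_le.mpr hc) ?_ (by positivity) hK
      exact one_div_le_one_div_of_le (by positivity) (by nlinarith)
    have hdiff : Z (m + 1) - Z m = (b - (C (m + 1) - C m) / (m + 1)) +
        (C (m + 1) - (m + 1)) * (1 / ((m : ℝ) + 1) - 1 / (m + 2)) := by
      simp only [hZ, hV, b, harmonic_succ]
      push_cast
      rw [show (m : ℝ) + 1 + 1 = m + 2 by ring]
      field_simp
      ring
    rw [hdiff]
    refine (abs_add_le _ _).trans ?_
    rw [abs_of_nonneg hr0]
    linarith
  set L := 1 + 3 * K
  have hL : 0 ≤ L := by positivity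
  have hmono : Monotone fun k : ℕ => Z (k + 1) - L * (1 / ((k : ℝ) + 1)) :=
    monotone_nat_of_le_succ fun k => by
      have := (abs_le.mp (hstep (k + 1) (by lia))).1
      push_cast at this ⊢
      linarith
  have hanti : Antitone fun k : ℕ => Z (k + 1) + L * (1 / ((k : ℝ) + 1)) :=
    antitone_nat_of_succ_le fun k => by
      have := (abs_le.mp (hstep (k + 1) (by lia))).2
      push_cast at this ⊢
      linarith
  have hzero : Tendsto (fun k : ℕ => L * (1 / ((k : ℝ) + 1))) atTop (nhds 0) := by
    simpa using tendsto_one_div_add_atTop_nhds_zero_nat.const_mul L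
  have hbdd : BddBelow (Set.range fun k : ℕ => Z (k + 1) + L * (1 / ((k : ℝ) + 1))) := by
    refine ⟨Z 1 - L * (1 / ((0 : ℕ) + 1)), ?_⟩
    rintro _ ⟨k, rfl⟩
    have := hmono (Nat.zero_le k)
    have h0 : 0 ≤ L * (1 / ((k : ℝ) + 1)) := by positivity
    simp only [zero_add] at this ⊢
    linarith
  obtain ⟨E, hE⟩ : ∃ E, Tendsto (fun k : ℕ => Z (k + 1) + L * (1 / ((k : ℝ) + 1))) atTop
      (nhds E) := ⟨_, tendsto_atTop_ciInf hanti hbdd⟩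
  have hZE : Tendsto (fun k : ℕ => Z (k + 1)) atTop (nhds E) := by
    simpa using hE.sub hzero
  have hle : ∀ k : ℕ, Z (k + 1) - L * (1 / ((k : ℝ) + 1)) ≤ E := by
    refine fun k => hmono.ge_of_tendsto ?_ k
    simpa using hZE.sub hzero
  have hV_abs : ∀ m : ℕ, |V m| ≤ K * (1 / ((m : ℝ) + 1)) := fun m => by
    rw [hV]
    simp only
    rw [abs_div, abs_of_pos (a := (m : ℝ) + 1) (by positivity), mul_one_div]
    exact div_le_div_of_nonneg_right (hC m) (by positivity)
  have hV0 : Tendsto V atTop (nhds 0) := by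
    refine squeeze_zero_norm hV_abs ?_
    simpa using tendsto_one_div_add_atTop_nhds_zero_nat.const_mul K
  refine ⟨E, L + K, ?_, fun m hm => ?_⟩
  · have := ((tendsto_add_atTop_iff_nat 1).mp hZE).add hV0
    simpa [hZ] using this
  · obtain ⟨k, rfl⟩ : ∃ k, m = k + 1 := ⟨m - 1, by lia⟩
    have h1 := hle k
    have h2 := (abs_le.mp (hV_abs (k + 1))).2
    have h3 : 1 / (((k + 1 : ℕ) : ℝ) + 1) ≤ 1 / ((k : ℝ) + 1) :=
      one_div_le_one_div_of_le (by positivity) (by push_cast; linarith)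
    have h4 := mul_le_mul_of_nonneg_left h3 hK
    have h5 : (L + K) / ((k + 1 : ℕ) : ℝ) =
        L * (1 / ((k : ℝ) + 1)) + K * (1 / ((k : ℝ) + 1)) := by
      push_cast
      ring
    simp only [hZ] at h1
    rw [h5]
    linarith

/-- The logarithm of the Mertens product `∏_{p ≤ exp m} (1 - 1 / p)⁻¹`. -/
noncomputable def logMertens (m : ℕ) : ℝ :=
  ∑ n ∈ range (⌊Real.exp m⌋₊ + 1), logEulerFactor 0 n

lemma sum_range_floor_exp_succ_sub (f : ℕ → ℝ) (m : ℕ) :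
    ∑ n ∈ range (⌊Real.exp (m + 1 : ℕ)⌋₊ + 1), f n - ∑ n ∈ range (⌊Real.exp m⌋₊ + 1), f n =
      ∑ n ∈ Ico (⌊Real.exp m⌋₊ + 1) (⌊Real.exp (m + 1 : ℕ)⌋₊ + 1), f n := by
  rw [sum_Ico_eq_sub]
  gcongr
  lia

lemma mem_Ico_floor_exp {m n : ℕ}
    (hn : n ∈ Ico (⌊Real.exp m⌋₊ + 1) (⌊Real.exp (m + 1 : ℕ)⌋₊ + 1)) :
    0 < n ∧ (m : ℝ) ≤ Real.log n ∧ Real.log n ≤ m + 1 := by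
  rw [mem_Ico] at hn
  have hpos : 0 < n := by lia
  have hpos' : (0 : ℝ) < n := by exact_mod_cast hpos
  refine ⟨hpos, ?_, ?_⟩
  · rw [Real.le_log_iff_exp_le hpos']
    exact ((Nat.floor_lt (Real.exp_pos _).le).mp hn.1).le
  · rw [Real.log_le_iff_le_exp hpos']
    have := (Nat.le_floor_iff (Real.exp_pos _).le).mp (Nat.lt_succ_iff.mp hn.2)
    exact_mod_cast this

lemma exists_tendsto_logMertens_sub_harmonic :
    ∃ E K : ℝ, Tendsto (fun m => logMertens m - harmonic m) atTop (nhds E) ∧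
      ∀ m : ℕ, 1 ≤ m → logMertens m - harmonic m ≤ E + K / m := by
  obtain ⟨K, hK⟩ := exists_abs_sum_logEulerFactor_mul_log_sub_log_le
  refine exists_tendsto_sub_harmonic (C := fun m =>
    ∑ n ∈ range (⌊Real.exp m⌋₊ + 1), logEulerFactor 0 n * Real.log n) (K := K + Real.log 2)
    (fun m => ?_) (fun m => ?_) (fun m => ?_)
  · simp only [logMertens]
    rw [sum_range_floor_exp_succ_sub, sum_range_floor_exp_succ_sub, mul_sum]
    refine sum_le_sum fun n hn => ?_
    rw [mul_comm]
    exact mul_le_mul_of_nonneg_left (mem_Ico_floor_exp hn).2.1 (logEulerFactor_nonneg le_rfl n)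
  · simp only [logMertens]
    rw [sum_range_floor_exp_succ_sub, sum_range_floor_exp_succ_sub, mul_sum]
    refine sum_le_sum fun n hn => ?_
    rw [mul_comm]
    exact mul_le_mul_of_nonneg_right (mem_Ico_floor_exp hn).2.2 (logEulerFactor_nonneg le_rfl n)
  · set N := ⌊Real.exp m⌋₊
    have hN : 1 ≤ N := Nat.le_floor (by simp)
    have hN0 : (0 : ℝ) < N := by exact_mod_cast hN
    have h1 : Real.log N ≤ m := by
      rw [Real.log_le_iff_le_exp hN0]
      exact Nat.floor_le (Real.exp_pos _).le
    have h2 : m ≤ Real.log 2 + Real.log N := by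
      rw [← Real.log_mul two_ne_zero hN0.ne', Real.le_log_iff_exp_le (by positivity)]
      have := Nat.lt_floor_add_one (Real.exp m)
      have : (1 : ℝ) ≤ N := by exact_mod_cast hN
      linarith
    have h3 := abs_le.mp (hK N hN)
    have h4 := Real.log_pos one_lt_two
    rw [abs_le]
    constructor <;> linarith

lemma tendsto_exp_neg_nhdsLT_one :
    Tendsto (fun s : ℝ => Real.exp (-s)) (nhdsWithin 0 (Set.Ioi 0))
      (nhdsWithin 1 (Set.Iio 1)) := by
  refine tendsto_nhdsWithin_iff.mpr ⟨?_, ?_⟩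
  · refine Tendsto.mono_left ?_ nhdsWithin_le_nhds
    exact (by fun_prop : Continuous fun s : ℝ => Real.exp (-s)).tendsto' 0 1 (by simp)
  · filter_upwards [self_mem_nhdsWithin] with s hs
    simpa using hs

lemma logMertens_zero : logMertens 0 = 0 := by
  simp [logMertens, logEulerFactor, sum_range_succ, Nat.not_prime_zero, Nat.not_prime_one]

lemma sum_range_logMertens_sub_mul_exp_le {s : ℝ} (hs : 0 ≤ s) (m : ℕ) :
    ∑ k ∈ range m, (logMertens (k + 1) - logMertens k) * Real.exp (-s) ^ (k + 1) ≤
      ∑ n ∈ range (⌊Real.exp m⌋₊ + 1), logEulerFactor 0 n * (n : ℝ) ^ (-s) := by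
  induction m with
  | zero => exact sum_nonneg fun n _ => mul_nonneg (logEulerFactor_nonneg le_rfl n) (by positivity)
  | succ m ih =>
    rw [sum_range_succ, ← sub_le_sub_iff_right (∑ n ∈ range (⌊Real.exp m⌋₊ + 1), _),
      sum_range_floor_exp_succ_sub]
    refine le_trans (sub_le_iff_le_add'.mpr (add_le_add ih le_rfl)) ?_
    simp only [logMertens]
    rw [sum_range_floor_exp_succ_sub, sum_mul]
    refine sum_le_sum fun n hn => ?_
    refine mul_le_mul_of_nonneg_left ?_ (logEulerFactor_nonneg le_rfl n)
    obtain ⟨hpos, -, hlog⟩ := mem_Ico_floor_exp hn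
    rw [Real.rpow_def_of_pos (by exact_mod_cast hpos), ← Real.exp_nat_mul]
    refine Real.exp_le_exp.mpr ?_
    push_cast
    nlinarith

/-- The constant in **Mertens' third theorem** is at most `exp γ`. -/
lemma limit_logMertens_sub_harmonic_le_zero {E : ℝ}
    (hE : Tendsto (fun m => logMertens m - harmonic m) atTop (nhds E)) : E ≤ 0 := by
  obtain ⟨Z, hZ, hZlim⟩ := exists_sum_logEulerFactor_mul_rpow_le
  set b : ℕ → ℝ := fun k => logMertens (k + 1) - logMertens k with hb
  have hb0 : ∀ k, 0 ≤ b k := fun k => by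
    simp only [hb, logMertens]
    rw [sum_range_floor_exp_succ_sub]
    exact sum_nonneg fun n _ => logEulerFactor_nonneg le_rfl n
  have hpartial : ∀ m, ∑ k ∈ range m, (b k - 1 / ((k : ℝ) + 1)) =
      logMertens m - harmonic m := by
    intro m
    rw [sum_sub_distrib, sum_range_sub, logMertens_zero, sub_zero, harmonic]
    simp
  have habel := Real.tendsto_tsum_powerSeries_nhdsWithin_lt (hE.congr fun m => (hpartial m).symm)
  have hz := habel.comp tendsto_exp_neg_nhdsLT_one
  have hlim := hz.mul (tendsto_exp_neg_nhdsLT_one.mono_right nhdsWithin_le_nhds)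
  rw [mul_one] at hlim
  refine le_of_tendsto_of_tendsto hlim hZlim ?_
  filter_upwards [self_mem_nhdsWithin] with s hs
  have hs : 0 < s := hs
  set z := Real.exp (-s) with hzdef
  have hz0 : 0 < z := Real.exp_pos _
  have hz1 : z < 1 := by
    rw [hzdef, Real.exp_lt_one_iff]
    linarith
  have hbound : ∀ m, ∑ k ∈ range m, b k * z ^ (k + 1) ≤ Z s := fun m =>
    (sum_range_logMertens_sub_mul_exp_le hs.le m).trans (hZ s hs _)
  have hbz0 : ∀ k, 0 ≤ b k * z ^ (k + 1) := fun k => mul_nonneg (hb0 k) (by positivity)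
  have hbsum : Summable fun k => b k * z ^ (k + 1) := summable_of_sum_range_le hbz0 hbound
  have hlog := Real.hasSum_pow_div_log_of_abs_lt_one (x := z) (by rwa [abs_of_pos hz0])
  have hdiff := hbsum.hasSum.sub hlog
  have heq : (∑' k, (b k - 1 / ((k : ℝ) + 1)) * z ^ k) * z =
      ∑' k, b k * z ^ (k + 1) + Real.log (1 - z) := by
    rw [← tsum_mul_right, ← sub_neg_eq_add, ← hdiff.tsum_eq]
    exact tsum_congr fun k => by ring
  have hlogz : Real.log (1 - z) ≤ Real.log s :=
    Real.log_le_log (by linarith) (by linarith [Real.add_one_le_exp (-s)])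
  calc _ = ∑' k, b k * z ^ (k + 1) + Real.log (1 - z) := heq
    _ ≤ _ := add_le_add (Real.tsum_le_of_sum_range_le hbz0 hbound) hlogz

/-- The upper bound in **Mertens' third theorem**, with error term. -/
lemma exists_sum_logEulerFactor_le :
    ∃ K : ℝ, 0 ≤ K ∧ ∀ x : ℝ, 3 ≤ x → ∑ n ∈ range (⌊x⌋₊ + 1), logEulerFactor 0 n ≤
      Real.eulerMascheroniConstant + Real.log (Real.log x) + K / Real.log x := by
  obtain ⟨E, K, hlim, hK⟩ := exists_tendsto_logMertens_sub_harmonic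
  have hE := limit_logMertens_sub_harmonic_le_zero hlim
  refine ⟨|K| + 2, by positivity, fun x hx => ?_⟩
  have hx0 : 0 < x := by linarith
  have hlog : 0 < Real.log x := Real.log_pos (by linarith)
  set M := ⌈Real.log x⌉₊
  have hM1 : 1 ≤ M := Nat.one_le_ceil_iff.mpr hlog
  have hM : Real.log x ≤ M := Nat.le_ceil _
  have hM' : (M : ℝ) < Real.log x + 1 := Nat.ceil_lt_add_one hlog.le
  have h1 : ∑ n ∈ range (⌊x⌋₊ + 1), logEulerFactor 0 n ≤ logMertens M := by
    refine sum_le_sum_of_subset_of_nonneg (range_mono ?_) fun n _ _ =>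
      logEulerFactor_nonneg le_rfl n
    gcongr
    exact (Real.log_le_iff_le_exp hx0).mp hM
  have h2 := hK M hM1
  have h3 := Real.eulerMascheroniSeq_lt_eulerMascheroniConstant M
  rw [Real.eulerMascheroniSeq] at h3
  have h4 : Real.log (M + 1) ≤ Real.log (Real.log x) + 2 / Real.log x := by
    have h5 : Real.log ((M + 1) / Real.log x) ≤ (M + 1) / Real.log x - 1 :=
      Real.log_le_sub_one_of_pos (by positivity)
    rw [Real.log_div (by positivity) hlog.ne'] at h5
    have h6 : (M + 1) / Real.log x - 1 ≤ 2 / Real.log x := by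
      rw [sub_le_iff_le_add, div_add_one hlog.ne']
      exact div_le_div_of_nonneg_right (by linarith) hlog.le
    linarith
  have h7 : K / M ≤ |K| / Real.log x :=
    (div_le_div_of_nonneg_right (le_abs_self K) (by positivity)).trans (by gcongr)
  rw [add_div]
  linarith

lemma sum_divisors_eq_mul_prod {n : ℕ} (hn : 0 < n) :
    ((∑ d ∈ n.divisors, d : ℕ) : ℝ) =
      n * ∏ p ∈ n.primeFactors, ∑ i ∈ range (n.factorization p + 1), ((p : ℝ)⁻¹) ^ i := by
  have h := ArithmeticFunction.sigma_eq_prod_primeFactors_sum_range_factorization_pow_mul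
    (k := 1) hn.ne'
  rw [ArithmeticFunction.sigma_one_apply] at h
  have hfac : (n : ℝ) = ∏ p ∈ n.primeFactors, (p : ℝ) ^ n.factorization p := by
    exact_mod_cast (Nat.prod_factorization_pow_eq_self hn.ne').symm
  rw [h]
  conv_rhs => rw [hfac]
  push_cast
  rw [← prod_mul_distrib]
  refine prod_congr rfl fun p hp => ?_
  have hp0 : (p : ℝ) ≠ 0 := by exact_mod_cast (Nat.prime_of_mem_primeFactors hp).ne_zero
  rw [← sum_range_reflect, mul_sum]
  refine sum_congr rfl fun i hi => ?_
  have hi : i ≤ n.factorization p := by simpa [Nat.lt_succ_iff] using hi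
  rw [mul_one, Nat.add_sub_cancel, inv_pow, pow_sub₀ _ hp0 hi]

lemma geom_sum_inv_le {p k t : ℕ} (hp : p.Prime) (hk : k + 1 ≤ t) :
    ∑ i ∈ range (k + 1), ((p : ℝ)⁻¹) ^ i ≤
      (1 - ((p : ℝ)⁻¹) ^ t) * Real.exp (logEulerFactor 0 p) := by
  have h2 := natCast_inv_le_half hp.two_le
  have hpos : 0 < 1 - (p : ℝ)⁻¹ := by linarith
  rw [logEulerFactor_zero_of_prime hp, Real.exp_neg, Real.exp_log hpos]
  rw [← div_eq_mul_inv, le_div_iff₀ hpos, geom_sum_mul_neg]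
  have : ((p : ℝ)⁻¹) ^ t ≤ ((p : ℝ)⁻¹) ^ (k + 1) :=
    pow_le_pow_of_le_one (by positivity) (by linarith) hk
  linarith

lemma prod_geom_sum_inv_le {n t : ℕ} (hn : 0 < n)
    (hfree : ∀ p : ℕ, p.Prime → ¬ p ^ t ∣ n) :
    ∏ p ∈ n.primeFactors, ∑ i ∈ range (n.factorization p + 1), ((p : ℝ)⁻¹) ^ i ≤
      (1 - (1 / 2 : ℝ) ^ t) * Real.exp (∑ p ∈ insert 2 n.primeFactors, logEulerFactor 0 p) := by
  have hk : ∀ p : ℕ, p.Prime → n.factorization p + 1 ≤ t := fun p hp => by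
    by_contra h
    exact hfree p hp ((hp.pow_dvd_iff_le_factorization hn.ne').mpr (by lia))
  have hrest : ∏ p ∈ n.primeFactors.erase 2,
      ∑ i ∈ range (n.factorization p + 1), ((p : ℝ)⁻¹) ^ i ≤
        Real.exp (∑ p ∈ n.primeFactors.erase 2, logEulerFactor 0 p) := by
    rw [Real.exp_sum]
    refine prod_le_prod (fun p _ => by positivity) fun p hp => ?_
    have hp := Nat.prime_of_mem_primeFactors (mem_of_mem_erase hp)
    refine (geom_sum_inv_le hp (hk p hp)).trans (mul_le_of_le_one_left (Real.exp_pos _).le ?_)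
    have : 0 ≤ ((p : ℝ)⁻¹) ^ t := by positivity
    linarith
  have hinsert : insert 2 n.primeFactors = insert 2 (n.primeFactors.erase 2) := by
    ext p
    by_cases h : p = 2 <;> simp [h]
  have htwo : ∑ i ∈ range (n.factorization 2 + 1), ((2 : ℝ)⁻¹) ^ i ≤
      (1 - (1 / 2 : ℝ) ^ t) * Real.exp (logEulerFactor 0 2) := by
    simpa using geom_sum_inv_le Nat.prime_two (hk 2 Nat.prime_two)
  have hprod : ∏ p ∈ n.primeFactors, ∑ i ∈ range (n.factorization p + 1), ((p : ℝ)⁻¹) ^ i =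
      (∑ i ∈ range (n.factorization 2 + 1), ((2 : ℝ)⁻¹) ^ i) *
        ∏ p ∈ n.primeFactors.erase 2,
          ∑ i ∈ range (n.factorization p + 1), ((p : ℝ)⁻¹) ^ i := by
    by_cases h2 : 2 ∈ n.primeFactors
    · rw [← mul_prod_erase _ _ h2, Nat.cast_ofNat]
    · rw [erase_eq_of_notMem h2, ← Nat.support_factorization, Finsupp.notMem_support_iff] at *
      simp [h2]
  rw [hprod, hinsert, sum_insert (by simp), Real.exp_add, ← mul_assoc]
  exact mul_le_mul htwo hrest (prod_nonneg fun p _ => by positivity)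
    ((sum_nonneg fun _ _ => by positivity).trans htwo)

/-- Prime factors of `n` exceeding `log n` contribute little to `n / φ(n)`. -/
lemma sum_insert_two_primeFactors_le {n : ℕ} (hn : 0 < n) (hx : 3 ≤ Real.log n) :
    ∑ p ∈ insert 2 n.primeFactors, logEulerFactor 0 p ≤
      ∑ k ∈ range (⌊Real.log n⌋₊ + 1), logEulerFactor 0 k + 2 / Real.log (Real.log n) := by
  set x := Real.log n
  have hlogx : 0 < Real.log x := Real.log_pos (by linarith)
  set Q := n.primeFactors.filter (⌊x⌋₊ < ·)
  have hmem : ∀ p ∈ Q, p.Prime ∧ x < p := fun p hp => by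
    obtain ⟨h1, h2⟩ := mem_filter.mp hp
    exact ⟨Nat.prime_of_mem_primeFactors h1, (Nat.floor_lt (by linarith)).mp h2⟩
  have hcard : #Q * Real.log x ≤ x := by
    have h1 : ∏ p ∈ Q, p ≤ n := (Nat.le_of_dvd hn
      ((prod_dvd_prod_of_subset _ _ _ (filter_subset _ _)).trans (Nat.prod_primeFactors_dvd n)))
    have h2 : Real.log (∏ p ∈ Q, (p : ℝ)) ≤ x := by
      refine Real.log_le_log (prod_pos fun p hp => by exact_mod_cast (hmem p hp).1.pos) ?_
      rw [← Nat.cast_prod]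
      exact Nat.cast_le.mpr h1
    rw [Real.log_prod fun p hp => by exact_mod_cast (hmem p hp).1.ne_zero] at h2
    refine le_trans ?_ h2
    rw [← nsmul_eq_mul]
    exact card_nsmul_le_sum _ _ _ fun p hp => Real.log_le_log (by linarith) (hmem p hp).2.le
  have hQ : ∑ p ∈ Q, logEulerFactor 0 p ≤ 2 / Real.log x := by
    calc ∑ p ∈ Q, logEulerFactor 0 p ≤ #Q • (2 / x) := by
          refine sum_le_card_nsmul _ _ _ fun p hp => ?_
          obtain ⟨hpp, hpx⟩ := hmem p hp
          refine (logEulerFactor_zero_mem_Icc hpp).2.trans ?_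
          rw [inv_le_comm₀ (by linarith) (by positivity), inv_div]
          linarith
      _ ≤ (x / Real.log x) * (2 / x) := by
          rw [nsmul_eq_mul]
          gcongr
          rwa [le_div_iff₀ hlogx]
      _ = 2 / Real.log x := by
          field_simp
  refine le_trans (sum_le_sum_of_subset_of_nonneg (t := range (⌊x⌋₊ + 1) ∪ Q) ?_
    fun p _ _ => logEulerFactor_nonneg le_rfl p) ?_
  · intro p hp
    rw [mem_union, mem_range, mem_filter, Nat.lt_succ_iff]
    rcases mem_insert.mp hp with rfl | hp
    · exact Or.inl (Nat.le_floor (by push_cast; linarith))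
    · exact (le_or_gt p ⌊x⌋₊).imp_right fun h => ⟨hp, h⟩
  · refine le_trans ?_ (add_le_add le_rfl hQ)
    rw [← sum_union_inter]
    exact le_add_of_nonneg_right (sum_nonneg fun p _ => logEulerFactor_nonneg le_rfl p)

lemma two_pow_le_primorialAt (n : ℕ) : 2 ^ n ≤ primorialAt n := by
  rw [primorialAt, ← card_range n, ← prod_const, card_range]
  exact prod_le_prod' fun k _ => (Nat.prime_nth_prime k).two_le

/-- Robin's inequality for a `t`-free integer `n` when `2 ^ t` is small compared to `log log n`. -/
lemma exists_robin_of_two_pow_mul_lt :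
    ∃ K : ℝ, ∀ n t : ℕ, 0 < n → (∀ p : ℕ, p.Prime → ¬ p ^ t ∣ n) →
      3 ≤ Real.log n → 2 ^ t * K < Real.log (Real.log n) →
      ((∑ d ∈ n.divisors, d : ℕ) : ℝ) <
        Real.exp Real.eulerMascheroniConstant * n * Real.log (Real.log n) := by
  obtain ⟨K, hK0, hK⟩ := exists_sum_logEulerFactor_le
  refine ⟨K + 2, fun n t hn hfree hx hlt => ?_⟩
  set x := Real.log n
  have hlogx : 0 < Real.log x := Real.log_pos (by linarith)
  have hn0 : (0 : ℝ) < n := by exact_mod_cast hn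
  have hsum : ∑ p ∈ insert 2 n.primeFactors, logEulerFactor 0 p ≤
      Real.eulerMascheroniConstant + Real.log (Real.log x) + (K + 2) / Real.log x := by
    have h1 := sum_insert_two_primeFactors_le hn hx
    have h2 := hK x hx
    rw [add_div]
    linarith
  have hsmall : (K + 2) / Real.log x < (1 / 2 : ℝ) ^ t := by
    rw [div_lt_iff₀ hlogx, one_div, inv_pow, ← div_eq_inv_mul, lt_div_iff₀ (by positivity)]
    linarith
  have hfactor : 1 - (1 / 2 : ℝ) ^ t ≤ Real.exp (-(1 / 2 : ℝ) ^ t) := by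
    linarith [Real.add_one_le_exp (-(1 / 2 : ℝ) ^ t)]
  rw [sum_divisors_eq_mul_prod hn]
  calc n * ∏ p ∈ n.primeFactors, ∑ i ∈ range (n.factorization p + 1), ((p : ℝ)⁻¹) ^ i
      ≤ n * (Real.exp (-(1 / 2 : ℝ) ^ t) *
          Real.exp (∑ p ∈ insert 2 n.primeFactors, logEulerFactor 0 p)) := by
        gcongr
        exact (prod_geom_sum_inv_le hn hfree).trans (by gcongr)
    _ < n * Real.exp (Real.eulerMascheroniConstant + Real.log (Real.log x)) := by
        rw [← Real.exp_add]
        exact mul_lt_mul_of_pos_left (Real.exp_lt_exp.mpr (by linarith)) hn0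
    _ = _ := by
        rw [Real.exp_add, Real.exp_log hlogx]
        ring

lemma eventually_two_pow_mul_lt_log {T : ℕ → ℕ}
    (hslow : Tendsto (fun n : ℕ => (T n : ℝ) / Real.log (Real.log n)) atTop (nhds 0)) (K : ℝ) :
    ∀ᶠ n : ℕ in atTop, 2 ^ T n * K < Real.log (n * Real.log 2) := by
  have hloglog : Tendsto (fun n : ℕ => Real.log (Real.log n)) atTop atTop :=
    Real.tendsto_log_atTop.comp (Real.tendsto_log_atTop.comp tendsto_natCast_atTop_atTop)
  have hlog : Tendsto (fun n : ℕ => Real.log n) atTop atTop :=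
    Real.tendsto_log_atTop.comp tendsto_natCast_atTop_atTop
  have hlog2 : 0 < Real.log 2 := Real.log_pos one_lt_two
  filter_upwards [hslow.eventually_lt_const (u := 1 / 2) (by norm_num),
    hloglog.eventually_gt_atTop 0, hlog.eventually_gt_atTop (4 * K ^ 2),
    hlog.eventually_gt_atTop (-2 * Real.log (Real.log 2)), hlog.eventually_gt_atTop 0,
    eventually_gt_atTop 0] with n hT hpos hK hc hL hn
  have hn0 : (n : ℝ) ≠ 0 := by exact_mod_cast hn.ne'
  rw [div_lt_iff₀ hpos] at hT
  set L := Real.log n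
  have hpow : (2 : ℝ) ^ T n ≤ √L := by
    calc (2 : ℝ) ^ T n ≤ Real.exp 1 ^ T n := by
          gcongr
          linarith [Real.add_one_le_exp 1]
      _ = Real.exp (T n) := by rw [← Real.exp_nat_mul, mul_one]
      _ ≤ Real.exp (Real.log L / 2) := Real.exp_le_exp.mpr (by linarith)
      _ = √L := by rw [Real.exp_half, Real.exp_log hL]
  have hKL : 2 * |K| < √L := by
    refine Real.lt_sqrt_of_sq_lt ?_
    rw [mul_pow, sq_abs]
    linarith
  have hmul : 2 ^ T n * K ≤ √L * |K| :=
    (mul_le_mul_of_nonneg_left (le_abs_self K) (by positivity)).trans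
      (mul_le_mul_of_nonneg_right hpow (abs_nonneg K))
  rw [Real.log_mul hn0 hlog2.ne']
  nlinarith [Real.mul_self_sqrt hL.le, Real.sqrt_nonneg L, abs_nonneg K]

theorem robin_of_slowly_varying_t (S : ℕ → ℕ) (T : ℕ → ℕ)
    (hS : ∀ n, 0 < S n) (hT : ∀ n, 2 ≤ T n)
    (hSN : ∀ᶠ n in atTop, primorialAt n ≤ S n)
    (hfree : ∀ n, ∀ p : ℕ, p.Prime → ¬ p ^ T n ∣ S n)
    (hslow : Tendsto (fun n : ℕ => (T n : ℝ) / Real.log (Real.log n)) atTop (nhds 0)) :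
    ∀ᶠ n in atTop, ((∑ d ∈ (S n).divisors, d : ℕ) : ℝ) <
      Real.exp Real.eulerMascheroniConstant * (S n : ℝ) * Real.log (Real.log (S n)) := by
  obtain ⟨K, hK⟩ := exists_robin_of_two_pow_mul_lt
  have hlog2 : 0 < Real.log 2 := Real.log_pos one_lt_two
  have hlarge : Tendsto (fun n : ℕ => (n : ℝ) * Real.log 2) atTop atTop :=
    tendsto_natCast_atTop_atTop.atTop_mul_const hlog2
  filter_upwards [hSN, eventually_two_pow_mul_lt_log hslow K, hlarge.eventually_ge_atTop 3]
    with n hSn hlt h3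
  have hlog : n * Real.log 2 ≤ Real.log (S n) := by
    rw [← Real.log_pow]
    exact Real.log_le_log (by positivity)
      (by exact_mod_cast (two_pow_le_primorialAt n).trans hSn)
  exact hK (S n) (T n) (hS n) (hfree n) (h3.trans hlog)
    (hlt.trans_le (Real.log_le_log (by linarith) hlog))
end
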